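/- Long-time behavior when the ergodic constant vanishes: let m > 2, f ∈ C(Ω̄), u₀ ∈ C(Ω̄) and g ∈ C(∂Ω) with u₀ = g on ∂Ω, and let u be the unique continuous viscosity solution of E(Ω,f,g,u₀,0). Let c ∈ ℝ and u_∞ be an ergodic pair, i.e. u_∞ is a viscosity solution of Erg(Ω,f,c) which is Hölder continuous on Ω̄ with exponent (m−2)/(m−1) and locally Lipschitz in Ω. If c = 0, then: (a) every continuous viscosity solution of the generalized Dirichlet problem S(Ω,f,g,0) has the form u_∞ − C for some constant C ∈ ℝ satisfying u_∞ − C ≤ g on ∂Ω; and (b) there exists a constant C̃ ∈ ℝ (depending on f, c, u₀ and g), with u_∞ − C̃ ≤ g on ∂Ω, such that u(·,t) converges uniformly on Ω̄ to u_∞ − C̃ as t → +∞. -/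

import Mathlib

open Set Filter Topology Metric MeasureTheory

noncomputable section

/-- Euclidean space `ℝ^N`. -/
abbrev Euc (N : ℕ) : Type := EuclideanSpace ℝ (Fin N)

/-- The Laplacian of `φ` at `x`, computed as the trace of the second derivative
in the standard orthonormal basis of `ℝ^N`. -/
noncomputable def lapl {N : ℕ} (φ : Euc N → ℝ) (x : Euc N) : ℝ :=
  ∑ i : Fin N,
    iteratedFDeriv ℝ 2 φ x ![EuclideanSpace.single i 1, EuclideanSpace.single i 1]

/-- `Ω` is a domain with `C²` boundary: it is the sublevel set of a `C²`
defining function whose gradient does not vanish on the boundary. -/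
def HasC2Boundary {N : ℕ} (Ω : Set (Euc N)) : Prop :=
  ∃ ρ : Euc N → ℝ, ContDiff ℝ 2 ρ ∧ Ω = {x | ρ x < 0} ∧
    frontier Ω = {x | ρ x = 0} ∧ ∀ x ∈ frontier Ω, gradient ρ x ≠ 0

/-- The stationary operator `−Δφ(x) + |Dφ(x)|^m + λ r − h(x)` evaluated with the
value `r` of the (sub/super)solution at `x`. -/
noncomputable def statOp {N : ℕ} (h : Euc N → ℝ) (lam m : ℝ)
    (φ : Euc N → ℝ) (r : ℝ) (x : Euc N) : ℝ :=
  -lapl φ x + ‖gradient φ x‖ ^ m + lam * r - h x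

/-- Viscosity subsolution of the generalized Dirichlet problem
`S(Ω,h,k,λ)`: `−Δw + |Dw|^m + λ w = h` in `Ω`, `w = k` on `∂Ω`. -/
def IsStatSub {N : ℕ} (Ω : Set (Euc N)) (h k : Euc N → ℝ) (lam m : ℝ)
    (u : Euc N → ℝ) : Prop :=
  UpperSemicontinuousOn u (closure Ω) ∧
  ∀ φ : Euc N → ℝ, ContDiff ℝ 2 φ → ∀ x₀ ∈ closure Ω,
    IsLocalMaxOn (u - φ) (closure Ω) x₀ →
      (x₀ ∈ Ω → statOp h lam m φ (u x₀) x₀ ≤ 0) ∧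
      (x₀ ∈ frontier Ω → min (statOp h lam m φ (u x₀) x₀) (u x₀ - k x₀) ≤ 0)

/-- Viscosity supersolution of the generalized Dirichlet problem `S(Ω,h,k,λ)`. -/
def IsStatSuper {N : ℕ} (Ω : Set (Euc N)) (h k : Euc N → ℝ) (lam m : ℝ)
    (v : Euc N → ℝ) : Prop :=
  LowerSemicontinuousOn v (closure Ω) ∧
  ∀ φ : Euc N → ℝ, ContDiff ℝ 2 φ → ∀ x₀ ∈ closure Ω,
    IsLocalMinOn (v - φ) (closure Ω) x₀ →
      (x₀ ∈ Ω → 0 ≤ statOp h lam m φ (v x₀) x₀) ∧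
      (x₀ ∈ frontier Ω → 0 ≤ max (statOp h lam m φ (v x₀) x₀) (v x₀ - k x₀))

/-- The parabolic operator
`φ_t(x,t) − Δφ(·,t)(x) + |Dφ(·,t)(x)|^m + λ r − f(x)`. -/
noncomputable def parOp {N : ℕ} (f : Euc N → ℝ) (lam m : ℝ)
    (φ : Euc N × ℝ → ℝ) (r : ℝ) (x : Euc N) (t : ℝ) : ℝ :=
  deriv (fun s => φ (x, s)) t - lapl (fun y => φ (y, t)) x
    + ‖gradient (fun y => φ (y, t)) x‖ ^ m + lam * r - f x

/-- Viscosity subsolution of the generalized initial-boundary value problem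
`E(Ω,f,g,u₀,λ)` on the time interval `[0,T]`:
`u_t − Δu + |Du|^m + λ u = f` in `Ω × (0,T]`, `u = g` on `∂Ω × (0,T]`,
`u(·,0) = u₀` on `closure Ω`. -/
def IsParSub {N : ℕ} (Ω : Set (Euc N)) (f g u₀ : Euc N → ℝ) (lam m T : ℝ)
    (u : Euc N → ℝ → ℝ) : Prop :=
  UpperSemicontinuousOn (fun p : Euc N × ℝ => u p.1 p.2) (closure Ω ×ˢ Ico 0 T) ∧
  (∀ x ∈ closure Ω, u x 0 ≤ u₀ x) ∧
  ∀ φ : Euc N × ℝ → ℝ, ContDiff ℝ 2 φ → ∀ x₀ : Euc N, ∀ t₀ : ℝ,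
    (x₀, t₀) ∈ closure Ω ×ˢ Ioc 0 T →
    IsLocalMaxOn (fun p : Euc N × ℝ => u p.1 p.2 - φ p) (closure Ω ×ˢ Ioc 0 T) (x₀, t₀) →
      (x₀ ∈ Ω → parOp f lam m φ (u x₀ t₀) x₀ t₀ ≤ 0) ∧
      (x₀ ∈ frontier Ω →
        min (parOp f lam m φ (u x₀ t₀) x₀ t₀) (u x₀ t₀ - g x₀) ≤ 0)

/-- Viscosity supersolution of `E(Ω,f,g,u₀,λ)` on the time interval `[0,T]`. -/
def IsParSuper {N : ℕ} (Ω : Set (Euc N)) (f g u₀ : Euc N → ℝ) (lam m T : ℝ)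
    (v : Euc N → ℝ → ℝ) : Prop :=
  LowerSemicontinuousOn (fun p : Euc N × ℝ => v p.1 p.2) (closure Ω ×ˢ Icc 0 T) ∧
  (∀ x ∈ closure Ω, u₀ x ≤ v x 0) ∧
  ∀ φ : Euc N × ℝ → ℝ, ContDiff ℝ 2 φ → ∀ x₀ : Euc N, ∀ t₀ : ℝ,
    (x₀, t₀) ∈ closure Ω ×ˢ Ioc 0 T →
    IsLocalMinOn (fun p : Euc N × ℝ => v p.1 p.2 - φ p) (closure Ω ×ˢ Ioc 0 T) (x₀, t₀) →
      (x₀ ∈ Ω → 0 ≤ parOp f lam m φ (v x₀ t₀) x₀ t₀) ∧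
      (x₀ ∈ frontier Ω →
        0 ≤ max (parOp f lam m φ (v x₀ t₀) x₀ t₀) (v x₀ t₀ - g x₀))

/-- A continuous viscosity solution, global in time, of `E(Ω,f,g,u₀,λ)`. -/
def IsGlobalParSol {N : ℕ} (Ω : Set (Euc N)) (f g u₀ : Euc N → ℝ) (lam m : ℝ)
    (u : Euc N → ℝ → ℝ) : Prop :=
  ContinuousOn (fun p : Euc N × ℝ => u p.1 p.2) (closure Ω ×ˢ Ici 0) ∧
  ∀ T > (0 : ℝ), IsParSub Ω f g u₀ lam m T u ∧ IsParSuper Ω f g u₀ lam m T u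

open scoped Classical in
/-- Redefinition of a parabolic subsolution on the lateral boundary by its
`limsup` from inside `Ω × (0,T]`. -/
noncomputable def uscExtPar {N : ℕ} (Ω : Set (Euc N)) (T : ℝ)
    (u : Euc N → ℝ → ℝ) : Euc N → ℝ → ℝ :=
  fun z t => if z ∈ Ω then u z t
    else limsup (fun p : Euc N × ℝ => u p.1 p.2) (𝓝[Ω ×ˢ Ioc 0 T] (z, t))

open scoped Classical in
/-- Redefinition of a stationary subsolution on the boundary by its `limsup`
from inside `Ω`. -/
noncomputable def uscExtStat {N : ℕ} (Ω : Set (Euc N))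
    (u : Euc N → ℝ) : Euc N → ℝ :=
  fun z => if z ∈ Ω then u z else limsup u (𝓝[Ω] z)

/-- Continuous viscosity solution of the state constraint problem
`−Δw + |Dw|^m + λ w = h` in `Ω`, `−Δw + |Dw|^m + λ w ≥ h` on `∂Ω`. -/
def IsSCSolution {N : ℕ} (Ω : Set (Euc N)) (h : Euc N → ℝ) (lam m : ℝ)
    (w : Euc N → ℝ) : Prop :=
  ContinuousOn w (closure Ω) ∧
  (∀ φ : Euc N → ℝ, ContDiff ℝ 2 φ → ∀ x₀ ∈ Ω, IsLocalMaxOn (w - φ) Ω x₀ →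
      statOp h lam m φ (w x₀) x₀ ≤ 0) ∧
  (∀ φ : Euc N → ℝ, ContDiff ℝ 2 φ → ∀ x₀ ∈ closure Ω,
      IsLocalMinOn (w - φ) (closure Ω) x₀ → 0 ≤ statOp h lam m φ (w x₀) x₀)

/-- Continuous viscosity subsolution of `−Δu + |Du|^m ≤ h` in `Ω`
(no boundary condition). -/
def IsIntSub {N : ℕ} (Ω : Set (Euc N)) (h : Euc N → ℝ) (m : ℝ)
    (u : Euc N → ℝ) : Prop :=
  ∀ φ : Euc N → ℝ, ContDiff ℝ 2 φ → ∀ x₀ ∈ Ω, IsLocalMaxOn (u - φ) Ω x₀ →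
    statOp h 0 m φ (u x₀) x₀ ≤ 0

/-- Hölder continuity with exponent `α` on a set. -/
def HolderOnCl {N : ℕ} (α : ℝ) (s : Set (Euc N)) (w : Euc N → ℝ) : Prop :=
  ∃ C > (0 : ℝ), ∀ x ∈ s, ∀ y ∈ s, |w x - w y| ≤ C * ‖x - y‖ ^ α

/-- Local Lipschitz continuity inside `Ω`. -/
def LocLipIn {N : ℕ} (Ω : Set (Euc N)) (w : Euc N → ℝ) : Prop :=
  ∀ x ∈ Ω, ∃ ε > (0 : ℝ), ∃ K : ℝ, 0 ≤ K ∧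
    ∀ y ∈ ball x ε ∩ Ω, ∀ z ∈ ball x ε ∩ Ω, |w y - w z| ≤ K * ‖y - z‖

/-- A piecewise `C¹` path parametrized on `[0,1]`. -/
def IsPWC1Path {N : ℕ} (γ : ℝ → Euc N) : Prop :=
  ContinuousOn γ (Icc 0 1) ∧
  ∃ n : ℕ, ∃ τ : Fin (n + 1) → ℝ, StrictMono τ ∧ τ 0 = 0 ∧ τ (Fin.last n) = 1 ∧
    ∀ i : Fin n, ContDiffOn ℝ 1 γ (Icc (τ i.castSucc) (τ i.succ))

/-- The length of a path on `[0,1]`. -/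
noncomputable def pathLen {N : ℕ} (γ : ℝ → Euc N) : ℝ :=
  ∫ t in (0 : ℝ)..1, ‖derivWithin γ (Icc (0 : ℝ) 1) t‖

/-- The geodesic-type distance inside `closure S` via piecewise `C¹` paths. -/
noncomputable def dTilde {N : ℕ} (S : Set (Euc N)) (x y : Euc N) : ℝ :=
  sInf {L : ℝ | ∃ γ : ℝ → Euc N, IsPWC1Path γ ∧ γ 0 = x ∧ γ 1 = y ∧
    MapsTo γ (Icc 0 1) (closure S) ∧ L = pathLen γ}

/-- The inner parallel set `Ω_δ = {x ∈ Ω : dist(x,∂Ω) > δ}`. -/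
def innerSet {N : ℕ} (Ω : Set (Euc N)) (δ : ℝ) : Set (Euc N) :=
  {x ∈ Ω | δ < infDist x (frontier Ω)}

end


/-! ### Part 1: calculus of jets -/

section JetCalculus

variable {N : ℕ}

lemma lapl_eq (φ : Euc N → ℝ) (x : Euc N) :
    lapl φ x = ∑ i : Fin N, fderiv ℝ (fderiv ℝ φ) x (EuclideanSpace.single i 1)
      (EuclideanSpace.single i 1) := by
  unfold lapl
  refine Finset.sum_congr rfl fun i _ => ?_
  rw [iteratedFDeriv_two_apply]
  simp

lemma inner_gradient (φ : Euc N → ℝ) (x d : Euc N) :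
    inner ℝ (gradient φ x) d = fderiv ℝ φ x d := by
  unfold gradient
  rw [InnerProductSpace.toDual_symm_apply]

lemma gradient_ext {φ : Euc N → ℝ} {x v : Euc N} (h : ∀ d, fderiv ℝ φ x d = inner ℝ v d) :
    gradient φ x = v := by
  refine ext_inner_right ℝ fun d => ?_
  rw [inner_gradient, h]

lemma fderiv_differentiableAt {E : Type*} [NormedAddCommGroup E] [NormedSpace ℝ E]
    {φ : E → ℝ} {x : E} (h : ContDiffAt ℝ 2 φ x) :
    DifferentiableAt ℝ (fderiv ℝ φ) x :=
  (h.fderiv_right (m := 1) (by norm_num)).differentiableAt (by norm_num)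

lemma eventually_differentiableAt {E : Type*} [NormedAddCommGroup E] [NormedSpace ℝ E]
    {φ : E → ℝ} {x : E} (h : ContDiffAt ℝ 2 φ x) :
    ∀ᶠ y in 𝓝 x, DifferentiableAt ℝ φ y := by
  filter_upwards [h.eventually (by simp)] with y hy
  exact hy.differentiableAt (by norm_num)

lemma lapl_add {φ ψ : Euc N → ℝ} {x : Euc N} (h1 : ContDiffAt ℝ 2 φ x)
    (h2 : ContDiffAt ℝ 2 ψ x) : lapl (fun y => φ y + ψ y) x = lapl φ x + lapl ψ x := by
  simp only [lapl_eq]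
  rw [← Finset.sum_add_distrib]
  refine Finset.sum_congr rfl fun i _ => ?_
  have : fderiv ℝ (fun y => φ y + ψ y) =ᶠ[𝓝 x] fun y => fderiv ℝ φ y + fderiv ℝ ψ y := by
    filter_upwards [eventually_differentiableAt h1, eventually_differentiableAt h2] with y ha hb
    exact fderiv_fun_add ha hb
  rw [this.fderiv_eq, fderiv_fun_add (fderiv_differentiableAt h1) (fderiv_differentiableAt h2)]
  rfl

lemma lapl_const_mul (c : ℝ) {φ : Euc N → ℝ} {x : Euc N} (h1 : ContDiffAt ℝ 2 φ x) :
    lapl (fun y => c * φ y) x = c * lapl φ x := by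
  simp only [lapl_eq]
  rw [Finset.mul_sum]
  refine Finset.sum_congr rfl fun i _ => ?_
  have : fderiv ℝ (fun y => c * φ y) =ᶠ[𝓝 x] fun y => c • fderiv ℝ φ y := by
    filter_upwards [eventually_differentiableAt h1] with y ha
    exact fderiv_const_mul ha c
  rw [this.fderiv_eq, fderiv_fun_const_smul (fderiv_differentiableAt h1)]
  rfl

lemma lapl_const (c : ℝ) (x : Euc N) : lapl (fun _ => c) x = 0 := by
  simp [lapl_eq]

lemma gradient_add {φ ψ : Euc N → ℝ} {x : Euc N} (h1 : DifferentiableAt ℝ φ x)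
    (h2 : DifferentiableAt ℝ ψ x) :
    gradient (fun y => φ y + ψ y) x = gradient φ x + gradient ψ x := by
  refine gradient_ext fun d => ?_
  rw [fderiv_fun_add h1 h2, inner_add_left, inner_gradient, inner_gradient]; rfl

lemma gradient_const_mul (c : ℝ) {φ : Euc N → ℝ} {x : Euc N} (h1 : DifferentiableAt ℝ φ x) :
    gradient (fun y => c * φ y) x = c • gradient φ x := by
  refine gradient_ext fun d => ?_
  rw [fderiv_const_mul h1, inner_smul_left, inner_gradient]; rfl

lemma gradient_cst (c : ℝ) (x : Euc N) : gradient (fun _ : Euc N => c) x = 0 := by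
  refine gradient_ext fun d => ?_
  simp

lemma sum_fderiv_sq (φ : Euc N → ℝ) (x : Euc N) :
    ∑ i : Fin N, (fderiv ℝ φ x (EuclideanSpace.single i 1)) ^ 2 = ‖gradient φ x‖ ^ 2 := by
  rw [EuclideanSpace.norm_sq_eq]
  refine Finset.sum_congr rfl fun i _ => ?_
  rw [← inner_gradient, EuclideanSpace.inner_single_right]
  simp

lemma lapl_sq {φ : Euc N → ℝ} {x : Euc N} (h1 : ContDiffAt ℝ 2 φ x) :
    lapl (fun y => φ y ^ 2) x = 2 * ‖gradient φ x‖ ^ 2 + 2 * φ x * lapl φ x := by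
  simp only [lapl_eq]
  rw [Finset.mul_sum, ← sum_fderiv_sq, Finset.mul_sum, ← Finset.sum_add_distrib]
  refine Finset.sum_congr rfl fun i _ => ?_
  have : fderiv ℝ (fun y => φ y ^ 2) =ᶠ[𝓝 x] fun y => (2 * φ y) • fderiv ℝ φ y := by
    filter_upwards [eventually_differentiableAt h1] with y ha
    rw [fderiv_fun_pow 2 ha]
    simp
  rw [this.fderiv_eq, fderiv_fun_smul ((h1.differentiableAt (by norm_num)).const_mul 2)
    (fderiv_differentiableAt h1), fderiv_const_mul (h1.differentiableAt (by norm_num))]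
  simp
  ring

lemma gradient_sq {φ : Euc N → ℝ} {x : Euc N} (h1 : DifferentiableAt ℝ φ x) :
    gradient (fun y => φ y ^ 2) x = (2 * φ x) • gradient φ x := by
  refine gradient_ext fun d => ?_
  rw [fderiv_fun_pow 2 h1, inner_smul_left, inner_gradient]; simp

lemma contDiff_normsq (a : Euc N) {n : WithTop ℕ∞} :
    ContDiff ℝ n (fun y : Euc N => ‖y - a‖ ^ 2) :=
  (contDiff_id.sub contDiff_const).norm_sq ℝ

lemma fderiv_normsq (a x d : Euc N) :
    fderiv ℝ (fun y : Euc N => ‖y - a‖ ^ 2) x d = 2 * inner ℝ (x - a) d := by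
  have := ((hasFDerivAt_id x).sub_const a).norm_sq
  simp only [id] at this
  rw [this.fderiv]; simp [inner_sub_left]

lemma gradient_normsq (a x : Euc N) :
    gradient (fun y : Euc N => ‖y - a‖ ^ 2) x = (2 : ℝ) • (x - a) := by
  refine gradient_ext fun d => ?_
  rw [fderiv_normsq, inner_smul_left]; simp

lemma lapl_normsq (a x : Euc N) :
    lapl (fun y : Euc N => ‖y - a‖ ^ 2) x = 2 * N := by
  rw [lapl_eq]
  have : fderiv ℝ (fun y : Euc N => ‖y - a‖ ^ 2) =
      fun y => (2 : ℝ) • innerSL ℝ (y - a) := by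
    funext y; ext d; rw [fderiv_normsq]; simp [inner_sub_left]
  rw [this]
  have h2 : ∀ i : Fin N, fderiv ℝ (fun y : Euc N => (2 : ℝ) • innerSL ℝ (y - a)) x
      (EuclideanSpace.single i 1) (EuclideanSpace.single i 1) = 2 := by
    intro i
    have h3 : HasFDerivAt (fun y : Euc N => (2 : ℝ) • innerSL ℝ (y - a))
        ((2 : ℝ) • (innerSL ℝ : Euc N →L[ℝ] Euc N →L[ℝ] ℝ)) x := by
      exact (HasFDerivAt.comp (g := (innerSL ℝ : Euc N →L[ℝ] Euc N →L[ℝ] ℝ)) x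
        (innerSL ℝ : Euc N →L[ℝ] Euc N →L[ℝ] ℝ).hasFDerivAt
        ((hasFDerivAt_id x).sub_const a)).const_smul (2 : ℝ)
    rw [h3.fderiv]
    change (2 : ℝ) * inner ℝ (EuclideanSpace.single i 1 : Euc N) (EuclideanSpace.single i 1) = 2
    rw [EuclideanSpace.inner_single_left]
    simp
  simp only [h2]
  simp [mul_comm]

/-! Parabolic jets -/

noncomputable def dt (φ : Euc N × ℝ → ℝ) (p : Euc N × ℝ) : ℝ :=
  deriv (fun s => φ (p.1, s)) p.2
noncomputable def lpl (φ : Euc N × ℝ → ℝ) (p : Euc N × ℝ) : ℝ :=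
  lapl (fun y => φ (y, p.2)) p.1
noncomputable def gr (φ : Euc N × ℝ → ℝ) (p : Euc N × ℝ) : Euc N :=
  gradient (fun y => φ (y, p.2)) p.1

lemma hasFDerivAt_slice {F : Type*} [NormedAddCommGroup F] [NormedSpace ℝ F]
    {φ : Euc N × ℝ → F} {x : Euc N} {t : ℝ}
    (h : DifferentiableAt ℝ φ (x, t)) :
    HasFDerivAt (fun y => φ (y, t))
      ((fderiv ℝ φ (x, t)).comp (ContinuousLinearMap.inl ℝ (Euc N) ℝ)) x := by
  have h0 : HasFDerivAt (fun y : Euc N => (y, t)) (ContinuousLinearMap.inl ℝ (Euc N) ℝ) x :=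
    hasFDerivAt_prodMk_left x t
  exact HasFDerivAt.comp (g := φ) x h.hasFDerivAt h0

lemma dt_eq {φ : Euc N × ℝ → ℝ} {p : Euc N × ℝ} (h : DifferentiableAt ℝ φ p) :
    dt φ p = fderiv ℝ φ p (0, 1) := by
  have h0 : HasDerivAt (fun s : ℝ => (p.1, s)) ((0 : Euc N), (1 : ℝ)) p.2 :=
    (hasDerivAt_const _ _).prodMk (hasDerivAt_id _)
  have := HasFDerivAt.comp_hasDerivAt (l := φ) p.2 (h.hasFDerivAt) h0
  exact this.deriv

lemma gr_inner {φ : Euc N × ℝ → ℝ} {p : Euc N × ℝ} (h : DifferentiableAt ℝ φ p) (d : Euc N) :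
    inner ℝ (gr φ p) d = fderiv ℝ φ p (d, 0) := by
  unfold gr
  rw [inner_gradient, (hasFDerivAt_slice (x := p.1) (t := p.2) h).fderiv]
  simp

lemma lpl_eq {φ : Euc N × ℝ → ℝ} {p : Euc N × ℝ} (h : ContDiffAt ℝ 2 φ p) :
    lpl φ p = ∑ i : Fin N, fderiv ℝ (fderiv ℝ φ) p (EuclideanSpace.single i 1, 0)
      (EuclideanSpace.single i 1, 0) := by
  unfold lpl
  rw [lapl_eq]
  refine Finset.sum_congr rfl fun i _ => ?_
  have hc : ContinuousAt (fun y : Euc N => (y, p.2)) p.1 := by fun_prop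
  have h1 : fderiv ℝ (fun y => φ (y, p.2)) =ᶠ[𝓝 p.1] fun y =>
      (fderiv ℝ φ (y, p.2)).comp (ContinuousLinearMap.inl ℝ (Euc N) ℝ) := by
    filter_upwards [hc.eventually (eventually_differentiableAt h)] with y hy
    exact (hasFDerivAt_slice hy).fderiv
  rw [h1.fderiv_eq]
  have h2 := hasFDerivAt_slice (x := p.1) (t := p.2) (fderiv_differentiableAt h)
  have h3 := h2.clm_comp (hasFDerivAt_const (ContinuousLinearMap.inl ℝ (Euc N) ℝ) p.1)
  rw [h3.fderiv]
  simp

lemma slice_contDiffAt {φ : Euc N × ℝ → ℝ} {p : Euc N × ℝ} (h : ContDiffAt ℝ 2 φ p) :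
    ContDiffAt ℝ 2 (fun y => φ (y, p.2)) p.1 :=
  ContDiffAt.comp (g := φ) p.1 h (by fun_prop)

lemma slice_differentiableAt {φ : Euc N × ℝ → ℝ} {p : Euc N × ℝ} (h : DifferentiableAt ℝ φ p) :
    DifferentiableAt ℝ (fun y => φ (y, p.2)) p.1 :=
  DifferentiableAt.comp (g := φ) p.1 h (by fun_prop)

lemma tslice_differentiableAt {φ : Euc N × ℝ → ℝ} {p : Euc N × ℝ} (h : DifferentiableAt ℝ φ p) :
    DifferentiableAt ℝ (fun s => φ (p.1, s)) p.2 :=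
  DifferentiableAt.comp (g := φ) p.2 h (by fun_prop)

lemma lpl_add {φ ψ : Euc N × ℝ → ℝ} {p : Euc N × ℝ} (h1 : ContDiffAt ℝ 2 φ p)
    (h2 : ContDiffAt ℝ 2 ψ p) : lpl (fun q => φ q + ψ q) p = lpl φ p + lpl ψ p :=
  lapl_add (slice_contDiffAt h1) (slice_contDiffAt h2)

lemma lpl_const_mul (c : ℝ) {φ : Euc N × ℝ → ℝ} {p : Euc N × ℝ} (h1 : ContDiffAt ℝ 2 φ p) :
    lpl (fun q => c * φ q) p = c * lpl φ p :=
  lapl_const_mul c (slice_contDiffAt h1)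

lemma gr_add {φ ψ : Euc N × ℝ → ℝ} {p : Euc N × ℝ} (h1 : DifferentiableAt ℝ φ p)
    (h2 : DifferentiableAt ℝ ψ p) : gr (fun q => φ q + ψ q) p = gr φ p + gr ψ p :=
  gradient_add (slice_differentiableAt h1) (slice_differentiableAt h2)

lemma gr_const_mul (c : ℝ) {φ : Euc N × ℝ → ℝ} {p : Euc N × ℝ} (h1 : DifferentiableAt ℝ φ p) :
    gr (fun q => c * φ q) p = c • gr φ p :=
  gradient_const_mul c (slice_differentiableAt h1)

lemma dt_add {φ ψ : Euc N × ℝ → ℝ} {p : Euc N × ℝ} (h1 : DifferentiableAt ℝ φ p)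
    (h2 : DifferentiableAt ℝ ψ p) : dt (fun q => φ q + ψ q) p = dt φ p + dt ψ p :=
  deriv_fun_add (tslice_differentiableAt h1) (tslice_differentiableAt h2)

lemma dt_const_mul (c : ℝ) {φ : Euc N × ℝ → ℝ} {p : Euc N × ℝ} (h1 : DifferentiableAt ℝ φ p) :
    dt (fun q => c * φ q) p = c * dt φ p :=
  deriv_const_mul c (tslice_differentiableAt h1)

lemma lpl_sq {φ : Euc N × ℝ → ℝ} {p : Euc N × ℝ} (h1 : ContDiffAt ℝ 2 φ p) :
    lpl (fun q => φ q ^ 2) p = 2 * ‖gr φ p‖ ^ 2 + 2 * φ p * lpl φ p :=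
  lapl_sq (slice_contDiffAt h1)

lemma gr_sq {φ : Euc N × ℝ → ℝ} {p : Euc N × ℝ} (h1 : DifferentiableAt ℝ φ p) :
    gr (fun q => φ q ^ 2) p = (2 * φ p) • gr φ p :=
  gradient_sq (slice_differentiableAt h1)

lemma dt_sq {φ : Euc N × ℝ → ℝ} {p : Euc N × ℝ} (h1 : DifferentiableAt ℝ φ p) :
    dt (fun q => φ q ^ 2) p = 2 * φ p * dt φ p := by
  unfold dt
  rw [deriv_fun_pow (tslice_differentiableAt h1)]
  simp

lemma parOp_eq (f : Euc N → ℝ) (m : ℝ) (φ : Euc N × ℝ → ℝ) (r : ℝ) (p : Euc N × ℝ) :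
    parOp f 0 m φ r p.1 p.2 = dt φ p - lpl φ p + ‖gr φ p‖ ^ m - f p.1 := by
  unfold parOp dt lpl gr; simp

lemma jets_congr {φ ψ : Euc N × ℝ → ℝ} {p : Euc N × ℝ} (h : φ =ᶠ[𝓝 p] ψ) :
    dt φ p = dt ψ p ∧ lpl φ p = lpl ψ p ∧ gr φ p = gr ψ p := by
  have hc : ContinuousAt (fun y : Euc N => (y, p.2)) p.1 := by fun_prop
  have hc2 : ContinuousAt (fun s : ℝ => (p.1, s)) p.2 := by fun_prop
  have h1 : (fun y => φ (y, p.2)) =ᶠ[𝓝 p.1] fun y => ψ (y, p.2) := hc.eventually h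
  have h2 : (fun s => φ (p.1, s)) =ᶠ[𝓝 p.2] fun s => ψ (p.1, s) := hc2.eventually h
  refine ⟨h2.deriv_eq, ?_, ?_⟩
  · unfold lpl; rw [lapl_eq, lapl_eq, h1.fderiv.fderiv_eq]
  · unfold gr gradient; rw [h1.fderiv_eq]

lemma continuous_dt {φ : Euc N × ℝ → ℝ} (h : ContDiff ℝ 2 φ) : Continuous (dt φ) := by
  have : dt φ = fun p => fderiv ℝ φ p (0, 1) := by
    funext p; exact dt_eq (h.differentiable (by norm_num) p)
  rw [this]
  exact (h.continuous_fderiv (by norm_num)).clm_apply continuous_const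

lemma continuous_lpl {φ : Euc N × ℝ → ℝ} (h : ContDiff ℝ 2 φ) : Continuous (lpl φ) := by
  have : lpl φ = fun p => ∑ i : Fin N, fderiv ℝ (fderiv ℝ φ) p (EuclideanSpace.single i 1, 0)
      (EuclideanSpace.single i 1, 0) := by
    funext p; exact lpl_eq h.contDiffAt
  rw [this]
  have h2 : Continuous (fderiv ℝ (fderiv ℝ φ)) :=
    (h.fderiv_right (m := 1) (by norm_num)).continuous_fderiv (by norm_num)
  refine continuous_finsetSum _ fun i _ => ?_
  exact (h2.clm_apply continuous_const).clm_apply continuous_const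

lemma continuous_gr {φ : Euc N × ℝ → ℝ} (h : ContDiff ℝ 2 φ) : Continuous (gr φ) := by
  have : gr φ = fun p => (InnerProductSpace.toDual ℝ (Euc N)).symm
      ((fderiv ℝ φ p).comp (ContinuousLinearMap.inl ℝ (Euc N) ℝ)) := by
    funext p
    unfold gr gradient
    rw [(hasFDerivAt_slice (x := p.1) (t := p.2) (h.differentiable (by norm_num) _)).fderiv]
  rw [this]
  exact (LinearIsometryEquiv.continuous _).comp
    ((h.continuous_fderiv (by norm_num)).clm_comp continuous_const)

/-- Second derivative test in one variable. -/
lemma second_deriv_nonpos {h : ℝ → ℝ} (hmax : IsLocalMax h 0) (hc : ContDiffAt ℝ 2 h 0) :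
    deriv (deriv h) 0 ≤ 0 := by
  by_contra hpos
  push Not at hpos
  have h0 : deriv h 0 = 0 := hmax.deriv_eq_zero
  have hmin := isLocalMin_of_deriv_deriv_pos hpos h0 hc.continuousAt
  have heq : h =ᶠ[𝓝 0] fun _ => h 0 := by
    filter_upwards [hmax, hmin] with y h1 h2
    exact le_antisymm h1 h2
  have : deriv h =ᶠ[𝓝 0] deriv (fun _ => h 0) := heq.deriv
  rw [this.deriv_eq] at hpos
  simp at hpos

lemma line_second {E : Type*} [NormedAddCommGroup E] [NormedSpace ℝ E]
    {φ : E → ℝ} {x : E} (h : ContDiffAt ℝ 2 φ x) (d : E) :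
    deriv (deriv (fun s : ℝ => φ (x + s • d))) 0 = fderiv ℝ (fderiv ℝ φ) x d d := by
  have hl : ∀ s : ℝ, HasDerivAt (fun s : ℝ => x + s • d) d s := fun s => by
    simpa using ((hasDerivAt_id s).smul_const d).const_add x
  have hc : ContinuousAt (fun s : ℝ => x + s • d) 0 := (hl 0).continuousAt
  have hx : x + (0 : ℝ) • d = x := by simp
  have h1 : deriv (fun s : ℝ => φ (x + s • d)) =ᶠ[𝓝 0] fun s => fderiv ℝ φ (x + s • d) d := by
    have := hc.eventually (p := fun y => DifferentiableAt ℝ φ y)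
      (by beta_reduce; rw [hx]; exact eventually_differentiableAt h)
    filter_upwards [this] with s hs
    exact (HasFDerivAt.comp_hasDerivAt (l := φ) s hs.hasFDerivAt (hl s)).deriv
  rw [h1.deriv_eq]
  have h2 : HasFDerivAt (fderiv ℝ φ) (fderiv ℝ (fderiv ℝ φ) x) (x + (0 : ℝ) • d) := by
    rw [hx]; exact (fderiv_differentiableAt h).hasFDerivAt
  have h3 := HasFDerivAt.comp_hasDerivAt (l := fderiv ℝ φ) (0 : ℝ) h2 (hl 0)
  have h4 := h3.clm_apply (hasDerivAt_const (0 : ℝ) d)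
  simpa using h4.deriv

lemma lapl_nonpos {φ : Euc N → ℝ} {x : Euc N} (h : ContDiffAt ℝ 2 φ x) (hm : IsLocalMax φ x) :
    lapl φ x ≤ 0 := by
  rw [lapl_eq]
  refine Finset.sum_nonpos fun i _ => ?_
  rw [← line_second h]
  have hl : ContDiff ℝ 2 (fun s : ℝ => x + s • (EuclideanSpace.single i 1 : Euc N)) := by
    fun_prop
  have hx : x + (0 : ℝ) • (EuclideanSpace.single i 1 : Euc N) = x := by simp
  refine second_deriv_nonpos ?_ ?_
  · have hc : ContinuousAt (fun s : ℝ => x + s • (EuclideanSpace.single i 1 : Euc N)) 0 :=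
      hl.continuous.continuousAt
    have := hc.eventually (p := fun y => φ y ≤ φ x) (by beta_reduce; rw [hx]; exact hm)
    filter_upwards [this] with s hs
    simpa using hs
  · exact ContDiffAt.comp (g := φ) 0 (by rw [hx]; exact h) hl.contDiffAt

lemma deriv_nonneg_of_left_max {h : ℝ → ℝ} {t : ℝ} (hd : DifferentiableAt ℝ h t)
    (hm : ∀ᶠ s in 𝓝 t, s ≤ t → h s ≤ h t) : 0 ≤ deriv h t := by
  have h1 := (hasDerivAt_iff_tendsto_slope.1 hd.hasDerivAt).mono_left
    (nhdsWithin_mono t (fun s (hs : s ∈ Iio t) => ne_of_lt hs))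
  refine ge_of_tendsto h1 ?_
  filter_upwards [self_mem_nhdsWithin, hm.filter_mono nhdsWithin_le_nhds] with s hs hs2
  have hs' : s < t := hs
  rw [slope_def_field]
  exact div_nonneg_of_nonpos (by linarith [hs2 hs'.le]) (by linarith)

/-- jets at a one-sided (in time) maximum point. -/
lemma jets_max {W : Euc N × ℝ → ℝ} {p : Euc N × ℝ} (h : ContDiffAt ℝ 2 W p)
    (hm : ∀ᶠ q in 𝓝 p, q.2 ≤ p.2 → W q ≤ W p) :
    0 ≤ dt W p ∧ gr W p = 0 ∧ lpl W p ≤ 0 := by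
  have hc : ContinuousAt (fun y : Euc N => (y, p.2)) p.1 := by fun_prop
  have hc2 : ContinuousAt (fun s : ℝ => (p.1, s)) p.2 := by fun_prop
  have hx : IsLocalMax (fun y => W (y, p.2)) p.1 := by
    filter_upwards [hc.eventually hm] with y hy using hy le_rfl
  refine ⟨deriv_nonneg_of_left_max (tslice_differentiableAt (h.differentiableAt (by norm_num)))
    (hc2.eventually hm), ?_, lapl_nonpos (slice_contDiffAt h) hx⟩
  refine gradient_ext fun d => ?_
  rw [hx.fderiv_eq_zero]; simp

end JetCalculus


/-! ### Part 2: heat kernel -/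

section Heat

variable {N : ℕ}

def upperHalf (N : ℕ) : Set (Euc N × ℝ) := {p | 0 < p.2}

lemma isOpen_upperHalf : IsOpen (upperHalf N) := isOpen_lt continuous_const continuous_snd

lemma param_hasFDerivAt {F : Type*} [NormedAddCommGroup F] [NormedSpace ℝ F]
    {G : Euc N × ℝ → F} (hG : ContDiffOn ℝ 1 G (upperHalf N)) {v : Euc N → ℝ}
    (hv : Continuous v) (hvc : HasCompactSupport v) {p : Euc N × ℝ} (hp : 0 < p.2) :
    HasFDerivAt (fun q : Euc N × ℝ => ∫ y, v y • G (q.1 - y, q.2))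
      (∫ y, v y • fderiv ℝ G (p.1 - y, p.2)) p := by
  have hdG : ContinuousOn (fderiv ℝ G) (upperHalf N) :=
    hG.continuousOn_fderiv_of_isOpen isOpen_upperHalf le_rfl
  have hGd : ∀ q ∈ upperHalf N, HasFDerivAt G (fderiv ℝ G q) q := fun q hq =>
    ((hG.differentiableOn (by norm_num)).differentiableAt
      (isOpen_upperHalf.mem_nhds hq)).hasFDerivAt
  -- compact set of relevant points
  let K : Set ((Euc N × ℝ) × Euc N) := closedBall p (p.2 / 2) ×ˢ tsupport v
  have hK : IsCompact K := (isCompact_closedBall _ _).prod hvc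
  have hpos : ∀ q ∈ closedBall p (p.2 / 2), 0 < q.2 := by
    intro q hq
    have h1 : dist q.2 p.2 ≤ p.2 / 2 := le_trans (le_max_right _ _) hq
    rw [Real.dist_eq] at h1
    linarith [(abs_le.1 h1).1]
  have hcont : ContinuousOn (fun z : (Euc N × ℝ) × Euc N =>
      fderiv ℝ G (z.1.1 - z.2, z.1.2)) K := by
    refine hdG.comp (by fun_prop) ?_
    rintro ⟨q, y⟩ ⟨hq, -⟩
    exact hpos q hq
  obtain ⟨M, hM⟩ := hK.exists_bound_of_continuousOn hcont
  have hsub : ∀ q ∈ closedBall p (p.2 / 2), ContinuousOn (fun y : Euc N => G (q.1 - y, q.2)) univ := by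
    intro q hq
    exact hG.continuousOn.comp (by fun_prop) (fun y _ => hpos q hq)
  have hs : closedBall p (p.2 / 2) ∈ 𝓝 p := closedBall_mem_nhds _ (by linarith)
  have hcF : ∀ q ∈ closedBall p (p.2 / 2), Continuous (fun y => v y • G (q.1 - y, q.2)) := by
    intro q hq
    exact hv.smul (continuousOn_univ.1 (hsub q hq))
  have hpp : p ∈ closedBall p (p.2 / 2) := mem_closedBall_self (by linarith)
  refine hasFDerivAt_integral_of_dominated_of_fderiv_le
    (F' := fun q y => v y • fderiv ℝ G (q.1 - y, q.2)) (bound := fun y => |v y| * M) hs ?_ ?_ ?_ ?_ ?_ ?_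
  · filter_upwards [hs] with q hq using (hcF q hq).aestronglyMeasurable
  · exact (hcF p hpp).integrable_of_hasCompactSupport hvc.smul_right
  · have : SecondCountableTopologyEither (Euc N) (Euc N × ℝ →L[ℝ] F) := ⟨Or.inl inferInstance⟩
    refine Continuous.aestronglyMeasurable ?_
    refine hv.smul (continuousOn_univ.1 ?_)
    exact hdG.comp (by fun_prop) (fun y _ => hp)
  · refine Eventually.of_forall fun y q hq => ?_
    rw [norm_smul, Real.norm_eq_abs]
    by_cases hy : y ∈ tsupport v
    · exact mul_le_mul_of_nonneg_left (hM (q, y) ⟨hq, hy⟩) (abs_nonneg _)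
    · rw [image_eq_zero_of_notMem_tsupport hy]; simp
  · exact (hv.abs.mul continuous_const).integrable_of_hasCompactSupport (hvc.abs.mul_right)
  · refine Eventually.of_forall fun y q hq => ?_
    have h1 : HasFDerivAt (fun q : Euc N × ℝ => (q.1 - y, q.2))
        (ContinuousLinearMap.id ℝ (Euc N × ℝ)) q := by
      have h2 := (hasFDerivAt_id (𝕜 := ℝ) q).sub_const ((y, 0) : Euc N × ℝ)
      have e : (fun q : Euc N × ℝ => (q.1 - y, q.2)) =
          fun q => id q - ((y, 0) : Euc N × ℝ) := by
        funext q; simp [Prod.ext_iff]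
      rw [e]; exact h2
    have h3 := HasFDerivAt.comp (g := G) q (hGd (q.1 - y, q.2) (hpos q hq)) h1
    rw [ContinuousLinearMap.comp_id] at h3
    exact h3.const_smul (v y)

lemma param_integrable {F : Type*} [NormedAddCommGroup F] [NormedSpace ℝ F]
    {G : Euc N × ℝ → F} (hG : ContinuousOn G (upperHalf N)) {v : Euc N → ℝ}
    (hv : Continuous v) (hvc : HasCompactSupport v) {p : Euc N × ℝ} (hp : 0 < p.2) :
    Integrable (fun y => v y • G (p.1 - y, p.2)) := by
  refine Continuous.integrable_of_hasCompactSupport (hv.smul (continuousOn_univ.1 ?_))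
      hvc.smul_right
  exact hG.comp (by fun_prop) (fun y _ => hp)

/-- normalized Gaussian -/
noncomputable def gam (w : Euc N) : ℝ := (∫ z : Euc N, Real.exp (-‖z‖ ^ 2))⁻¹ * Real.exp (-‖w‖ ^ 2)

lemma gauss_pos : 0 < ∫ z : Euc N, Real.exp (-‖z‖ ^ 2) := by
  have := GaussianFourier.integral_rexp_neg_mul_sq_norm (V := Euc N) (b := 1) one_pos
  simp only [neg_mul, one_mul, div_one] at this
  rw [this]
  exact Real.rpow_pos_of_pos Real.pi_pos _

lemma gauss_integrable : Integrable (fun z : Euc N => Real.exp (-‖z‖ ^ 2)) := by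
  by_contra h
  have := gauss_pos (N := N)
  rw [integral_undef h] at this
  exact lt_irrefl _ this

lemma gam_integrable : Integrable (gam (N := N)) := gauss_integrable.const_mul _

lemma gam_integral : ∫ w : Euc N, gam w = 1 := by
  unfold gam
  rw [integral_const_mul]
  exact inv_mul_cancel₀ gauss_pos.ne'

lemma gam_nonneg (w : Euc N) : 0 ≤ gam w :=
  mul_nonneg (inv_nonneg.2 gauss_pos.le) (Real.exp_pos _).le

lemma gam_continuous : Continuous (gam (N := N)) := by
  unfold gam; fun_prop

noncomputable def heatV (b : Euc N) (v : Euc N → ℝ) (p : Euc N × ℝ) : ℝ :=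
  ∫ w, gam w * v (p.1 - p.2 • b - (2 * √p.2) • w)

lemma heatV_zero (b : Euc N) (v : Euc N → ℝ) (y : Euc N) : heatV b v (y, 0) = v y := by
  unfold heatV
  simp [integral_mul_const, gam_integral]

lemma gam_mul_integrable {h : Euc N → ℝ} (hc : Continuous h) {M : ℝ} (hM : ∀ w, |h w| ≤ M) :
    Integrable (fun w => gam w * h w) := by
  refine Integrable.mono' (gam_integrable.mul_const M) (gam_continuous.mul hc).aestronglyMeasurable
    (Eventually.of_forall fun w => ?_)
  rw [Real.norm_eq_abs, abs_mul, abs_of_nonneg (gam_nonneg w)]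
  exact mul_le_mul_of_nonneg_left (hM w) (gam_nonneg w)

lemma heatV_abs_le (b : Euc N) {v : Euc N → ℝ} {M : ℝ} (hM : ∀ y, |v y| ≤ M)
    (p : Euc N × ℝ) : |heatV b v p| ≤ M := by
  unfold heatV
  rw [← Real.norm_eq_abs]
  refine le_trans (norm_integral_le_of_norm_le (gam_integrable.mul_const M)
    (Eventually.of_forall fun w => ?_)) ?_
  · rw [Real.norm_eq_abs, abs_mul, abs_of_nonneg (gam_nonneg w)]
    exact mul_le_mul_of_nonneg_left (hM _) (gam_nonneg w)
  · rw [integral_mul_const, gam_integral, one_mul]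

lemma heatV_continuous (b : Euc N) {v : Euc N → ℝ} {M : ℝ} (hv : Continuous v)
    (hM : ∀ y, |v y| ≤ M) : Continuous (heatV b v) := by
  refine continuous_of_dominated (bound := fun w => gam w * M) ?_ ?_ (gam_integrable.mul_const M) ?_
  · intro p
    refine Continuous.aestronglyMeasurable (gam_continuous.mul (hv.comp (by fun_prop)))
  · intro p
    refine Eventually.of_forall fun w => ?_
    rw [Real.norm_eq_abs, abs_mul, abs_of_nonneg (gam_nonneg w)]
    exact mul_le_mul_of_nonneg_left (hM _) (gam_nonneg w)
  · refine Eventually.of_forall fun w => ?_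
    refine continuous_const.mul (hv.comp (by fun_prop))

noncomputable def heatExp (b : Euc N) (p : Euc N × ℝ) : ℝ :=
  -‖p.1 - p.2 • b‖ ^ 2 / (4 * p.2) - (N / 2 : ℝ) * Real.log (4 * p.2)

noncomputable def heatK (b : Euc N) (p : Euc N × ℝ) : ℝ :=
  (∫ z : Euc N, Real.exp (-‖z‖ ^ 2))⁻¹ * Real.exp (heatExp b p)

lemma heatV_eq (b : Euc N) (v : Euc N → ℝ) {p : Euc N × ℝ} (hp : 0 < p.2) :
    heatV b v p = ∫ y, v y • heatK b (p.1 - y, p.2) := by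
  have hs : 0 < √p.2 := Real.sqrt_pos.2 hp
  have hR : (0 : ℝ) < 2 * √p.2 := by positivity
  have e1 : heatV b v p = ∫ w : Euc N, (fun x : Euc N => gam ((2 * √p.2)⁻¹ • x) *
      v (p.1 - p.2 • b - x)) ((2 * √p.2) • w) := by
    unfold heatV
    refine integral_congr_ae (Eventually.of_forall fun w => ?_)
    simp only
    rw [smul_smul, inv_mul_cancel₀ hR.ne', one_smul]
  rw [e1, Measure.integral_comp_smul_of_nonneg volume (fun x : Euc N =>
      gam ((2 * √p.2)⁻¹ • x) * v (p.1 - p.2 • b - x)) _ (hR := hR.le), ← integral_smul,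
    ← integral_sub_left_eq_self _ _ (p.1 - p.2 • b)]
  refine integral_congr_ae (Eventually.of_forall fun y => ?_)
  simp only [smul_eq_mul, finrank_euclideanSpace, Fintype.card_fin, sub_sub_cancel]
  unfold heatK heatExp gam
  have hlog : Real.exp (-((N / 2 : ℝ) * Real.log (4 * p.2))) = ((2 * √p.2) ^ N)⁻¹ := by
    rw [Real.exp_neg]
    congr 1
    have h4 : (4 * p.2) = (2 * √p.2) ^ 2 := by rw [mul_pow, Real.sq_sqrt hp.le]; norm_num
    rw [h4, Real.log_pow, ← Real.exp_log (pow_pos hR N), Real.log_pow]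
    congr 1
    push_cast; ring
  have hn : -‖(2 * √p.2)⁻¹ • (p.1 - p.2 • b - y)‖ ^ 2 = -‖p.1 - y - p.2 • b‖ ^ 2 / (4 * p.2) := by
    rw [norm_smul, mul_pow, Real.norm_eq_abs, sq_abs, inv_pow, mul_pow, Real.sq_sqrt hp.le,
      sub_right_comm]
    field_simp
    ring
  rw [hn]
  simp only
  rw [sub_eq_add_neg (_ / _), Real.exp_add, hlog]
  ring

lemma heatExp_contDiffAt {n : WithTop ℕ∞} (b : Euc N) {p : Euc N × ℝ} (hp : 0 < p.2) :
    ContDiffAt ℝ n (heatExp b) p := by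
  unfold heatExp
  refine ContDiffAt.sub (ContDiffAt.div (ContDiffAt.neg ?_) (by fun_prop) (by positivity))
    (contDiffAt_const.mul (ContDiffAt.log (by fun_prop) (by positivity)))
  exact ContDiffAt.norm_sq ℝ (by fun_prop)

lemma heatK_contDiffAt {n : WithTop ℕ∞} (b : Euc N) {p : Euc N × ℝ} (hp : 0 < p.2) :
    ContDiffAt ℝ n (heatK b) p :=
  contDiffAt_const.mul (heatExp_contDiffAt b hp).exp

lemma lapl_exp {φ : Euc N → ℝ} {x : Euc N} (h1 : ContDiffAt ℝ 2 φ x) :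
    lapl (fun y => Real.exp (φ y)) x = Real.exp (φ x) * (‖gradient φ x‖ ^ 2 + lapl φ x) := by
  simp only [lapl_eq]
  rw [← sum_fderiv_sq, ← Finset.sum_add_distrib, Finset.mul_sum]
  refine Finset.sum_congr rfl fun i _ => ?_
  have : fderiv ℝ (fun y => Real.exp (φ y)) =ᶠ[𝓝 x] fun y => Real.exp (φ y) • fderiv ℝ φ y := by
    filter_upwards [eventually_differentiableAt h1] with y ha
    rw [fderiv_exp ha]
  have hd := h1.differentiableAt (by norm_num)
  rw [this.fderiv_eq, fderiv_fun_smul hd.exp (fderiv_differentiableAt h1), fderiv_exp hd]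
  simp
  ring

lemma gradient_exp {φ : Euc N → ℝ} {x : Euc N} (h1 : DifferentiableAt ℝ φ x) :
    gradient (fun y => Real.exp (φ y)) x = Real.exp (φ x) • gradient φ x := by
  refine gradient_ext fun d => ?_
  rw [fderiv_exp h1, inner_smul_left, inner_gradient]; simp

lemma heatExp_gradient (b : Euc N) {p : Euc N × ℝ} :
    gr (heatExp b) p = (-(1 / (2 * p.2))) • (p.1 - p.2 • b) := by
  unfold gr heatExp
  have : (fun y : Euc N => -‖y - p.2 • b‖ ^ 2 / (4 * p.2) - (N / 2 : ℝ) * Real.log (4 * p.2)) =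
      fun y => (-(1 / (4 * p.2))) * ‖y - p.2 • b‖ ^ 2 + (-((N / 2 : ℝ) * Real.log (4 * p.2))) := by
    funext y; ring
  simp only
  rw [this, gradient_add, gradient_cst, gradient_const_mul, gradient_normsq, smul_smul, add_zero]
  · congr 1; ring
  · exact (contDiff_normsq (n := 2) _).differentiable (by norm_num) _
  · exact ((contDiff_normsq (n := 2) _).differentiable (by norm_num) _).const_mul _
  · fun_prop

lemma heatExp_lapl (b : Euc N) {p : Euc N × ℝ} :
    lpl (heatExp b) p = -(N / (2 * p.2)) := by
  unfold lpl heatExp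
  have : (fun y : Euc N => -‖y - p.2 • b‖ ^ 2 / (4 * p.2) - (N / 2 : ℝ) * Real.log (4 * p.2)) =
      fun y => (-(1 / (4 * p.2))) * ‖y - p.2 • b‖ ^ 2 + (-((N / 2 : ℝ) * Real.log (4 * p.2))) := by
    funext y; ring
  simp only
  rw [this, lapl_add, lapl_const, lapl_const_mul, lapl_normsq, add_zero]
  · ring
  · exact (contDiff_normsq (n := 2) _).contDiffAt
  · exact contDiffAt_const.mul (contDiff_normsq (n := 2) _).contDiffAt
  · fun_prop

lemma heatExp_dt (b : Euc N) {p : Euc N × ℝ} (hp : 0 < p.2) :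
    dt (heatExp b) p = ‖p.1 - p.2 • b‖ ^ 2 / (4 * p.2 ^ 2) +
      inner ℝ (p.1 - p.2 • b) b / (2 * p.2) - N / (2 * p.2) := by
  unfold dt heatExp
  simp only
  have h1 : HasDerivAt (fun s : ℝ => p.1 - s • b) (-b) p.2 := by
    simpa using ((hasDerivAt_id p.2).smul_const b).const_sub p.1
  have h2 := h1.norm_sq
  have h3 : HasDerivAt (fun s : ℝ => 4 * s) 4 p.2 := by
    simpa using (hasDerivAt_id p.2).const_mul (4 : ℝ)
  have h4 := (h2.neg.div h3 (by positivity)).sub ((h3.log (by positivity)).const_mul (N / 2 : ℝ))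
  have h5 := h4.deriv
  refine Eq.trans ?_ (h5.trans ?_)
  · rfl
  · rw [inner_neg_right]
    simp
    field_simp
    ring

lemma heatK_eq (b : Euc N) {p : Euc N × ℝ} (hp : 0 < p.2) :
    dt (heatK b) p - lpl (heatK b) p + inner ℝ b (gr (heatK b) p) = 0 := by
  have hc := heatExp_contDiffAt (n := 2) b hp
  have hd := hc.differentiableAt (by norm_num)
  unfold heatK
  have hce := hc.exp
  rw [dt_const_mul _ hd.exp, lpl_const_mul _ hce, gr_const_mul _ hd.exp]
  have e1 : dt (fun q => Real.exp (heatExp b q)) p = Real.exp (heatExp b p) * dt (heatExp b) p := by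
    unfold dt
    rw [deriv_exp (tslice_differentiableAt hd)]
  have e2 : lpl (fun q => Real.exp (heatExp b q)) p =
      Real.exp (heatExp b p) * (‖gr (heatExp b) p‖ ^ 2 + lpl (heatExp b) p) :=
    lapl_exp (slice_contDiffAt hc)
  have e3 : gr (fun q => Real.exp (heatExp b q)) p = Real.exp (heatExp b p) • gr (heatExp b) p :=
    gradient_exp (slice_differentiableAt hd)
  rw [e1, e2, e3, heatExp_dt b hp, heatExp_lapl, heatExp_gradient, norm_smul, inner_smul_right,
    inner_smul_right, inner_smul_right, real_inner_comm, mul_pow, Real.norm_eq_abs, sq_abs]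
  field_simp
  ring

set_option synthInstance.maxHeartbeats 400000 in
set_option maxHeartbeats 1000000 in
lemma heatV_jets (b : Euc N) {v : Euc N → ℝ} (hv : Continuous v) (hvc : HasCompactSupport v)
    {p : Euc N × ℝ} (hp : 0 < p.2) :
    ContDiffAt ℝ 2 (heatV b v) p ∧
    dt (heatV b v) p - lpl (heatV b v) p + inner ℝ b (gr (heatV b v) p) = 0 := by
  have hop := isOpen_upperHalf (N := N)
  have c0 : ContDiffOn ℝ 3 (heatK b) (upperHalf N) := fun q hq =>
    (heatK_contDiffAt b hq).contDiffWithinAt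
  have c1 : ContDiffOn ℝ 2 (fderiv ℝ (heatK b)) (upperHalf N) :=
    c0.fderiv_of_isOpen hop (by norm_num)
  have c2 : ContDiffOn ℝ 1 (fderiv ℝ (fderiv ℝ (heatK b))) (upperHalf N) :=
    c1.fderiv_of_isOpen hop (by norm_num)
  have d0 : ∀ q ∈ upperHalf N, HasFDerivAt (heatV b v)
      (∫ y, v y • fderiv ℝ (heatK b) (q.1 - y, q.2)) q := by
    intro q hq
    refine (param_hasFDerivAt (c0.of_le (by norm_num)) hv hvc hq).congr_of_eventuallyEq ?_
    filter_upwards [hop.mem_nhds hq] with q' hq' using heatV_eq b v hq'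
  have d1 : ∀ q ∈ upperHalf N, HasFDerivAt (fderiv ℝ (heatV b v))
      (∫ y, v y • fderiv ℝ (fderiv ℝ (heatK b)) (q.1 - y, q.2)) q := by
    intro q hq
    refine (param_hasFDerivAt (c1.of_le (by norm_num)) hv hvc hq).congr_of_eventuallyEq ?_
    filter_upwards [hop.mem_nhds hq] with q' hq' using (d0 q' hq').fderiv
  have d2 : ∀ q ∈ upperHalf N, ContinuousAt (fderiv ℝ (fderiv ℝ (heatV b v))) q := by
    intro q hq
    refine (param_hasFDerivAt c2 hv hvc hq).continuousAt.congr ?_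
    filter_upwards [hop.mem_nhds hq] with q' hq' using (d1 q' hq').fderiv.symm
  have hcd : ContDiffAt ℝ 2 (heatV b v) p := by
    have hon : ContDiffOn ℝ 2 (heatV b v) (upperHalf N) := by
      have : (2 : WithTop ℕ∞) = 1 + 1 := by norm_num
      rw [this, contDiffOn_succ_iff_fderiv_of_isOpen hop]
      refine ⟨fun q hq => (d0 q hq).differentiableAt.differentiableWithinAt, by simp, ?_⟩
      have : (1 : WithTop ℕ∞) = 0 + 1 := by norm_num
      rw [this, contDiffOn_succ_iff_fderiv_of_isOpen hop]
      refine ⟨fun q hq => (d1 q hq).differentiableAt.differentiableWithinAt, by simp, ?_⟩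
      rw [contDiffOn_zero]
      exact fun q hq => (d2 q hq).continuousWithinAt
    exact hon.contDiffAt (hop.mem_nhds hp)
  refine ⟨hcd, ?_⟩
  have hdp := hcd.differentiableAt (by norm_num)
  have i1 : Integrable (fun y => v y • fderiv ℝ (heatK b) (p.1 - y, p.2)) := by
    refine Continuous.integrable_of_hasCompactSupport (hv.smul (continuousOn_univ.1 ?_))
      hvc.smul_right
    exact c1.continuousOn.comp (by fun_prop) (fun y _ => hp)
  have i2 := param_integrable c2.continuousOn hv hvc hp
  rw [dt_eq hdp, lpl_eq hcd, real_inner_comm, gr_inner hdp, (d0 p hp).fderiv, (d1 p hp).fderiv,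
    ContinuousLinearMap.integral_apply i1, ContinuousLinearMap.integral_apply i1]
  have : ∀ i : Fin N, (∫ y, v y • fderiv ℝ (fderiv ℝ (heatK b)) (p.1 - y, p.2))
      (EuclideanSpace.single i 1, 0) (EuclideanSpace.single i 1, 0) =
      ∫ y, (v y • fderiv ℝ (fderiv ℝ (heatK b)) (p.1 - y, p.2))
      (EuclideanSpace.single i 1, 0) (EuclideanSpace.single i 1, 0) := by
    intro i
    rw [ContinuousLinearMap.integral_apply i2, ContinuousLinearMap.integral_apply]
    exact i2.apply_continuousLinearMap _
  simp only [this]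
  rw [← integral_finsetSum]
  swap
  · intro i _
    exact (i2.apply_continuousLinearMap _).apply_continuousLinearMap _
  rw [← integral_sub, ← integral_add]
  · refine Eq.trans (integral_congr_ae (g := fun _ => (0:ℝ)) ?_) (integral_zero _ _)
    refine Eventually.of_forall fun y => ?_
    have hc := heatK_contDiffAt (n := 2) b (p := (p.1 - y, p.2)) hp
    have hd := hc.differentiableAt (by norm_num)
    have := heatK_eq b (p := (p.1 - y, p.2)) hp
    rw [dt_eq hd, lpl_eq hc, real_inner_comm, gr_inner hd] at this
    simp only [smul_apply, smul_eq_mul]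
    rw [← Finset.mul_sum, ← mul_sub, ← mul_add, this, mul_zero]
  · refine (i1.apply_continuousLinearMap _).sub (integrable_finsetSum _ fun i _ => ?_)
    exact (i2.apply_continuousLinearMap _).apply_continuousLinearMap _
  · exact i1.apply_continuousLinearMap _
  · exact i1.apply_continuousLinearMap _
  · refine (integrable_finsetSum _ fun i _ => ?_)
    exact (i2.apply_continuousLinearMap _).apply_continuousLinearMap _

end Heat


/-! ### Part 3: jets as a structure, viscosity subsolutions -/

section ViscSubSec

variable {N : ℕ}

lemma lapl_mul {φ ψ : Euc N → ℝ} {x : Euc N} (h1 : ContDiffAt ℝ 2 φ x)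
    (h2 : ContDiffAt ℝ 2 ψ x) :
    lapl (fun y => φ y * ψ y) x =
      φ x * lapl ψ x + ψ x * lapl φ x + 2 * inner ℝ (gradient φ x) (gradient ψ x) := by
  have e : (fun y => φ y * ψ y) =
      fun y => (1 / 4 : ℝ) * ((fun z => φ z + ψ z) y ^ 2) + (-(1 / 4 : ℝ)) * ((fun z => φ z + (-1) * ψ z) y ^ 2) := by
    funext y; ring
  have h2' : ContDiffAt ℝ 2 (fun z => (-1) * ψ z) x := contDiffAt_const.mul h2
  have d1 := h1.differentiableAt (by norm_num)
  have d2 := h2.differentiableAt (by norm_num)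
  have d2' := h2'.differentiableAt (by norm_num)
  rw [e, lapl_add, lapl_const_mul, lapl_const_mul, lapl_sq, lapl_sq, lapl_add h1 h2,
    lapl_add h1 h2', lapl_const_mul _ h2, gradient_add d1 d2, gradient_add d1 d2',
    gradient_const_mul _ d2, norm_add_sq_real, norm_add_sq_real, inner_smul_right, norm_smul]
  · norm_num; ring
  · exact h1.add h2'
  · exact h1.add h2
  · exact (h1.add h2').pow 2
  · exact (h1.add h2).pow 2
  · exact contDiffAt_const.mul ((h1.add h2).pow 2)
  · exact contDiffAt_const.mul ((h1.add h2').pow 2)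

lemma gradient_mul {φ ψ : Euc N → ℝ} {x : Euc N} (h1 : DifferentiableAt ℝ φ x)
    (h2 : DifferentiableAt ℝ ψ x) :
    gradient (fun y => φ y * ψ y) x = φ x • gradient ψ x + ψ x • gradient φ x := by
  refine gradient_ext fun d => ?_
  rw [fderiv_fun_mul h1 h2, inner_add_left, inner_smul_left, inner_smul_left, inner_gradient,
    inner_gradient]; simp

structure HasJet (φ : Euc N × ℝ → ℝ) (p : Euc N × ℝ) (a : ℝ) (v : Euc N) (l : ℝ) : Prop where
  cd : ContDiffAt ℝ 2 φ p
  hdt : dt φ p = a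
  hgr : gr φ p = v
  hlp : lpl φ p = l

lemma ContDiffAt.hasJet {φ : Euc N × ℝ → ℝ} {p : Euc N × ℝ} (h : ContDiffAt ℝ 2 φ p) :
    HasJet φ p (dt φ p) (gr φ p) (lpl φ p) := ⟨h, rfl, rfl, rfl⟩

namespace HasJet

variable {φ ψ : Euc N × ℝ → ℝ} {p : Euc N × ℝ} {a a' l l' : ℝ} {v v' : Euc N}

lemma diff (h : HasJet φ p a v l) : DifferentiableAt ℝ φ p := h.cd.differentiableAt (by norm_num)

lemma add (h : HasJet φ p a v l) (h' : HasJet ψ p a' v' l') :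
    HasJet (fun q => φ q + ψ q) p (a + a') (v + v') (l + l') :=
  ⟨h.cd.add h'.cd, by rw [dt_add h.diff h'.diff, h.hdt, h'.hdt],
   by rw [gr_add h.diff h'.diff, h.hgr, h'.hgr], by rw [lpl_add h.cd h'.cd, h.hlp, h'.hlp]⟩

lemma const_mul (c : ℝ) (h : HasJet φ p a v l) :
    HasJet (fun q => c * φ q) p (c * a) (c • v) (c * l) :=
  ⟨contDiffAt_const.mul h.cd, by rw [dt_const_mul _ h.diff, h.hdt],
   by rw [gr_const_mul _ h.diff, h.hgr], by rw [lpl_const_mul _ h.cd, h.hlp]⟩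

lemma neg (h : HasJet φ p a v l) : HasJet (fun q => - φ q) p (-a) (-v) (-l) := by
  have := h.const_mul (-1)
  simpa using this

lemma sub (h : HasJet φ p a v l) (h' : HasJet ψ p a' v' l') :
    HasJet (fun q => φ q - ψ q) p (a - a') (v - v') (l - l') := by
  have := h.add h'.neg
  simpa [sub_eq_add_neg] using this

lemma mul (h : HasJet φ p a v l) (h' : HasJet ψ p a' v' l') :
    HasJet (fun q => φ q * ψ q) p (φ p * a' + ψ p * a) (φ p • v' + ψ p • v)
      (φ p * l' + ψ p * l + 2 * inner ℝ v v') := by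
  refine ⟨h.cd.mul h'.cd, ?_, ?_, ?_⟩
  · unfold dt
    rw [deriv_fun_mul (tslice_differentiableAt h.diff) (tslice_differentiableAt h'.diff)]
    have e1 := h.hdt
    have e2 := h'.hdt
    unfold dt at e1 e2
    rw [e1, e2]; ring
  · have := gradient_mul (slice_differentiableAt h.diff) (slice_differentiableAt h'.diff)
    rw [← h.hgr, ← h'.hgr]
    exact this
  · have := lapl_mul (slice_contDiffAt h.cd) (slice_contDiffAt h'.cd)
    rw [← h.hlp, ← h'.hlp, ← h.hgr, ← h'.hgr]
    exact this

lemma const (c : ℝ) (p : Euc N × ℝ) : HasJet (fun _ => c) p 0 0 0 :=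
  ⟨contDiffAt_const, by unfold dt; simp, gradient_cst _ _, lapl_const _ _⟩

lemma time {T : ℝ → ℝ} {p : Euc N × ℝ} {a : ℝ} (h : ContDiffAt ℝ 2 T p.2)
    (hd : HasDerivAt T a p.2) : HasJet (fun q : Euc N × ℝ => T q.2) p a 0 0 :=
  ⟨ContDiffAt.comp (g := T) p h (by fun_prop), hd.deriv, gradient_cst (T p.2) p.1,
    lapl_const (T p.2) p.1⟩

lemma snd (p : Euc N × ℝ) : HasJet (fun q : Euc N × ℝ => q.2) p 1 0 0 :=
  time (T := fun s => s) contDiffAt_id (hasDerivAt_id _)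

lemma space {T : Euc N → ℝ} {p : Euc N × ℝ} (h : ContDiffAt ℝ 2 T p.1) :
    HasJet (fun q : Euc N × ℝ => T q.1) p 0 (gradient T p.1) (lapl T p.1) :=
  ⟨ContDiffAt.comp (g := T) p h (by fun_prop), by unfold dt; simp, rfl, rfl⟩

lemma normsq (a : Euc N) (p : Euc N × ℝ) :
    HasJet (fun q : Euc N × ℝ => ‖q.1 - a‖ ^ 2) p 0 ((2 : ℝ) • (p.1 - a)) (2 * N) := by
  have := space (T := fun y => ‖y - a‖ ^ 2) (p := p) (contDiff_normsq a).contDiffAt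
  rwa [gradient_normsq, lapl_normsq] at this

lemma movsq (a w : Euc N) (p : Euc N × ℝ) :
    HasJet (fun q : Euc N × ℝ => ‖q.1 - (a + q.2 • w)‖ ^ 2) p
      (-2 * inner ℝ (p.1 - (a + p.2 • w)) w) ((2 : ℝ) • (p.1 - (a + p.2 • w))) (2 * N) := by
  refine ⟨?_, ?_, gradient_normsq (a + p.2 • w) p.1, lapl_normsq (a + p.2 • w) p.1⟩
  · exact ContDiffAt.norm_sq ℝ (by fun_prop)
  · unfold dt
    have h1 : HasDerivAt (fun s : ℝ => p.1 - (a + s • w)) (-w) p.2 := by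
      simpa using (((hasDerivAt_id p.2).smul_const w).const_add a).const_sub p.1
    have h2 := h1.norm_sq
    rw [h2.deriv, inner_neg_right]; ring

lemma congr (h : HasJet φ p a v l) (ha : a = a') (hv : v = v') (hl : l = l') :
    HasJet φ p a' v' l' := by subst ha hv hl; exact h

lemma congr_fun (h : HasJet φ p a v l) (hh : ψ =ᶠ[𝓝 p] φ) : HasJet ψ p a v l := by
  have := jets_congr hh
  exact ⟨h.cd.congr_of_eventuallyEq hh, this.1.trans h.hdt, this.2.2.trans h.hgr,
    this.2.1.trans h.hlp⟩

lemma shift (d : Euc N × ℝ) (h : HasJet φ (p + d) a v l) :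
    HasJet (fun q => φ (q + d)) p a v l := by
  refine ⟨ContDiffAt.comp (g := φ) p h.cd (by fun_prop), ?_, ?_, ?_⟩
  · rw [← h.hdt]
    unfold dt
    exact deriv_comp_add_const (fun s => φ (p.1 + d.1, s)) d.2 p.2
  · rw [← h.hgr]
    unfold gr gradient
    congr 1
    exact fderiv_comp_add_right (f := fun y => φ (y, p.2 + d.2)) d.1
  · rw [← h.hlp]
    unfold lpl lapl
    refine Finset.sum_congr rfl fun i _ => ?_
    have := iteratedFDeriv_comp_add_right (𝕜 := ℝ) (f := fun y => φ (y, p.2 + d.2)) 2 d.1 p.1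
    exact congrArg (fun g => g ![EuclideanSpace.single i 1, EuclideanSpace.single i 1]) this

end HasJet

/-- viscosity subsolution (one-sided in time) in the set `O`. -/
def ViscSub (O : Set (Euc N × ℝ)) (u : Euc N × ℝ → ℝ) (H : Euc N × ℝ → Euc N → ℝ) : Prop :=
  ∀ φ : Euc N × ℝ → ℝ, ∀ p ∈ O, ContDiffAt ℝ 2 φ p →
    (∀ᶠ q in 𝓝 p, q.2 ≤ p.2 → u q - φ q ≤ u p - φ p) →
    dt φ p - lpl φ p + H p (gr φ p) ≤ 0

abbrev ViscLin (O : Set (Euc N × ℝ)) (u : Euc N × ℝ → ℝ) (b : Euc N) (k : ℝ) : Prop :=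
  ViscSub O u (fun _ v => inner ℝ b v - k)

lemma ViscSub.mono {O O' : Set (Euc N × ℝ)} {u : Euc N × ℝ → ℝ} {H H' : Euc N × ℝ → Euc N → ℝ}
    (h : ViscSub O u H) (hO : O' ⊆ O) (hH : ∀ p ∈ O', ∀ v, H' p v ≤ H p v) : ViscSub O' u H' := by
  intro φ p hp hc hm
  have := h φ p (hO hp) hc hm
  linarith [hH p hp (gr φ p)]

lemma ViscSub.shift {O : Set (Euc N × ℝ)} {u : Euc N × ℝ → ℝ} {b : Euc N} {k : ℝ}
    (h : ViscLin O u b k) (d : Euc N × ℝ) : ViscLin {p | p + d ∈ O} (fun q => u (q + d)) b k := by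
  intro φ p hp hc hm
  have hc' : ContDiffAt ℝ 2 φ ((p + d) + (-d)) := by simpa using hc
  have hj := hc'.hasJet.shift
  have hm' : ∀ᶠ q in 𝓝 (p + d), q.2 ≤ (p + d).2 → u q - φ (q + (-d)) ≤
      u (p + d) - φ ((p + d) + (-d)) := by
    have hcont : ContinuousAt (fun q => q + (-d)) (p + d) := by fun_prop
    have := hcont.eventually (p := fun q => q.2 ≤ p.2 → u (q + d) - φ q ≤ u (p + d) - φ p)
      (by simpa using hm)
    filter_upwards [this] with q hq hq2
    have := hq (by simpa using hq2)
    simpa using this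
  have := h _ (p + d) hp hj.cd hm'
  rw [hj.hdt, hj.hgr, hj.hlp] at this
  simpa using this

/-- a `C²` function which is a classical strict-type subsolution is a viscosity one. -/
lemma ViscLin.of_smooth {O : Set (Euc N × ℝ)} {W : Euc N × ℝ → ℝ} {b : Euc N} {k : ℝ}
    (hW : ∀ p ∈ O, ContDiffAt ℝ 2 W p)
    (h : ∀ p ∈ O, dt W p - lpl W p + inner ℝ b (gr W p) ≤ k) : ViscLin O W b k := by
  intro φ p hp hc hm
  have hj := (hW p hp).hasJet.sub hc.hasJet
  have := jets_max hj.cd hm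
  rw [hj.hdt, hj.hgr, hj.hlp] at this
  obtain ⟨h1, h2, h3⟩ := this
  have h4 : gr φ p = gr W p := (sub_eq_zero.1 h2).symm
  have := h p hp
  simp only [h4]
  linarith

noncomputable def cut (R : ℝ) (y : Euc N) : ℝ := max 0 (1 - (‖y‖ ^ 2) ^ 2 / R ^ 4)

lemma cut_cont (R : ℝ) : Continuous (cut (N := N) R) := by unfold cut; fun_prop

lemma cut_nonneg (R : ℝ) (y : Euc N) : 0 ≤ cut R y := le_max_left _ _
lemma cut_le_one {R : ℝ} (hR : 0 < R) (y : Euc N) : cut R y ≤ 1 := by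
  unfold cut
  refine max_le zero_le_one ?_
  have : 0 ≤ (‖y‖ ^ 2) ^ 2 / R ^ 4 := by positivity
  linarith

lemma cut_zero {R : ℝ} (hR : 0 < R) {y : Euc N} (hy : R ≤ ‖y‖) : cut R y = 0 := by
  unfold cut
  refine max_eq_left ?_
  have h1 : R ^ 4 ≤ (‖y‖ ^ 2) ^ 2 := by
    rw [← pow_mul]; exact pow_le_pow_left₀ hR.le hy 4
  have : 1 ≤ (‖y‖ ^ 2) ^ 2 / R ^ 4 := by rwa [le_div_iff₀ (by positivity), one_mul]
  linarith

lemma cut_support {R : ℝ} (hR : 0 < R) : HasCompactSupport (cut (N := N) R) :=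
  HasCompactSupport.intro (isCompact_closedBall (0 : Euc N) R) (fun y hy =>
    cut_zero hR (by
      rw [mem_closedBall, dist_zero_right] at hy
      exact (not_le.1 hy).le))

lemma one_sub_cut_le {R : ℝ} (y : Euc N) : 1 - cut R y ≤ (‖y‖ ^ 2) ^ 2 / R ^ 4 := by
  unfold cut
  linarith [le_max_right 0 (1 - (‖y‖ ^ 2) ^ 2 / R ^ 4)]

set_option maxHeartbeats 1000000 in
lemma heat_compare (b : Euc N) {R : ℝ} (hR : 0 < R) : ∃ C, 0 ≤ C ∧
    ∀ (u : Euc N × ℝ → ℝ) (k M σ : ℝ), Continuous u → 0 < σ → |k| * σ ≤ M →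
    (∀ y s, ‖y‖ ≤ R → 0 ≤ s → s ≤ σ → |u (y, s)| ≤ M) →
    ViscLin (ball 0 R ×ˢ Ioc 0 σ) u b k →
    u (0, σ) ≤ heatV b (fun y => cut R y * u (y, 0)) (0, σ) + k * σ + C * M * σ ^ 2 := by
  obtain ⟨c1, hc1⟩ : ∃ c1 : ℝ, c1 = 4 * N + 8 + 4 * (‖b‖ * R) := ⟨_, rfl⟩
  obtain ⟨c2, hc2⟩ : ∃ c2 : ℝ, c2 = c1 * (N + ‖b‖ * R) := ⟨_, rfl⟩
  have hbR : 0 ≤ ‖b‖ * R := by positivity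
  have hNn : (0 : ℝ) ≤ N := Nat.cast_nonneg N
  have hc1' : 0 ≤ c1 := by rw [hc1]; positivity
  have hc2' : 0 ≤ c2 := by rw [hc2]; positivity
  refine ⟨3 * ((R ^ 4)⁻¹ * c2), by positivity, ?_⟩
  intro u k M σ hu hσ hkM hM hV
  have hM0 : 0 ≤ M := le_trans (by positivity) hkM
  set w : Euc N → ℝ := fun y => cut R y * u (y, 0) with hw
  have hwc : Continuous w := (cut_cont R).mul (hu.comp (by fun_prop))
  have hws : HasCompactSupport w := (cut_support hR).mul_right
  have hwM : ∀ y, |w y| ≤ M := by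
    intro y
    rw [hw]; simp only
    rw [abs_mul, abs_of_nonneg (cut_nonneg R y)]
    rcases le_total ‖y‖ R with h | h
    · calc cut R y * |u (y, 0)| ≤ 1 * M :=
            mul_le_mul (cut_le_one hR y) (hM y 0 h le_rfl hσ.le) (abs_nonneg _) zero_le_one
        _ = M := one_mul M
    · rw [cut_zero hR h]; simpa using hM0
  set e : Euc N × ℝ → ℝ := fun q => (‖q.1 - 0‖ ^ 2 * ‖q.1 - 0‖ ^ 2) +
    (c1 * (‖q.1 - 0‖ ^ 2 * q.2) + c2 * (q.2 * q.2)) with he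
  have hec : Continuous e := by rw [he]; fun_prop
  by_contra hcon
  push Not at hcon
  obtain ⟨δ, hδ, hδ2⟩ : ∃ δ > 0, heatV b w (0, σ) + k * σ + 3 * ((R ^ 4)⁻¹ * c2) * M * σ ^ 2 + δ * σ
      < u (0, σ) := by
    refine ⟨(u (0, σ) - (heatV b w (0, σ) + k * σ + 3 * ((R ^ 4)⁻¹ * c2) * M * σ ^ 2)) / (2 * σ),
      div_pos (by linarith) (by positivity), ?_⟩
    field_simp
    field_simp at hcon
    linarith
  set Ψ : Euc N × ℝ → ℝ := fun q => heatV b w q + ((k + δ) * q.2 + (3 * M * (R ^ 4)⁻¹) * e q) with hΨ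
  have hΨc : Continuous Ψ := by
    rw [hΨ]
    exact (heatV_continuous b hwc hwM).add (by fun_prop)
  obtain ⟨p, hp, hmax⟩ := ((isCompact_closedBall (0 : Euc N) R).prod
    (isCompact_Icc (a := (0 : ℝ)) (b := σ))).exists_isMaxOn
    ⟨(0, σ), mem_closedBall_self hR.le, hσ.le, le_rfl⟩ (hu.sub hΨc).continuousOn
  have hpos : 0 < u p - Ψ p := by
    have h1 := hmax (show ((0 : Euc N), σ) ∈ _ from ⟨mem_closedBall_self hR.le, hσ.le, le_rfl⟩)
    have h2 : u (0, σ) - Ψ (0, σ) ≤ u p - Ψ p := h1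
    refine lt_of_lt_of_le ?_ h2
    have : Ψ (0, σ) = heatV b w (0, σ) + k * σ + 3 * ((R ^ 4)⁻¹ * c2) * M * σ ^ 2 + δ * σ := by
      rw [hΨ, he]; simp; ring
    rw [this]; linarith
  obtain ⟨hp1, hp2, hp3⟩ := hp
  have hp1' : ‖p.1‖ ≤ R := by simpa using hp1
  have hR4 : 0 < R ^ 4 := by positivity
  have hk : -M ≤ k * p.2 := by
    have : |k * p.2| ≤ M := by
      rw [abs_mul, abs_of_nonneg hp2]
      exact le_trans (mul_le_mul_of_nonneg_left hp3 (abs_nonneg k)) hkM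
    linarith [(abs_le.1 this).1]
  have hMR : 0 ≤ M * (R ^ 4)⁻¹ := by positivity
  have he1 : (‖p.1‖ ^ 2) ^ 2 ≤ e p := by
    rw [he]; simp only [sub_zero]
    have : 0 ≤ c1 * (‖p.1‖ ^ 2 * p.2) + c2 * (p.2 * p.2) := by positivity
    nlinarith
  have hs0 : 0 < p.2 := by
    rcases hp2.lt_or_eq with h | h
    · exact h
    exfalso
    have hpe : p = (p.1, 0) := by rw [h]
    have h3 : heatV b w p = w p.1 := by rw [hpe, heatV_zero]
    have h4 : u p - w p.1 ≤ M * ((‖p.1‖ ^ 2) ^ 2 / R ^ 4) := by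
      have h5 : u p - w p.1 = (1 - cut R p.1) * u p := by
        rw [hw]; simp only; rw [← hpe]; ring
      rw [h5]
      have h6 : |u p| ≤ M := by
        have := hM p.1 p.2 hp1' hp2 hp3
        exact this
      have h7 := one_sub_cut_le (R := R) p.1
      have h8 : 0 ≤ 1 - cut R p.1 := by linarith [cut_le_one hR p.1]
      calc (1 - cut R p.1) * u p ≤ (1 - cut R p.1) * M :=
            mul_le_mul_of_nonneg_left ((le_abs_self _).trans h6) h8
        _ ≤ M * ((‖p.1‖ ^ 2) ^ 2 / R ^ 4) := by rw [mul_comm]; exact mul_le_mul_of_nonneg_left h7 hM0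
    have h9 : Ψ p = w p.1 + 3 * M * (R ^ 4)⁻¹ * e p := by
      rw [hΨ]; simp only; rw [h3, ← h]; ring
    have h10 : M * ((‖p.1‖ ^ 2) ^ 2 / R ^ 4) ≤ 3 * M * (R ^ 4)⁻¹ * e p := by
      have := mul_le_mul_of_nonneg_left he1 hMR
      have h11 : 0 ≤ M * (R ^ 4)⁻¹ * e p := le_trans (by positivity) this
      rw [div_eq_mul_inv]
      nlinarith
    linarith
  have hRlt : ‖p.1‖ < R := by
    rcases hp1'.lt_or_eq with h | h
    · exact h
    exfalso
    have h1 : u p ≤ M := (le_abs_self _).trans (hM p.1 p.2 hp1' hp2 hp3)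
    have h2 : -M ≤ heatV b w p := (abs_le.1 (heatV_abs_le b hwM p)).1
    have h3 : 3 * M ≤ 3 * M * (R ^ 4)⁻¹ * e p := by
      have h4 := mul_le_mul_of_nonneg_left he1 hMR
      rw [h] at h4
      have h5 : M * (R ^ 4)⁻¹ * (R ^ 2) ^ 2 = M := by
        field_simp
      rw [h5] at h4
      linarith
    have h6 : 0 ≤ δ * p.2 := by positivity
    have : Ψ p = heatV b w p + (k * p.2 + δ * p.2 + 3 * M * (R ^ 4)⁻¹ * e p) := by
      rw [hΨ]; ring
    linarith
  obtain ⟨hVc, hVeq⟩ := heatV_jets b hwc hws hs0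
  have hn := HasJet.normsq (0 : Euc N) p
  have hsn := HasJet.snd p
  have hje : HasJet e p _ _ _ :=
    (hn.mul hn).add (((hn.mul hsn).const_mul c1).add ((hsn.mul hsn).const_mul c2))
  have hj := hVc.hasJet.add ((hsn.const_mul (k + δ)).add (hje.const_mul (3 * M * (R ^ 4)⁻¹)))
  have hloc : ∀ᶠ q in 𝓝 p, q.2 ≤ p.2 → u q - Ψ q ≤ u p - Ψ p := by
    have h1 : ∀ᶠ q in 𝓝 p, ‖q.1‖ < R :=
      (continuous_fst.norm.continuousAt (x := p)).eventually_lt_const hRlt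
    have h2 : ∀ᶠ q in 𝓝 p, 0 < q.2 := (continuous_snd.continuousAt (x := p)).eventually_const_lt hs0
    filter_upwards [h1, h2] with q hq1 hq2 hq3
    exact hmax (show q ∈ _ from ⟨by simpa using hq1.le, hq2.le, hq3.trans hp3⟩)
  have hfin := hV Ψ p ⟨by simpa using hRlt, hs0, hp3⟩ hj.cd hloc
  rw [hj.hdt, hj.hlp, hj.hgr] at hfin
  simp only [sub_zero, inner_add_right, inner_smul_right, inner_zero_right, inner_smul_left,
    real_inner_self_eq_norm_sq, mul_zero, add_zero, zero_add,
    mul_one, RCLike.conj_to_real] at hfin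
  have hin : -(‖b‖ * R) ≤ inner ℝ b p.1 := by
    have := (abs_le.1 (abs_real_inner_le_norm b p.1)).1
    have h2 : ‖b‖ * ‖p.1‖ ≤ ‖b‖ * R := mul_le_mul_of_nonneg_left hp1' (norm_nonneg _)
    linarith
  set I := inner ℝ b p.1
  set n2 := ‖p.1‖ ^ 2
  have hn2 : 0 ≤ n2 := by positivity
  have key : 0 ≤ n2 * (c1 - 8 - 4 * N + 4 * I) + p.2 * (2 * c2 + c1 * (2 * I) - c1 * (2 * N)) := by
    refine add_nonneg (mul_nonneg hn2 ?_) (mul_nonneg hp2 ?_)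
    · rw [hc1]; linarith
    · rw [hc2]; nlinarith
  have := mul_nonneg (mul_nonneg zero_le_three hMR) key
  nlinarith [this]

end ViscSubSec


/-! ### Part 4: mollification of subsolutions -/

section Moll

variable {N : ℕ}

lemma rpow_tangent_real {m a c : ℝ} (hm : 2 < m) (ha : 0 ≤ a) (hc : 0 ≤ c) :
    a ^ m + m * a ^ (m - 2) * (a * c - a ^ 2) ≤ c ^ m := by
  rcases ha.eq_or_lt with h | h
  · rw [← h, Real.zero_rpow (by linarith), Real.zero_rpow (by linarith)]
    simp only [mul_zero, zero_mul, add_zero]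
    positivity
  · have h1 := one_add_mul_self_le_rpow_one_add (s := c / a - 1) (p := m)
      (by have : 0 ≤ c / a := by positivity
          linarith) (by linarith)
    have h2 : (1 + (c / a - 1)) = c / a := by ring
    rw [h2, Real.div_rpow hc ha, le_div_iff₀ (by positivity)] at h1
    have h3 : a ^ m = a ^ (m - 2) * a ^ 2 := by
      rw [← Real.rpow_natCast a 2, ← Real.rpow_add h]; norm_num
    refine le_trans (le_of_eq ?_) h1
    rw [h3]; field_simp

lemma rpow_tangent {m : ℝ} (hm : 2 < m) (a v : Euc N) :
    ‖a‖ ^ m + m * ‖a‖ ^ (m - 2) * (inner ℝ a v - ‖a‖ ^ 2) ≤ ‖v‖ ^ m := by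
  refine le_trans ?_ (rpow_tangent_real hm (norm_nonneg a) (norm_nonneg v))
  have h1 := real_inner_le_norm a v
  have h2 : 0 ≤ m * ‖a‖ ^ (m - 2) := by positivity
  have := mul_le_mul_of_nonneg_left (sub_le_sub_right h1 (‖a‖ ^ 2)) h2
  linarith

structure IsMoll (ε : ℝ) (η : Euc N × ℝ → ℝ) : Prop where
  cd : ContDiff ℝ 2 η
  cs : HasCompactSupport η
  nonneg : ∀ q, 0 ≤ η q
  int : ∫ q, η q = 1
  supp : ∀ q, ε < ‖q‖ → η q = 0

lemma exists_moll {ε : ℝ} (hε : 0 < ε) : ∃ η : Euc N × ℝ → ℝ, IsMoll ε η := by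
  let f : ContDiffBump (0 : Euc N × ℝ) := ⟨ε / 2, ε, by linarith, by linarith⟩
  refine ⟨f.normed volume, f.contDiff_normed, f.hasCompactSupport_normed, fun q => f.nonneg_normed q,
    f.integral_normed, fun q hq => ?_⟩
  have := f.support_normed_eq (μ := volume)
  by_contra h
  have h2 : q ∈ Function.support (f.normed volume) := h
  rw [this] at h2
  simp only [mem_ball, dist_zero_right] at h2
  exact lt_asymm hq h2

noncomputable def moll (η u : Euc N × ℝ → ℝ) (p : Euc N × ℝ) : ℝ := ∫ q, η q * u (p - q)

variable {η u : Euc N × ℝ → ℝ} {ε : ℝ}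

lemma IsMoll.integrable (hη : IsMoll ε η) : Integrable η :=
  hη.cd.continuous.integrable_of_hasCompactSupport hη.cs

lemma IsMoll.integrable_mul (hη : IsMoll ε η) {h : Euc N × ℝ → ℝ} (hh : Continuous h) :
    Integrable (fun q => η q * h q) :=
  (hη.cd.continuous.mul hh).integrable_of_hasCompactSupport hη.cs.mul_right

lemma IsMoll.avg_le (hη : IsMoll ε η) {h h' : Euc N × ℝ → ℝ} (hh : Continuous h)
    (hh' : Continuous h') (hle : ∀ q, ‖q‖ ≤ ε → h q ≤ h' q) :
    ∫ q, η q * h q ≤ ∫ q, η q * h' q := by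
  refine integral_mono (hη.integrable_mul hh) (hη.integrable_mul hh') fun q => ?_
  rcases le_or_gt ‖q‖ ε with h1 | h1
  · exact mul_le_mul_of_nonneg_left (hle q h1) (hη.nonneg q)
  · simp [hη.supp q h1]

lemma IsMoll.avg_const (hη : IsMoll ε η) (c : ℝ) : ∫ q, η q * c = c := by
  rw [integral_mul_const, hη.int, one_mul]

lemma IsMoll.abs_le (hη : IsMoll ε η) {h : Euc N × ℝ → ℝ} {M : ℝ} (hh : Continuous h)
    (hle : ∀ q, ‖q‖ ≤ ε → |h q| ≤ M) : |∫ q, η q * h q| ≤ M := by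
  rw [_root_.abs_le]
  constructor
  · rw [← hη.avg_const (-M)]
    exact hη.avg_le continuous_const hh fun q hq => (_root_.abs_le.1 (hle q hq)).1
  · rw [← hη.avg_const M]
    exact hη.avg_le hh continuous_const fun q hq => (_root_.abs_le.1 (hle q hq)).2

lemma moll_contDiff (hη : IsMoll ε η) (hu : Continuous u) : ContDiff ℝ 2 (moll η u) := by
  haveI : (volume : Measure (Euc N × ℝ)).IsAddHaarMeasure :=
    inferInstanceAs (((volume : Measure (Euc N)).prod (volume : Measure ℝ)).IsAddHaarMeasure)
  have := hη.cs.contDiff_convolution_left (n := 2) (L := ContinuousLinearMap.lsmul ℝ ℝ)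
    (μ := volume) hη.cd hu.locallyIntegrable
  exact this

lemma heat_swap (hη : IsMoll ε η) (hu : Continuous u) (b : Euc N) {R : ℝ} (hR : 0 < R) (σ : ℝ)
    (p0 : Euc N × ℝ) :
    ∫ q, η q * heatV b (fun y => cut R y * u ((y, 0) + (p0 - q))) (0, σ) =
      heatV b (fun y => cut R y * moll η u ((y, 0) + p0)) (0, σ) := by
  obtain ⟨M, hM⟩ := ((isCompact_closedBall (0 : Euc N) R).prod
    (isCompact_closedBall (0 : Euc N × ℝ) ε)).exists_bound_of_continuousOn
    (f := fun z : Euc N × (Euc N × ℝ) => u ((z.1, 0) + (p0 - z.2))) (hu.comp (by fun_prop)).continuousOn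
  unfold heatV moll
  simp only [zero_sub]
  set z : Euc N → Euc N := fun w => -(σ • b) - (2 * √σ) • w with hz
  have hzc : Continuous z := by rw [hz]; fun_prop
  have e1 : ∀ q, η q * ∫ w, gam w * (cut R (z w) * u ((z w, 0) + (p0 - q))) =
      ∫ w, η q * (gam w * (cut R (z w) * u ((z w, 0) + (p0 - q)))) := fun q =>
    (integral_const_mul _ _).symm
  have e2 : ∀ w, gam w * (cut R (z w) * ∫ q, η q * u ((z w, 0) + p0 - q)) =
      ∫ q, η q * (gam w * (cut R (z w) * u ((z w, 0) + (p0 - q)))) := by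
    intro w
    rw [← integral_const_mul, ← integral_const_mul]
    refine integral_congr_ae (Eventually.of_forall fun q => ?_)
    simp only
    rw [add_sub_assoc]; ring
  change ∫ q, η q * ∫ w, gam w * (cut R (z w) * u ((z w, 0) + (p0 - q))) =
    ∫ w, gam w * (cut R (z w) * ∫ q, η q * u ((z w, 0) + p0 - q))
  simp only [e1, e2]
  refine integral_integral_swap ?_
  refine Integrable.mono' ((hη.integrable.mul_prod gam_integrable).mul_const |M|) ?_ ?_
  · refine Continuous.aestronglyMeasurable ?_
    have h1 := hη.cd.continuous
    have h2 := gam_continuous (N := N)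
    have h3 := cut_cont (N := N) R
    unfold Function.uncurry
    fun_prop
  · refine Eventually.of_forall fun ⟨q, w⟩ => ?_
    simp only [Function.uncurry, Real.norm_eq_abs]
    rw [abs_mul, abs_mul, abs_of_nonneg (hη.nonneg q), abs_of_nonneg (gam_nonneg w), mul_assoc]
    rcases le_or_gt ‖q‖ ε with hq | hq
    swap
    · simp [hη.supp q hq]
    refine mul_le_mul_of_nonneg_left (mul_le_mul_of_nonneg_left ?_ (gam_nonneg w)) (hη.nonneg q)
    rw [abs_mul, abs_of_nonneg (cut_nonneg _ _)]
    rcases le_or_gt R ‖z w‖ with h | h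
    · rw [cut_zero hR h]; simp
    · have h4 := hM (z w, q) ⟨by simpa using h.le, by simpa using hq⟩
      calc _ ≤ 1 * |M| := mul_le_mul (cut_le_one hR _) (h4.trans (le_abs_self M))
            (abs_nonneg _) zero_le_one
        _ = |M| := one_mul _

lemma heatV_neg (b : Euc N) (v : Euc N → ℝ) (p : Euc N × ℝ) :
    heatV b (fun y => - v y) p = - heatV b v p := by
  unfold heatV
  rw [← integral_neg]
  refine integral_congr_ae (Eventually.of_forall fun q => ?_)
  simp

lemma heat_integrable (hη : IsMoll ε η) (hu : Continuous u) (b : Euc N) {R : ℝ} (hR : 0 < R)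
    (σ : ℝ) (p0 : Euc N × ℝ) : Integrable (fun q => η q *
      heatV b (fun y => cut R y * u ((y, 0) + (p0 - q))) (0, σ)) := by
  refine Continuous.integrable_of_hasCompactSupport ?_ hη.cs.mul_right
  refine continuous_iff_continuousAt.2 fun q0 => ?_
  obtain ⟨M2, hM2⟩ := ((isCompact_closedBall (0 : Euc N) R).prod
    (isCompact_closedBall (q0 : Euc N × ℝ) 1)).exists_bound_of_continuousOn
    (f := fun z : Euc N × (Euc N × ℝ) => u ((z.1, 0) + (p0 - z.2)))
    (hu.comp (by fun_prop)).continuousOn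
  refine hη.cd.continuous.continuousAt.mul ?_
  unfold heatV
  refine continuousAt_of_dominated (bound := fun w => gam w * |M2|) ?_ ?_
    (gam_integrable.mul_const _) ?_
  · refine Eventually.of_forall fun q => Continuous.aestronglyMeasurable ?_
    have h2 := gam_continuous (N := N)
    have h3 := cut_cont (N := N) R
    fun_prop
  · filter_upwards [closedBall_mem_nhds q0 one_pos] with q hq
    refine Eventually.of_forall fun w => ?_
    rw [Real.norm_eq_abs, abs_mul, abs_of_nonneg (gam_nonneg w)]
    refine mul_le_mul_of_nonneg_left ?_ (gam_nonneg w)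
    rw [abs_mul, abs_of_nonneg (cut_nonneg _ _)]
    rcases le_or_gt R ‖(0 : Euc N) - σ • b - (2 * √σ) • w‖ with h | h
    · rw [cut_zero hR h]; simp
    · have h4 := hM2 ((0 : Euc N) - σ • b - (2 * √σ) • w, q) ⟨by simpa using h.le, hq⟩
      calc _ ≤ 1 * |M2| := mul_le_mul (cut_le_one hR _) (h4.trans (le_abs_self M2))
            (abs_nonneg _) zero_le_one
        _ = |M2| := one_mul _
  · refine Eventually.of_forall fun w => Continuous.continuousAt ?_
    fun_prop

set_option maxHeartbeats 1000000 in
lemma moll_lin (hη : IsMoll ε η) (hε : 0 < ε) (hu : Continuous u) {O : Set (Euc N × ℝ)}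
    (hO : IsOpen O) {b : Euc N} {k : ℝ} (hV : ViscLin O u b k) {p0 : Euc N × ℝ}
    (hp0 : closedBall p0 ε ⊆ O) :
    dt (moll η u) p0 - lpl (moll η u) p0 + inner ℝ b (gr (moll η u) p0) ≤ k := by
  set W := moll η u with hWdef
  have hWc : ContDiff ℝ 2 W := moll_contDiff hη hu
  by_contra hcon
  push Not at hcon
  obtain ⟨k', hk1, hk2⟩ := exists_between hcon
  have hcont : Continuous (fun p => dt W p - lpl W p + inner ℝ b (gr W p)) :=
    ((continuous_dt hWc).sub (continuous_lpl hWc)).add (continuous_const.inner (continuous_gr hWc))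
  have hev : ∀ᶠ p in 𝓝 p0, k' < dt W p - lpl W p + inner ℝ b (gr W p) :=
    hcont.continuousAt.eventually_const_lt hk2
  obtain ⟨R1, hR1, hR1'⟩ := Metric.eventually_nhds_iff.1 hev
  obtain ⟨R2, hR2, hR2'⟩ := (isCompact_closedBall p0 ε).exists_cthickening_subset_open hO hp0
  obtain ⟨R, hR, hRR1, hRR2⟩ : ∃ R > 0, R < R1 ∧ R ≤ R2 :=
    ⟨min (R1 / 2) R2, by positivity, lt_of_le_of_lt (min_le_left _ _) (by linarith), min_le_right _ _⟩
  obtain ⟨C, hC, hcomp⟩ := heat_compare b hR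
  obtain ⟨M0, hM0⟩ := (isCompact_closedBall p0 (ε + R)).exists_bound_of_continuousOn hu.continuousOn
  obtain ⟨M, hMM0, hMk, hMk'⟩ : ∃ M, M0 ≤ M ∧ |k| ≤ M ∧ |k'| ≤ M :=
    ⟨max M0 (max |k| |k'|), le_max_left _ _, (le_max_left _ _).trans (le_max_right _ _),
      (le_max_right _ _).trans (le_max_right _ _)⟩
  have hMnn : 0 ≤ M := (abs_nonneg k).trans hMk
  have hM : ∀ p, dist p p0 ≤ ε + R → |u p| ≤ M := fun p hp => (hM0 p hp).trans hMM0
  obtain ⟨σ, hσ, hσ1, hσR, hσk⟩ : ∃ σ > 0, σ ≤ 1 ∧ σ < R ∧ (2 * (C * M) + 1) * σ ≤ k' - k := by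
    have : 0 < (k' - k) / (2 * (C * M) + 1) := div_pos (by linarith) (by positivity)
    refine ⟨min 1 (min (R / 2) ((k' - k) / (2 * (C * M) + 1))), by positivity, min_le_left _ _, ?_, ?_⟩
    · exact lt_of_le_of_lt ((min_le_right _ _).trans (min_le_left _ _)) (by linarith)
    · rw [← le_div_iff₀' (by positivity)]
      exact (min_le_right _ _).trans (min_le_right _ _)
  have hdist : ∀ (y : Euc N) (s : ℝ), ‖y‖ ≤ R → 0 ≤ s → s ≤ σ → ‖((y, s) : Euc N × ℝ)‖ ≤ R := by
    intro y s hy hs0 hs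
    rw [Prod.norm_def]
    refine max_le hy ?_
    rw [Real.norm_eq_abs, abs_of_nonneg hs0]
    linarith
  have hkb : ∀ κ : ℝ, |κ| ≤ M → |κ| * σ ≤ M := fun κ hκ =>
    (mul_le_of_le_one_right (abs_nonneg κ) hσ1).trans hκ
  -- estimate for u
  have A1 : ∀ q : Euc N × ℝ, ‖q‖ ≤ ε → u ((0, σ) + (p0 - q)) ≤
      heatV b (fun y => cut R y * u ((y, 0) + (p0 - q))) (0, σ) + (k * σ + C * M * σ ^ 2) := by
    intro q hq
    have := hcomp (fun p => u (p + (p0 - q))) k M σ (hu.comp (by fun_prop)) hσ (hkb k hMk) ?_ ?_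
    · linarith
    · intro y s hy hs0 hs
      refine hM _ ?_
      rw [dist_eq_norm]
      have e : (y, s) + (p0 - q) - p0 = (y, s) - q := by abel
      rw [e]
      refine (norm_sub_le _ _).trans ?_
      linarith [hdist y s hy hs0 hs]
    · refine (hV.shift (p0 - q)).mono ?_ (fun _ _ _ => le_rfl)
      rintro ⟨y, s⟩ ⟨hy, hs0, hs⟩
      have hy' : ‖y‖ < R := by simpa using hy
      refine hR2' (Metric.mem_cthickening_of_dist_le _ (p0 - q) R2 _ ?_ ?_)
      · simpa [dist_eq_norm] using hq
      · rw [dist_eq_norm, add_sub_cancel_right]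
        exact (hdist y s hy'.le hs0.le hs).trans hRR2
  have A2 : W ((0, σ) + p0) ≤
      heatV b (fun y => cut R y * W ((y, 0) + p0)) (0, σ) + (k * σ + C * M * σ ^ 2) := by
    have h1 : ∫ q, η q * u ((0, σ) + (p0 - q)) ≤ ∫ q, η q *
      (heatV b (fun y => cut R y * u ((y, 0) + (p0 - q))) (0, σ) + (k * σ + C * M * σ ^ 2)) := by
      have hi := heat_integrable hη hu b hR σ p0
      refine integral_mono (hη.integrable_mul (hu.comp (by fun_prop))) ?_ fun q => ?_
      · simp only [mul_add]
        refine hi.add (Integrable.add ?_ ?_)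
        · exact hη.integrable.mul_const _
        · exact hη.integrable.mul_const _
      · rcases le_or_gt ‖q‖ ε with h1 | h1
        · exact mul_le_mul_of_nonneg_left (A1 q h1) (hη.nonneg q)
        · simp [hη.supp q h1]
    have h2 : ∫ q, η q * u ((0, σ) + (p0 - q)) = W ((0, σ) + p0) := by
      simp only [hWdef, moll, add_sub_assoc]
    have h3 : ∫ q, η q * (heatV b (fun y => cut R y * u ((y, 0) + (p0 - q))) (0, σ) +
        (k * σ + C * M * σ ^ 2)) = heatV b (fun y => cut R y * W ((y, 0) + p0)) (0, σ) +
        (k * σ + C * M * σ ^ 2) := by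
      rw [← heat_swap hη hu b hR σ p0, ← hη.avg_const (k * σ + C * M * σ ^ 2),
        ← integral_add (heat_integrable hη hu b hR σ p0) (hη.integrable.mul_const _),
        hη.avg_const]
      simp only [mul_add]
    rw [← h2, ← h3]
    exact h1
  have hWb : ∀ p, dist p p0 ≤ R → |W p| ≤ M := by
    intro p hp
    refine hη.abs_le (hu.comp (by fun_prop)) fun q hq => hM _ ?_
    rw [dist_eq_norm] at hp ⊢
    have e : p - q - p0 = (p - p0) - q := by abel
    rw [e]
    exact (norm_sub_le _ _).trans (by linarith)
  have hdd : ∀ z : Euc N × ℝ, dist (z + p0) p0 = ‖z‖ := fun z => by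
    rw [dist_eq_norm, add_sub_cancel_right]
  have A3 := hcomp (fun p => - W (p + p0)) (-k') M σ (hWc.continuous.comp (by fun_prop)).neg hσ
    (by rw [abs_neg]; exact hkb k' hMk')
    (fun y s hy hs0 hs => by
      rw [abs_neg]
      exact hWb _ (by rw [hdd]; exact hdist y s hy hs0 hs))
    (by
      refine ViscLin.of_smooth (fun p _ => (hWc.comp (by fun_prop)).neg.contDiffAt) ?_
      rintro ⟨y, s⟩ ⟨hy, hs0, hs⟩
      have hy' : ‖y‖ < R := by simpa using hy
      have hj := ((hWc.contDiffAt (x := (y, s) + p0)).hasJet.shift).neg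
      rw [hj.hdt, hj.hgr, hj.hlp, inner_neg_right]
      have := hR1' (y := (y, s) + p0) (by
        rw [hdd]; exact lt_of_le_of_lt (hdist y s hy'.le hs0.le hs) hRR1)
      linarith)
  have A4 : heatV b (fun y => cut R y * (- W ((y, 0) + p0))) (0, σ) =
      - heatV b (fun y => cut R y * W ((y, 0) + p0)) (0, σ) := by
    rw [← heatV_neg]; simp only [mul_neg]
  beta_reduce at A3
  rw [A4] at A3
  nlinarith

/-- Mollification of a subsolution of the nonlinear equation with constant right-hand side. -/
lemma moll_sub {m : ℝ} (hm : 2 < m) (hη : IsMoll ε η) (hε : 0 < ε) (hu : Continuous u)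
    {O : Set (Euc N × ℝ)} (hO : IsOpen O) {k : ℝ}
    (hV : ViscSub O u (fun _ v => ‖v‖ ^ m - k)) {p0 : Euc N × ℝ} (hp0 : closedBall p0 ε ⊆ O) :
    dt (moll η u) p0 - lpl (moll η u) p0 + ‖gr (moll η u) p0‖ ^ m ≤ k := by
  set a := gr (moll η u) p0 with ha
  have hL : ViscLin O u ((m * ‖a‖ ^ (m - 2)) • a) (k + m * ‖a‖ ^ (m - 2) * ‖a‖ ^ 2 - ‖a‖ ^ m) := by
    refine hV.mono le_rfl fun p _ v => ?_
    have := rpow_tangent hm a v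
    rw [inner_smul_left]
    simp only [conj_trivial]
    nlinarith
  have := moll_lin hη hε hu hO hL hp0
  rw [← ha, inner_smul_left, real_inner_self_eq_norm_sq] at this
  simp only [conj_trivial] at this
  linarith

lemma IsMoll.moll_close (hη : IsMoll ε η) (hu : Continuous u) {p : Euc N × ℝ} {c δ : ℝ}
    (h : ∀ q, dist q p ≤ ε → |u q - c| ≤ δ) : |moll η u p - c| ≤ δ := by
  have : moll η u p - c = ∫ q, η q * (u (p - q) - c) := by
    have h1 : Continuous (fun q => u (p - q)) := hu.comp (by fun_prop)
    have h2 := integral_sub (hη.integrable_mul h1) (hη.integrable.mul_const c)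
    rw [hη.avg_const] at h2
    unfold moll
    rw [← h2]
    simp only [mul_sub]
  rw [this]
  refine hη.abs_le ((hu.comp (by fun_prop)).sub continuous_const) fun q hq => h _ ?_
  rw [dist_eq_norm]; simpa using hq

end Moll


/-! ### Part 5: comparison by shifted mollification -/

section CmpBase

variable {N : ℕ}

def SupAt (Ω : Set (Euc N)) (f : Euc N → ℝ) (m : ℝ) (V : Euc N × ℝ → ℝ) (Gd : Euc N → Prop)
    (p : Euc N × ℝ) : Prop :=
  ∀ᶠ q in 𝓝 p, q.1 ∈ closure Ω → ∀ φ : Euc N × ℝ → ℝ, ContDiff ℝ 2 φ →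
    (∀ᶠ q' in 𝓝 q, q'.1 ∈ closure Ω → q'.2 ≤ q.2 → V q - φ q ≤ V q' - φ q') →
    0 ≤ dt φ q - lpl φ q + ‖gr φ q‖ ^ m - f q.1 ∧ Gd (gr φ q)

def ConeAt (Ω : Set (Euc N)) (x0 : Euc N) : Prop :=
  ∃ e : Euc N, ∃ c > (0 : ℝ), ∃ r > (0 : ℝ), ∀ x ∈ closure Ω, dist x x0 < r → ∀ l : ℝ, 0 < l →
    l < r → closedBall (x + l • e) (c * l) ⊆ Ω

lemma closure_le {Ω : Set (Euc N)} {ρ : Euc N → ℝ} (hρ : ContDiff ℝ 2 ρ) (hΩ : Ω = {x | ρ x < 0})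
    {x : Euc N} (hx : x ∈ closure Ω) : ρ x ≤ 0 := by
  have : closure Ω ⊆ {x | ρ x ≤ 0} := by
    refine closure_minimal ?_ (isClosed_le hρ.continuous continuous_const)
    rw [hΩ]; intro y hy; exact le_of_lt (show ρ y < 0 from hy)
  exact this hx

lemma coneAt {Ω : Set (Euc N)} (hΩo : IsOpen Ω) (hΩ2 : HasC2Boundary Ω) {x0 : Euc N}
    (hx0 : x0 ∈ closure Ω) : ConeAt Ω x0 := by
  by_cases hin : x0 ∈ Ω
  · obtain ⟨r, hr, hr'⟩ := Metric.isOpen_iff.1 hΩo x0 hin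
    refine ⟨0, 1, one_pos, r / 2, by linarith, fun x _ hd l hl hlr y hy => hr' ?_⟩
    rw [mem_closedBall, smul_zero, add_zero, one_mul] at hy
    rw [mem_ball]
    have := dist_triangle y x x0
    linarith
  · obtain ⟨ρ, hρ, hΩ, hfr, hgr⟩ := hΩ2
    have hx0f : x0 ∈ frontier Ω := by
      rw [frontier, hΩo.interior_eq]; exact ⟨hx0, hin⟩
    have hn := hgr x0 hx0f
    set n := gradient ρ x0 with hndef
    have hn0 : 0 < ‖n‖ := norm_pos_iff.2 hn
    have hs : HasStrictFDerivAt ρ (fderiv ℝ ρ x0) x0 :=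
      hρ.contDiffAt.hasStrictFDerivAt (by norm_num)
    have hs2 := hs.isLittleO.def (c := ‖n‖ / 4) (by positivity)
    obtain ⟨d, hd, hd'⟩ := Metric.eventually_nhds_iff.1 hs2
    refine ⟨-n, ‖n‖ / 4, by positivity, min (d / 2) (d / (4 * ‖n‖)), by positivity, ?_⟩
    intro x hx hxd l hl hlr y hy
    have hl2 : l * (4 * ‖n‖) < d := by
      rw [← lt_div_iff₀ (by positivity)]; exact hlr.trans_le (min_le_right _ _)
    have hxd2 : dist x x0 < d / 2 := hxd.trans_le (min_le_left _ _)
    obtain ⟨z, rfl⟩ : ∃ z, y = x + l • (-n) + z := ⟨y - (x + l • (-n)), by abel⟩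
    have hz : ‖z‖ ≤ ‖n‖ / 4 * l := by
      rw [mem_closedBall, dist_eq_norm, add_sub_cancel_left] at hy; exact hy
    have e1 : x + l • (-n) + z - x = l • (-n) + z := by abel
    have hnorm : ‖l • (-n) + z‖ ≤ 5 / 4 * ‖n‖ * l := by
      refine (norm_add_le _ _).trans ?_
      rw [norm_smul, norm_neg, Real.norm_eq_abs, abs_of_pos hl]
      linarith
    have hyd : dist (x + l • (-n) + z) x0 < d := by
      have h1 : dist (x + l • (-n) + z) x ≤ 5 / 4 * ‖n‖ * l := by rw [dist_eq_norm, e1]; exact hnorm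
      have := dist_triangle (x + l • (-n) + z) x x0
      nlinarith
    have h1 := @hd' (x + l • (-n) + z, x) (by
      rw [Prod.dist_eq]; exact max_lt hyd (by linarith))
    simp only [e1] at h1
    have h2 := (abs_le.1 h1).2
    have h3 : fderiv ℝ ρ x0 (l • (-n) + z) ≤ - (l * ‖n‖ ^ 2) + ‖n‖ * (‖n‖ / 4 * l) := by
      rw [← inner_gradient, ← hndef, inner_add_right, inner_smul_right, inner_neg_right,
        real_inner_self_eq_norm_sq]
      have := (real_inner_le_norm n z).trans (mul_le_mul_of_nonneg_left hz hn0.le)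
      linarith
    have h4 := closure_le hρ hΩ hx
    have h5 : ‖n‖ / 4 * ‖l • (-n) + z‖ ≤ ‖n‖ / 4 * (5 / 4 * ‖n‖ * l) :=
      mul_le_mul_of_nonneg_left hnorm (by positivity)
    have h6 : 0 < l * ‖n‖ ^ 2 := by positivity
    rw [hΩ]
    change ρ _ < 0
    nlinarith

noncomputable def quart (p0 q : Euc N × ℝ) : ℝ := (‖q.1 - p0.1‖ ^ 2 + (q.2 - p0.2) ^ 2) * (‖q.1 - p0.1‖ ^ 2 + (q.2 - p0.2) ^ 2)

lemma quart_contDiff (p0 : Euc N × ℝ) : ContDiff ℝ 2 (quart p0) := by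
  have h : ContDiff ℝ 2 (fun q : Euc N × ℝ => ‖q.1 - p0.1‖ ^ 2 + (q.2 - p0.2) ^ 2) := by
    have : ContDiff ℝ 2 (fun q : Euc N × ℝ => ‖q.1 - p0.1‖ ^ 2) :=
      ContDiff.norm_sq ℝ (by fun_prop)
    exact this.add (by fun_prop)
  exact h.mul h

lemma quart_jet (p0 : Euc N × ℝ) : HasJet (quart p0) p0 0 0 0 := by
  have h1 := HasJet.normsq p0.1 p0
  have h2 : HasJet (fun q : Euc N × ℝ => (q.2 - p0.2) ^ 2) p0 0 0 0 :=
    HasJet.time (T := fun s => (s - p0.2) ^ 2) (by fun_prop) (by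
      have := ((hasDerivAt_id p0.2).sub_const p0.2).fun_pow 2
      simpa using this)
  have h3 := (h1.add h2).mul (h1.add h2)
  exact h3.congr (by simp) (by simp) (by simp)

lemma quart_ge {p0 q : Euc N × ℝ} {r : ℝ} (hr : 0 ≤ r) (h : r ≤ dist q p0) : r ^ 4 ≤ quart p0 q := by
  have h1 : r ^ 2 ≤ ‖q.1 - p0.1‖ ^ 2 + (q.2 - p0.2) ^ 2 := by
    rw [Prod.dist_eq] at h
    rcases le_max_iff.1 h with h | h
    · rw [dist_eq_norm] at h
      have := pow_le_pow_left₀ hr h 2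
      nlinarith [sq_nonneg (q.2 - p0.2)]
    · rw [Real.dist_eq] at h
      have := pow_le_pow_left₀ hr h 2
      rw [sq_abs] at this
      nlinarith [sq_nonneg ‖q.1 - p0.1‖]
  unfold quart
  nlinarith [sq_nonneg r]

lemma quart_nonneg (p0 q : Euc N × ℝ) : 0 ≤ quart p0 q := mul_self_nonneg _

set_option maxHeartbeats 1000000 in
lemma cmp_base {Ω : Set (Euc N)} (hΩo : IsOpen Ω) (hΩ2 : HasC2Boundary Ω)
    {m : ℝ} (hm : 2 < m) {f : Euc N → ℝ} (hf : Continuous f) {U V : Euc N × ℝ → ℝ}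
    (hU : Continuous U) (hV : Continuous V)
    (hsub : ViscSub (Ω ×ˢ Ioi 0) U (fun p v => ‖v‖ ^ m - f p.1))
    {Gd : Euc N → Prop} {p0 : Euc N × ℝ} (hx0 : p0.1 ∈ closure Ω) (ht0 : 0 < p0.2)
    (hsup : SupAt Ω f m V Gd p0) {χ : Euc N × ℝ → ℝ} (hχ : ContDiff ℝ 2 χ)
    {μ : ℝ} (hμ0 : 0 < μ) (hμ1 : μ ≤ 1) {Θ : Euc N → ℝ} (hΘ : Continuous Θ)
    (hΘ' : ∀ p q, Gd (μ • p + q) → ‖μ • p + q‖ ^ m - μ * ‖p‖ ^ m ≤ Θ q)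
    (hmax : ∀ᶠ q in 𝓝 p0, q.1 ∈ closure Ω → q.2 ≤ p0.2 →
      μ * U q + χ q - V q ≤ μ * U p0 + χ p0 - V p0) :
    (1 - μ) * f p0.1 ≤ dt χ p0 - lpl χ p0 + Θ (gr χ p0) := by
  by_contra hcon
  push Not at hcon
  set ψ : Euc N × ℝ → ℝ := fun q => χ q - quart p0 q with hψ
  have hψc : ContDiff ℝ 2 ψ := hχ.sub (quart_contDiff p0)
  have hj0 := (hχ.contDiffAt (x := p0)).hasJet.sub (quart_jet p0)
  obtain ⟨κ, hκ, hκ'⟩ : ∃ κ > 0, dt ψ p0 - lpl ψ p0 + Θ (gr ψ p0) < (1 - μ) * f p0.1 - 3 * κ := by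
    rw [hj0.hdt, hj0.hgr, hj0.hlp]
    refine ⟨((1 - μ) * f p0.1 - (dt χ p0 - lpl χ p0 + Θ (gr χ p0))) / 4, by linarith, ?_⟩
    simp only [sub_zero]
    linarith
  have hc1 : Continuous (fun p => dt ψ p - lpl ψ p + Θ (gr ψ p)) :=
    ((continuous_dt hψc).sub (continuous_lpl hψc)).add (hΘ.comp (continuous_gr hψc))
  have ev1 := hc1.continuousAt.eventually_lt_const hκ'
  have hc2 : Continuous (fun p : Euc N × ℝ => f p.1) := hf.comp continuous_fst
  have ev2 := hc2.continuousAt.eventually_lt_const (show f p0.1 < f p0.1 + κ by linarith)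
  have ev3 := hc2.continuousAt.eventually_const_lt (show f p0.1 - κ < f p0.1 by linarith)
  have ev4 : ∀ᶠ p : Euc N × ℝ in 𝓝 p0, 0 < p.2 :=
    continuous_snd.continuousAt.eventually_const_lt ht0
  obtain ⟨e, c, hc, r0, hr0, hcone⟩ := coneAt hΩo hΩ2 hx0
  obtain ⟨r1, hr1, hr1'⟩ := Metric.eventually_nhds_iff.1
    (ev1.and (ev2.and (ev3.and (ev4.and (hsup.and hmax)))))
  obtain ⟨r, hr, hrr0, hrr1⟩ : ∃ r > 0, r < r0 ∧ r < r1 :=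
    ⟨min r0 r1 / 2, by positivity, by linarith [min_le_left r0 r1, lt_min hr0 hr1],
      by linarith [min_le_right r0 r1, lt_min hr0 hr1]⟩
  obtain ⟨rh, hrh⟩ : ∃ rh, rh = r / 2 := ⟨_, rfl⟩
  have hrh0 : 0 < rh := by linarith
  have hK : IsCompact {q : Euc N × ℝ | dist q p0 ≤ rh ∧ q.1 ∈ closure Ω ∧ q.2 ≤ p0.2} := by
    refine (isCompact_closedBall p0 rh).of_isClosed_subset ?_ (fun q hq => hq.1)
    refine isClosed_closedBall.inter
      ((isClosed_closure.preimage continuous_fst).inter (isClosed_le continuous_snd continuous_const))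
  -- uniform continuity
  have huc := (isCompact_closedBall p0 r).uniformContinuousOn_of_continuous hU.continuousOn
  rw [Metric.uniformContinuousOn_iff] at huc
  obtain ⟨d, hd, hd'⟩ := huc (rh ^ 4 / 3) (by positivity)
  obtain ⟨l, hl, hlr0, hld, hlr⟩ : ∃ l > 0, l < r0 ∧ l * (‖e‖ + c) < d ∧ l * (‖e‖ + c) < rh := by
    have h0 : 0 < ‖e‖ + c := by positivity
    refine ⟨min r0 (min (d / (‖e‖ + c)) (rh / (‖e‖ + c))) / 2, by positivity, ?_, ?_, ?_⟩
    · have := min_le_left r0 (min (d / (‖e‖ + c)) (rh / (‖e‖ + c)))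
      linarith
    · rw [← lt_div_iff₀ h0]
      have := (min_le_right r0 (min (d / (‖e‖ + c)) (rh / (‖e‖ + c)))).trans (min_le_left _ _)
      have : 0 < d / (‖e‖ + c) := by positivity
      linarith
    · rw [← lt_div_iff₀ h0]
      have := (min_le_right r0 (min (d / (‖e‖ + c)) (rh / (‖e‖ + c)))).trans (min_le_right _ _)
      have : 0 < rh / (‖e‖ + c) := by positivity
      linarith
  obtain ⟨η, hη⟩ := exists_moll (N := N) (ε := c * l) (by positivity)
  set sh : Euc N × ℝ := (l • e, 0) with hsh
  have hshn : ‖sh‖ ≤ l * ‖e‖ := by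
    rw [hsh, Prod.norm_def, norm_smul, Real.norm_eq_abs, abs_of_pos hl]
    simp; positivity
  have hnear : ∀ q z : Euc N × ℝ, dist z (q + sh) ≤ c * l → dist z q ≤ l * (‖e‖ + c) := by
    intro q z hz
    have h1 := dist_triangle z (q + sh) q
    have h2 : dist (q + sh) q ≤ l * ‖e‖ := by rw [dist_eq_norm, add_sub_cancel_left]; exact hshn
    linarith
  set W := moll η U with hW
  have hWc : ContDiff ℝ 2 W := moll_contDiff hη hU
  have hclose : ∀ q, dist q p0 ≤ rh → |W (q + sh) - U q| ≤ rh ^ 4 / 3 := by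
    intro q hq
    refine hη.moll_close hU fun z hz => ?_
    have h1 := hnear q z hz
    have h2 := dist_triangle z q p0
    exact (hd' z (by rw [mem_closedBall]; linarith) q (by rw [mem_closedBall]; linarith)
      (by linarith)).le
  -- maximum point
  have hGc : Continuous (fun q => μ * W (q + sh) + ψ q - V q) :=
    ((continuous_const.mul (hWc.continuous.comp (by fun_prop))).add hψc.continuous).sub hV
  obtain ⟨q, ⟨hq1, hq2, hq3⟩, hqm⟩ := hK.exists_isMaxOn ⟨p0, by simpa using hrh0.le, hx0, le_rfl⟩
    hGc.continuousOn
  have hmp := hqm (show p0 ∈ {q : Euc N × ℝ | dist q p0 ≤ rh ∧ q.1 ∈ closure Ω ∧ q.2 ≤ p0.2} from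
    ⟨by simpa using hrh0.le, hx0, le_rfl⟩)
  simp only [mem_ofPred_eq] at hmp
  obtain ⟨g1, g2, g3, g4, g5, g6⟩ := hr1' (y := q) (by linarith)
  have hlt : dist q p0 < rh := by
    by_contra hge
    push Not at hge
    have h1 := quart_ge hrh0.le hge
    have h2 := abs_le.1 (hclose q hq1)
    have h3 := abs_le.1 (hclose p0 (by simpa using hrh0.le))
    have h4 := g6 hq2 hq3
    have h5 : quart p0 p0 = 0 := by simp [quart]
    have h6 : μ * (W (q + sh) - U q) ≤ rh ^ 4 / 3 := by
      have : 0 ≤ rh ^ 4 / 3 := by positivity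
      nlinarith
    have h7 : -(rh ^ 4 / 3) ≤ μ * (W (p0 + sh) - U p0) := by
      have : 0 ≤ rh ^ 4 / 3 := by positivity
      nlinarith
    have h8 : 0 < rh ^ 4 := by positivity
    simp only [hψ] at hmp
    rw [h5] at hmp
    nlinarith
  -- test
  have hjW : HasJet (fun q => W (q + sh)) q _ _ _ := (hWc.contDiffAt (x := q + sh)).hasJet.shift
  have hjφ := (hjW.const_mul μ).add (hψc.contDiffAt (x := q)).hasJet
  have hφc : ContDiff ℝ 2 (fun q => μ * W (q + sh) + ψ q) :=
    (contDiff_const.mul (hWc.comp (by fun_prop))).add hψc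
  have ht := g5 hq2 (fun q => μ * W (q + sh) + ψ q) hφc (by
    filter_upwards [isOpen_ball.mem_nhds (show q ∈ ball p0 rh from hlt)] with q' hq' h1 h2
    have := hqm (show q' ∈ {q : Euc N × ℝ | dist q p0 ≤ rh ∧ q.1 ∈ closure Ω ∧ q.2 ≤ p0.2} from
      ⟨(mem_ball.1 hq').le, h1, h2.trans hq3⟩)
    simp only [mem_ofPred_eq] at this
    linarith)
  rw [hjφ.hdt, hjφ.hlp, hjφ.hgr] at ht
  obtain ⟨ht1, ht2⟩ := ht
  have hΘq := hΘ' _ _ ht2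
  -- mollified subsolution
  have hM : dt W (q + sh) - lpl W (q + sh) + ‖gr W (q + sh)‖ ^ m ≤ f p0.1 + κ := by
    refine moll_sub hm hη (by positivity) hU
      (O := (Ω ×ˢ Ioi 0) ∩ ball p0 r) ((hΩo.prod isOpen_Ioi).inter isOpen_ball) ?_ ?_
    · refine hsub.mono inter_subset_left fun p hp v => ?_
      have := (hr1' (y := p) (by have := hp.2; rw [mem_ball] at this; linarith)).2.1
      linarith
    · intro z hz
      rw [mem_closedBall] at hz
      have h1 := hnear q z hz
      have h2 := dist_triangle z q p0
      have h3 : dist z p0 < r := by linarith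
      refine ⟨⟨?_, ?_⟩, h3⟩
      · refine hcone q.1 hq2 ?_ l hl hlr0 ?_
        · have : dist q.1 p0.1 ≤ dist q p0 := by rw [Prod.dist_eq]; exact le_max_left _ _
          linarith
        · rw [mem_closedBall]
          have : dist z.1 (q + sh).1 ≤ dist z (q + sh) := by rw [Prod.dist_eq]; exact le_max_left _ _
          simp only [hsh, Prod.fst_add] at this
          exact this.trans hz
      · exact (hr1' (y := z) (by linarith)).2.2.2.1
  have hμM := mul_le_mul_of_nonneg_left hM hμ0.le
  nlinarith

end CmpBase


/-! ### Part 6: comparison principles and the abstract setting -/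

section CmpTwo

variable {N : ℕ}

lemma conv_pow {m : ℝ} (hm : 2 < m) {μ : ℝ} (h0 : 0 < μ) (h1 : μ < 1) (p q : Euc N) :
    ‖μ • p + q‖ ^ m - μ * ‖p‖ ^ m ≤ (1 - μ) * ‖(1 - μ)⁻¹ • q‖ ^ m := by
  have h2 : 0 < 1 - μ := by linarith
  have e : ‖μ • p + q‖ ≤ μ * ‖p‖ + (1 - μ) * ‖(1 - μ)⁻¹ • q‖ := by
    have : μ • p + q = μ • p + (1 - μ) • ((1 - μ)⁻¹ • q) := by
      rw [smul_smul, mul_inv_cancel₀ h2.ne', one_smul]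
    rw [this]
    refine (norm_add_le _ _).trans ?_
    rw [norm_smul, norm_smul (1 - μ), Real.norm_eq_abs, Real.norm_eq_abs, abs_of_pos h0,
      abs_of_pos h2]
  have h3 := (convexOn_rpow (p := m) (by linarith)).2 (norm_nonneg p)
    (norm_nonneg ((1 - μ)⁻¹ • q)) h0.le h2.le (by ring)
  have h4 := Real.rpow_le_rpow (norm_nonneg _) e (by linarith : 0 ≤ m)
  simp only [smul_eq_mul] at h3
  linarith

lemma lip_pow {m : ℝ} (hm : 2 < m) {Λ : ℝ} (p q : Euc N) (h : ‖(1 : ℝ) • p + q‖ ≤ Λ) :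
    ‖(1 : ℝ) • p + q‖ ^ m - 1 * ‖p‖ ^ m ≤ m * Λ ^ (m - 1) * ‖q‖ := by
  rw [one_smul] at *
  rw [one_mul]
  have h1 := rpow_tangent hm (p + q) p
  have h2 : inner ℝ (p + q) p - ‖p + q‖ ^ 2 = - inner ℝ (p + q) q := by
    rw [← real_inner_self_eq_norm_sq, inner_add_right (p + q) p q]; ring
  rw [h2] at h1
  have h3 := real_inner_le_norm (p + q) q
  have h4 : 0 ≤ m * ‖p + q‖ ^ (m - 2) := by positivity
  have h5 : ‖p + q‖ ^ (m - 2) * ‖p + q‖ = ‖p + q‖ ^ (m - 1) := by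
    rw [← Real.rpow_add_one' (norm_nonneg _) (by linarith)]; congr 1; ring
  have h6 : ‖p + q‖ ^ (m - 1) ≤ Λ ^ (m - 1) :=
    Real.rpow_le_rpow (norm_nonneg _) h (by linarith)
  have h7 := mul_le_mul_of_nonneg_left h3 h4
  have h8 : m * ‖p + q‖ ^ (m - 2) * (‖p + q‖ * ‖q‖) = m * ‖p + q‖ ^ (m - 1) * ‖q‖ := by
    rw [← h5]; ring
  have h9 : m * ‖p + q‖ ^ (m - 1) * ‖q‖ ≤ m * Λ ^ (m - 1) * ‖q‖ := by gcongr
  linarith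

lemma cmp_strip {Ω : Set (Euc N)} (hΩo : IsOpen Ω) (hΩb : Bornology.IsBounded Ω)
    (hΩ2 : HasC2Boundary Ω)
    {m : ℝ} (hm : 2 < m) {f : Euc N → ℝ} (hf : Continuous f) {U V : Euc N × ℝ → ℝ}
    (hU : Continuous U) (hV : Continuous V)
    (hsub : ViscSub (Ω ×ˢ Ioi 0) U (fun p v => ‖v‖ ^ m - f p.1))
    {μ : ℝ} (hμ0 : 0 < μ) (hμ1 : μ < 1) {ψ : Euc N → ℝ} (hψ : ContDiff ℝ 2 ψ) {a : ℝ}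
    {S : Set (Euc N)} (hS : ∀ x ∈ closure Ω, x ∈ S →
      a + (1 - μ) * (- lapl ψ x + ‖gradient ψ x‖ ^ m - f x) < 0)
    {t1 t2 B : ℝ} (ht1 : 0 < t1)
    (hB : ∀ x ∈ closure Ω, ∀ t, t1 ≤ t → t ≤ t2 → (t = t1 ∨ x ∉ S ∨
      ¬ SupAt Ω f m V (fun _ => True) (x, t)) →
      μ * U (x, t) + ((1 - μ) * ψ x + a * t) - V (x, t) ≤ B) :
    ∀ x ∈ closure Ω, ∀ t, t1 ≤ t → t ≤ t2 →
      μ * U (x, t) + ((1 - μ) * ψ x + a * t) - V (x, t) ≤ B := by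
  intro x hx t h1 h2
  have hK : IsCompact (closure Ω ×ˢ Icc t1 t2) := hΩb.isCompact_closure.prod isCompact_Icc
  set χ : Euc N × ℝ → ℝ := fun q => (1 - μ) * ψ q.1 + a * q.2 with hχ
  have hχc : ContDiff ℝ 2 χ := by
    have : ContDiff ℝ 2 (fun q : Euc N × ℝ => ψ q.1) := hψ.comp contDiff_fst
    exact (contDiff_const.mul this).add (by fun_prop)
  have hGc : Continuous (fun q => μ * U q + χ q - V q) :=
    ((continuous_const.mul hU).add hχc.continuous).sub hV
  obtain ⟨p, hp, hpm⟩ := hK.exists_isMaxOn ⟨(x, t), mk_mem_prod hx ⟨h1, h2⟩⟩ hGc.continuousOn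
  have hpm' : ∀ q : Euc N × ℝ, q.1 ∈ closure Ω → t1 ≤ q.2 → q.2 ≤ t2 →
      μ * U q + χ q - V q ≤ μ * U p + χ p - V p := fun q h3 h4 h5 =>
    isMaxOn_iff.1 hpm q ⟨h3, h4, h5⟩
  obtain ⟨px, pt⟩ := p
  obtain ⟨hp1, hp2⟩ := (show px ∈ closure Ω ∧ pt ∈ Icc t1 t2 from hp)
  have hxt := hpm' (x, t) hx h1 h2
  simp only [hχ] at hxt
  refine le_trans hxt ?_
  by_cases hcase : pt = t1 ∨ px ∉ S ∨ ¬ SupAt Ω f m V (fun _ => True) (px, pt)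
  · exact hB px hp1 pt hp2.1 hp2.2 hcase
  exfalso
  push Not at hcase
  obtain ⟨hc1, hc2, hc3⟩ := hcase
  have hlt : t1 < pt := lt_of_le_of_ne hp2.1 (Ne.symm hc1)
  have hloc : ∀ᶠ q in 𝓝 (px, pt), q.1 ∈ closure Ω → q.2 ≤ (px, pt).2 →
      μ * U q + χ q - V q ≤ μ * U (px, pt) + χ (px, pt) - V (px, pt) := by
    have : ∀ᶠ q : Euc N × ℝ in 𝓝 (px, pt), t1 < q.2 :=
      continuous_snd.continuousAt.eventually_const_lt hlt
    filter_upwards [this] with q hq h1 h2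
    exact hpm' q h1 hq.le (h2.trans hp2.2)
  have hΘc : Continuous (fun q : Euc N => (1 - μ) * ‖(1 - μ)⁻¹ • q‖ ^ m) := by
    have hm0 : 0 ≤ m := by linarith
    have h1 : Continuous (fun q : Euc N => ‖(1 - μ)⁻¹ • q‖) := by fun_prop
    exact continuous_const.mul (h1.rpow_const (fun _ => Or.inr hm0))
  have := cmp_base (p0 := (px, pt)) hΩo hΩ2 hm hf hU hV hsub hp1 (ht1.trans hlt) hc3 hχc hμ0 hμ1.le
    hΘc (fun p q _ => conv_pow hm hμ0 hμ1 p q) hloc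
  have hj := ((HasJet.space (T := ψ) (p := (px, pt)) hψ.contDiffAt).const_mul (1 - μ)).add
    ((HasJet.snd (px, pt)).const_mul a)
  rw [hj.hdt, hj.hlp, hj.hgr] at this
  have h0 : 0 < 1 - μ := by linarith
  simp only [smul_zero, add_zero, mul_zero, mul_one, zero_add, smul_smul,
    inv_mul_cancel₀ h0.ne', one_smul] at this
  have := hS px hp1 hc2
  linarith

lemma cmp_lip {Ω : Set (Euc N)} (hΩo : IsOpen Ω)
    (hΩ2 : HasC2Boundary Ω)
    {m : ℝ} (hm : 2 < m) {f : Euc N → ℝ} (hf : Continuous f) {U V : Euc N × ℝ → ℝ}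
    (hU : Continuous U) (hV : Continuous V)
    (hsub : ViscSub (Ω ×ˢ Ioi 0) U (fun p v => ‖v‖ ^ m - f p.1))
    {Λ : ℝ} {p0 : Euc N × ℝ} (hx0 : p0.1 ∈ Ω) (ht0 : 0 < p0.2)
    (hsup : SupAt Ω f m V (fun v => ‖v‖ ≤ Λ) p0) {χ : Euc N × ℝ → ℝ} (hχ : ContDiff ℝ 2 χ)
    (hmax : ∀ᶠ q in 𝓝 p0, q.1 ∈ closure Ω → q.2 ≤ p0.2 →
      U q + χ q - V q ≤ U p0 + χ p0 - V p0) :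
    0 ≤ dt χ p0 - lpl χ p0 + m * Λ ^ (m - 1) * ‖gr χ p0‖ := by
  have := cmp_base hΩo hΩ2 hm hf hU hV hsub (subset_closure hx0) ht0 hsup hχ (μ := 1) one_pos le_rfl
    (Θ := fun q => m * Λ ^ (m - 1) * ‖q‖) (by fun_prop) (fun p q h => lip_pow hm p q h) (by
      simpa using hmax)
  simpa using this

/-! #### adding constants -/

lemma ViscSub.add_const {O : Set (Euc N × ℝ)} {u : Euc N × ℝ → ℝ} {H : Euc N × ℝ → Euc N → ℝ}
    (h : ViscSub O u H) (c : ℝ) : ViscSub O (fun q => u q + c) H := by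
  intro φ p hp hc hm
  refine h φ p hp hc ?_
  filter_upwards [hm] with q hq h1
  linarith [hq h1]

lemma SupAt.add_const {Ω : Set (Euc N)} {f : Euc N → ℝ} {m : ℝ} {V : Euc N × ℝ → ℝ}
    {Gd : Euc N → Prop} {p : Euc N × ℝ} (h : SupAt Ω f m V Gd p) (c : ℝ) :
    SupAt Ω f m (fun q => V q + c) Gd p := by
  filter_upwards [h] with q hq h1 φ hφ hm
  refine hq h1 φ hφ ?_
  filter_upwards [hm] with q' hq' h1 h2
  linarith [hq' h1 h2]

lemma gradient_le_of {φ : Euc N → ℝ} {x : Euc N} {Λ : ℝ} (hΛ : 0 ≤ Λ) (hd : DifferentiableAt ℝ φ x)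
    (h : ∀ᶠ y in 𝓝 x, φ y - φ x ≤ Λ * ‖y - x‖) : ‖gradient φ x‖ ≤ Λ := by
  set v := gradient φ x with hv
  rcases eq_or_ne v 0 with h0 | h0
  · rw [h0, norm_zero]
    exact hΛ
  have hvp : 0 < ‖v‖ := norm_pos_iff.2 h0
  have hl : HasDerivAt (fun s : ℝ => x + s • v) v 0 := by
    simpa using ((hasDerivAt_id (0 : ℝ)).smul_const v).const_add x
  have hd' : HasFDerivAt φ (fderiv ℝ φ x) (x + (0 : ℝ) • v) := by simpa using hd.hasFDerivAt
  have h1 : HasDerivAt (fun s : ℝ => φ (x + s • v)) (fderiv ℝ φ x v) 0 :=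
    hd'.comp_hasDerivAt (0 : ℝ) hl
  have h2 := (hasDerivAt_iff_tendsto_slope.1 h1).mono_left
    (nhdsWithin_mono 0 (fun s (hs : s ∈ Ioi (0 : ℝ)) => ne_of_gt hs))
  have h3 : fderiv ℝ φ x v ≤ Λ * ‖v‖ := by
    refine le_of_tendsto h2 ?_
    have h4 : Tendsto (fun s : ℝ => x + s • v) (𝓝 0) (𝓝 x) := by
      have := hl.continuousAt.tendsto
      simpa using this
    filter_upwards [(h4.eventually h).filter_mono nhdsWithin_le_nhds, self_mem_nhdsWithin] with s hs hs0
    have hs0' : 0 < s := hs0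
    rw [slope_def_field, sub_zero, div_le_iff₀ hs0']
    simp only [zero_smul, add_zero]
    rw [add_sub_cancel_left, norm_smul, Real.norm_eq_abs, abs_of_pos hs0'] at hs
    linarith
  rw [← inner_gradient, ← hv, real_inner_self_eq_norm_sq, sq] at h3
  exact le_of_mul_le_mul_right h3 hvp

lemma SupAt.lip {Ω : Set (Euc N)} {f : Euc N → ℝ} {m : ℝ} {w : Euc N → ℝ}
    {p : Euc N × ℝ} (h : SupAt Ω f m (fun q => w q.1) (fun _ => True) p) {Λ r : ℝ}
    (hΛ : 0 ≤ Λ) (hr : ball p.1 r ⊆ Ω) (hr0 : 0 < r)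
    (hl : ∀ y ∈ ball p.1 r, ∀ z ∈ ball p.1 r, |w y - w z| ≤ Λ * ‖y - z‖) :
    SupAt Ω f m (fun q => w q.1) (fun v => ‖v‖ ≤ Λ) p := by
  have hb : ∀ᶠ q : Euc N × ℝ in 𝓝 p, q.1 ∈ ball p.1 r :=
    continuous_fst.continuousAt.eventually (isOpen_ball.mem_nhds (mem_ball_self hr0))
  filter_upwards [h, hb] with q hq hqb h1 φ hφ hm
  refine ⟨(hq h1 φ hφ hm).1, ?_⟩
  refine gradient_le_of hΛ (slice_differentiableAt (hφ.differentiable (by norm_num) q)) ?_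
  have hc : ContinuousAt (fun y : Euc N => (y, q.2)) q.1 := by fun_prop
  filter_upwards [hc.eventually hm, isOpen_ball.mem_nhds hqb] with y hy hyb
  have h2 := hy (subset_closure (hr hyb)) le_rfl
  have h3 := (le_abs_self _).trans (hl y hyb q.1 hqb)
  linarith

end CmpTwo


/-! ### Part 7: the abstract setting and how to get it from the problem -/

section Setup

variable {N : ℕ}

structure Setting (Ω : Set (Euc N)) (m : ℝ) (f g : Euc N → ℝ) (U : Euc N × ℝ → ℝ)
    (w : Euc N → ℝ) : Prop where
  Ωo : IsOpen Ω
  Ωb : Bornology.IsBounded Ω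
  Ωc : IsConnected Ω
  Ω2 : HasC2Boundary Ω
  hm : 2 < m
  hf : Continuous f
  hg : Continuous g
  hU : Continuous U
  hw : Continuous w
  sub : ViscSub (Ω ×ˢ Ioi 0) U (fun p v => ‖v‖ ^ m - f p.1)
  subBd : ∀ q : Euc N × ℝ, q.1 ∈ frontier Ω → 0 < q.2 → ∀ φ : Euc N × ℝ → ℝ, ContDiff ℝ 2 φ →
    (∀ᶠ q' in 𝓝 q, q'.1 ∈ closure Ω → q'.2 ≤ q.2 → U q' - φ q' ≤ U q - φ q) →
    dt φ q - lpl φ q + ‖gr φ q‖ ^ m - f q.1 ≤ 0 ∨ U q ≤ g q.1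
  sup : ∀ p : Euc N × ℝ, p.1 ∈ closure Ω → 0 < p.2 → (p.1 ∈ Ω ∨ U p < g p.1) →
    SupAt Ω f m U (fun _ => True) p
  wsub : ViscSub (Ω ×ˢ Ioi 0) (fun q => w q.1) (fun p v => ‖v‖ ^ m - f p.1)
  wsup : ∀ p : Euc N × ℝ, p.1 ∈ closure Ω → SupAt Ω f m (fun q => w q.1) (fun _ => True) p
  wlip : ∀ x ∈ Ω, ∃ r > (0 : ℝ), closedBall x r ⊆ Ω ∧ ∃ Λ : ℝ, 0 ≤ Λ ∧
    ∀ y ∈ closedBall x r, ∀ z ∈ closedBall x r, |w y - w z| ≤ Λ * ‖y - z‖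

lemma Setting.shift {Ω : Set (Euc N)} {m : ℝ} {f g : Euc N → ℝ} {U : Euc N × ℝ → ℝ}
    {w : Euc N → ℝ} (h : Setting Ω m f g U w) (c : ℝ) : Setting Ω m f g U (fun x => w x + c) :=
  { h with
    hw := h.hw.add continuous_const
    wsub := h.wsub.add_const c
    wsup := fun p hp => (h.wsup p hp).add_const c
    wlip := fun x hx => by
      obtain ⟨r, hr, h1, Λ, hΛ, h2⟩ := h.wlip x hx
      refine ⟨r, hr, h1, Λ, hΛ, fun y hy z hz => ?_⟩
      have := h2 y hy z hz
      simpa using this }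

lemma exists_global {E : Type*} [NormedAddCommGroup E] [NormedSpace ℝ E] [FiniteDimensional ℝ E]
    {φ : E → ℝ} {p : E} (h : ContDiffAt ℝ 2 φ p) :
    ∃ φ' : E → ℝ, ContDiff ℝ 2 φ' ∧ φ' =ᶠ[𝓝 p] φ := by
  obtain ⟨r, hr, hr'⟩ := Metric.eventually_nhds_iff.1 (h.eventually (by simp))
  let b : ContDiffBump p := ⟨r / 4, r / 2, by linarith, by linarith⟩
  refine ⟨fun x => b x * φ x, ?_, ?_⟩
  · rw [contDiff_iff_contDiffAt]
    intro x
    by_cases hx : dist x p < r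
    · exact b.contDiff.contDiffAt.mul (hr' hx)
    · have : (fun x => b x * φ x) =ᶠ[𝓝 x] fun _ => 0 := by
        have ho : IsOpen {y : E | r / 2 < dist y p} :=
          isOpen_lt continuous_const (by fun_prop)
        filter_upwards [ho.mem_nhds (show r / 2 < dist x p by linarith)] with y hy
        have hy' : r / 2 < dist y p := hy
        rw [b.zero_of_le_dist (show r / 2 ≤ dist y p from hy'.le), zero_mul]
      exact contDiffAt_const.congr_of_eventuallyEq this
  · filter_upwards [b.eventuallyEq_one] with x hx
    rw [hx]; simp

lemma viscSub_of_par {Ω : Set (Euc N)} (hΩo : IsOpen Ω) {f f' g u₀ : Euc N → ℝ} {m : ℝ}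
    {u : Euc N → ℝ → ℝ} {U : Euc N × ℝ → ℝ} (hu : ∀ T > (0 : ℝ), IsParSub Ω f g u₀ 0 m T u)
    (hUu : ∀ x ∈ closure Ω, ∀ t, 0 ≤ t → U (x, t) = u x t)
    (hff : ∀ x ∈ closure Ω, f' x = f x) :
    ViscSub (Ω ×ˢ Ioi 0) U (fun p v => ‖v‖ ^ m - f' p.1) := by
  rintro φ ⟨x, t⟩ ⟨hx, ht⟩ hφ hmax
  have ht0 : 0 < t := ht
  have hx' : x ∈ Ω := hx
  obtain ⟨φ', hφ', he⟩ := exists_global hφ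
  have hloc : IsLocalMaxOn (fun p : Euc N × ℝ => u p.1 p.2 - φ' p) (closure Ω ×ˢ Ioc 0 t) (x, t) := by
    refine mem_nhdsWithin_iff_eventually.2 ?_
    filter_upwards [hmax, he] with q h1 h2 h3
    have h4 := h1 h3.2.2
    have h5 := hUu q.1 h3.1 q.2 h3.2.1.le
    have h6 := hUu x (subset_closure hx') t ht0.le
    have h7 : φ' (x, t) = φ (x, t) := he.self_of_nhds
    change u q.1 q.2 - φ' q ≤ u x t - φ' (x, t)
    rw [← h5, ← h6, h2, h7]
    exact h4
  have := ((hu t ht0).2.2 φ' hφ' x t ⟨subset_closure hx', ht0, le_rfl⟩ hloc).1 hx'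
  have e := parOp_eq f m φ' (u x t) (x, t)
  simp only at e
  rw [e] at this
  obtain ⟨j1, j2, j3⟩ := jets_congr he
  rw [j1, j2, j3] at this
  have h8 := hff x (subset_closure hx')
  simp only
  rw [h8]
  linarith

lemma subBd_of_par {Ω : Set (Euc N)} {f f' g g' u₀ : Euc N → ℝ} {m : ℝ}
    {u : Euc N → ℝ → ℝ} {U : Euc N × ℝ → ℝ} (hu : ∀ T > (0 : ℝ), IsParSub Ω f g u₀ 0 m T u)
    (hUu : ∀ x ∈ closure Ω, ∀ t, 0 ≤ t → U (x, t) = u x t)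
    (hff : ∀ x ∈ closure Ω, f' x = f x) (hgg : ∀ x ∈ frontier Ω, g' x = g x) :
    ∀ q : Euc N × ℝ, q.1 ∈ frontier Ω → 0 < q.2 → ∀ φ : Euc N × ℝ → ℝ, ContDiff ℝ 2 φ →
    (∀ᶠ q' in 𝓝 q, q'.1 ∈ closure Ω → q'.2 ≤ q.2 → U q' - φ q' ≤ U q - φ q) →
    dt φ q - lpl φ q + ‖gr φ q‖ ^ m - f' q.1 ≤ 0 ∨ U q ≤ g' q.1 := by
  rintro ⟨x, t⟩ hx ht φ hφ hmax
  simp only at hx ht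
  have hxc := frontier_subset_closure hx
  have hloc : IsLocalMaxOn (fun p : Euc N × ℝ => u p.1 p.2 - φ p) (closure Ω ×ˢ Ioc 0 t) (x, t) := by
    refine mem_nhdsWithin_iff_eventually.2 ?_
    filter_upwards [hmax] with q h1 h3
    have h4 := h1 h3.1 h3.2.2
    have h5 := hUu q.1 h3.1 q.2 h3.2.1.le
    have h6 := hUu x hxc t ht.le
    change u q.1 q.2 - φ q ≤ u x t - φ (x, t)
    rw [← h5, ← h6]
    exact h4
  have := ((hu t ht).2.2 φ hφ x t ⟨hxc, ht, le_rfl⟩ hloc).2 hx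
  have e := parOp_eq f m φ (u x t) (x, t)
  simp only at e
  rw [e, min_le_iff, ← hff x hxc, ← hgg x hx, ← hUu x hxc t ht.le] at this
  rcases this with h | h
  · exact Or.inl h
  · right; simp only; linarith

lemma supAt_of_par {Ω : Set (Euc N)} (hΩo : IsOpen Ω) {f f' g g' u₀ : Euc N → ℝ} {m : ℝ}
    {u : Euc N → ℝ → ℝ} {U : Euc N × ℝ → ℝ} (hu : ∀ T > (0 : ℝ), IsParSuper Ω f g u₀ 0 m T u)
    (hUc : Continuous U) (hgc : Continuous g')
    (hUu : ∀ x ∈ closure Ω, ∀ t, 0 ≤ t → U (x, t) = u x t)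
    (hff : ∀ x ∈ closure Ω, f' x = f x) (hgg : ∀ x ∈ frontier Ω, g' x = g x) :
    ∀ p : Euc N × ℝ, p.1 ∈ closure Ω → 0 < p.2 → (p.1 ∈ Ω ∨ U p < g' p.1) →
    SupAt Ω f' m U (fun _ => True) p := by
  intro p _ hp2 hp
  have ev1 : ∀ᶠ q : Euc N × ℝ in 𝓝 p, q.1 ∈ Ω ∨ U q < g' q.1 := by
    rcases hp with hp | hp
    · filter_upwards [continuous_fst.continuousAt.eventually (hΩo.mem_nhds hp)] with q hq
      exact Or.inl hq
    · filter_upwards [(isOpen_lt hUc (hgc.comp continuous_fst)).mem_nhds hp] with q hq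
      exact Or.inr hq
  have ev2 : ∀ᶠ q : Euc N × ℝ in 𝓝 p, 0 < q.2 :=
    continuous_snd.continuousAt.eventually_const_lt hp2
  filter_upwards [ev1, ev2]
  rintro ⟨x, t⟩ hxt ht hxc φ hφ hmin
  simp only at hxt ht hxc
  refine ⟨?_, trivial⟩
  have hloc : IsLocalMinOn (fun p : Euc N × ℝ => u p.1 p.2 - φ p) (closure Ω ×ˢ Ioc 0 t) (x, t) := by
    refine mem_nhdsWithin_iff_eventually.2 ?_
    filter_upwards [hmin] with q h1 h3
    have h4 := h1 h3.1 h3.2.2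
    have h5 := hUu q.1 h3.1 q.2 h3.2.1.le
    have h6 := hUu x hxc t ht.le
    change u x t - φ (x, t) ≤ u q.1 q.2 - φ q
    rw [← h5, ← h6]
    exact h4
  have := (hu t ht).2.2 φ hφ x t ⟨hxc, ht, le_rfl⟩ hloc
  have e := parOp_eq f m φ (u x t) (x, t)
  simp only at e
  rw [e, ← hff x hxc, ← hUu x hxc t ht.le] at this
  by_cases hx : x ∈ Ω
  · exact this.1 hx
  · have hxf : x ∈ frontier Ω := by rw [frontier, hΩo.interior_eq]; exact ⟨hxc, hx⟩
    have h1 := this.2 hxf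
    rw [← hgg x hxf, le_max_iff] at h1
    rcases h1 with h1 | h1
    · exact h1
    · exfalso
      rcases hxt with h2 | h2
      · exact hx h2
      · linarith

lemma statOp_slice (f : Euc N → ℝ) (m : ℝ) (φ : Euc N × ℝ → ℝ) (r : ℝ) (p : Euc N × ℝ) :
    statOp f 0 m (fun y => φ (y, p.2)) r p.1 = - lpl φ p + ‖gr φ p‖ ^ m - f p.1 := by
  unfold statOp lpl gr; simp

lemma viscSub_of_stat {Ω : Set (Euc N)} (hΩo : IsOpen Ω) {f f' : Euc N → ℝ} {m : ℝ}
    {w w' : Euc N → ℝ} (hw : ∀ φ : Euc N → ℝ, ContDiff ℝ 2 φ → ∀ x₀ ∈ Ω,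
      IsLocalMaxOn (w - φ) Ω x₀ → statOp f 0 m φ (w x₀) x₀ ≤ 0)
    (hww : ∀ x ∈ closure Ω, w' x = w x)
    (hff : ∀ x ∈ closure Ω, f' x = f x) :
    ViscSub (Ω ×ˢ Ioi 0) (fun q => w' q.1) (fun p v => ‖v‖ ^ m - f' p.1) := by
  rintro φ ⟨x, t⟩ ⟨hx, ht⟩ hφ hmax
  have hx' : x ∈ Ω := hx
  obtain ⟨φ', hφ', he⟩ := exists_global hφ
  obtain ⟨j1, j2, j3⟩ := jets_congr he
  have hc : ContinuousAt (fun y : Euc N => (y, t)) x := by fun_prop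
  have hc2 : ContinuousAt (fun s : ℝ => (x, s)) t := by fun_prop
  have hloc : IsLocalMaxOn (w - fun y => φ' (y, t)) Ω x := by
    refine mem_nhdsWithin_iff_eventually.2 ?_
    filter_upwards [hc.eventually hmax, hc.eventually he] with y h1 h2 h3
    have h4 := h1 le_rfl
    simp only [hww y (subset_closure h3), hww x (subset_closure hx')] at h4
    have h7 : φ' (x, t) = φ (x, t) := he.self_of_nhds
    change w y - φ' (y, t) ≤ w x - φ' (x, t)
    rw [h2, h7]
    exact h4
  have h1 := hw (fun y => φ' (y, t)) (hφ'.comp (by fun_prop)) x hx' hloc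
  rw [statOp_slice f m φ' (w x) (x, t)] at h1
  have h2 : dt φ (x, t) ≤ 0 := by
    have h3 := deriv_nonneg_of_left_max (h := fun s => - φ (x, s)) (t := t)
      (tslice_differentiableAt (hφ.differentiableAt (by norm_num))).neg (by
        filter_upwards [hc2.eventually hmax] with s hs h
        have := hs h
        linarith)
    rw [deriv.fun_neg] at h3
    unfold dt; simp only; linarith
  simp only [j2, j3] at h1
  simp only
  rw [hff x (subset_closure hx')]
  linarith

lemma supAt_of_stat {Ω : Set (Euc N)} {f f' : Euc N → ℝ} {m : ℝ}
    {w w' : Euc N → ℝ} (hw : ∀ φ : Euc N → ℝ, ContDiff ℝ 2 φ → ∀ x₀ ∈ closure Ω,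
      IsLocalMinOn (w - φ) (closure Ω) x₀ → 0 ≤ statOp f 0 m φ (w x₀) x₀)
    (hww : ∀ x ∈ closure Ω, w' x = w x)
    (hff : ∀ x ∈ closure Ω, f' x = f x) (p : Euc N × ℝ) :
    SupAt Ω f' m (fun q => w' q.1) (fun _ => True) p := by
  refine Eventually.of_forall ?_
  rintro ⟨x, t⟩ hx φ hφ hmin
  simp only at hx
  refine ⟨?_, trivial⟩
  have hc : ContinuousAt (fun y : Euc N => (y, t)) x := by fun_prop
  have hc2 : ContinuousAt (fun s : ℝ => (x, s)) t := by fun_prop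
  have hloc : IsLocalMinOn (w - fun y => φ (y, t)) (closure Ω) x := by
    refine mem_nhdsWithin_iff_eventually.2 ?_
    filter_upwards [hc.eventually hmin] with y h1 h3
    have h4 := h1 h3 le_rfl
    simp only [hww y h3, hww x hx] at h4
    exact h4
  have h1 := hw (fun y => φ (y, t)) (hφ.comp (by fun_prop)) x hx hloc
  rw [statOp_slice f m φ (w x) (x, t)] at h1
  have h2 : 0 ≤ dt φ (x, t) :=
    deriv_nonneg_of_left_max (h := fun s => φ (x, s)) (t := t)
      (tslice_differentiableAt (hφ.differentiable (by norm_num) (x, t))) (by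
        filter_upwards [hc2.eventually hmin] with s hs h
        have := hs hx h
        linarith)
  simp only at h1 ⊢
  rw [hff x hx]
  linarith

lemma par_of_stat {Ω : Set (Euc N)} {f g w : Euc N → ℝ} {m : ℝ} (hwc : ContinuousOn w (closure Ω))
    (h1 : IsStatSub Ω f g 0 m w) (h2 : IsStatSuper Ω f g 0 m w) :
    IsGlobalParSol Ω f g w 0 m (fun x _ => w x) := by
  have hcont : ContinuousOn (fun p : Euc N × ℝ => w p.1) (closure Ω ×ˢ (univ : Set ℝ)) :=
    hwc.comp continuousOn_fst (fun p hp => hp.1)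
  refine ⟨hcont.mono (prod_mono le_rfl (subset_univ _)), fun T hT => ⟨⟨?_, fun _ _ => le_rfl, ?_⟩,
    ⟨?_, fun _ _ => le_rfl, ?_⟩⟩⟩
  · exact (hcont.mono (prod_mono le_rfl (subset_univ _))).upperSemicontinuousOn
  · intro φ hφ x t hxt hmax
    have hmax' := mem_nhdsWithin_iff_eventually.1 hmax
    have hc : ContinuousAt (fun y : Euc N => (y, t)) x := by fun_prop
    have hc2 : ContinuousAt (fun s : ℝ => (x, s)) t := by fun_prop
    have hloc : IsLocalMaxOn (w - fun y => φ (y, t)) (closure Ω) x := by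
      refine mem_nhdsWithin_iff_eventually.2 ?_
      filter_upwards [hc.eventually hmax'] with y h1 h3
      exact h1 ⟨h3, hxt.2⟩
    have h3 : dt φ (x, t) ≤ 0 := by
      have h3 := deriv_nonneg_of_left_max (h := fun s => - φ (x, s)) (t := t)
        (tslice_differentiableAt (hφ.differentiable (by norm_num) (x, t))).neg (by
          filter_upwards [hc2.eventually hmax', eventually_gt_nhds hxt.2.1] with s hs h0 h
          have : w x - φ (x, s) ≤ w x - φ (x, t) := hs ⟨hxt.1, h0, h.trans hxt.2.2⟩
          linarith)
      rw [deriv.fun_neg] at h3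
      unfold dt; simp only; linarith
    have h4 := h1.2 (fun y => φ (y, t)) (hφ.comp (by fun_prop)) x hxt.1 hloc
    have e1 := statOp_slice f m φ (w x) (x, t)
    have e2 := parOp_eq f m φ (w x) (x, t)
    simp only at e1 e2
    rw [e1] at h4
    rw [e2]
    refine ⟨fun hx => by linarith [h4.1 hx], fun hx => ?_⟩
    refine le_trans (min_le_min_right _ ?_) (h4.2 hx)
    linarith
  · exact (hcont.mono (prod_mono le_rfl (subset_univ _))).lowerSemicontinuousOn
  · intro φ hφ x t hxt hmax
    have hmax' := mem_nhdsWithin_iff_eventually.1 hmax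
    have hc : ContinuousAt (fun y : Euc N => (y, t)) x := by fun_prop
    have hc2 : ContinuousAt (fun s : ℝ => (x, s)) t := by fun_prop
    have hloc : IsLocalMinOn (w - fun y => φ (y, t)) (closure Ω) x := by
      refine mem_nhdsWithin_iff_eventually.2 ?_
      filter_upwards [hc.eventually hmax'] with y h1 h3
      exact h1 ⟨h3, hxt.2⟩
    have h3 : 0 ≤ dt φ (x, t) :=
      deriv_nonneg_of_left_max (h := fun s => φ (x, s)) (t := t)
        (tslice_differentiableAt (hφ.differentiable (by norm_num) (x, t))) (by
          filter_upwards [hc2.eventually hmax', eventually_gt_nhds hxt.2.1] with s hs h0 h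
          have : w x - φ (x, t) ≤ w x - φ (x, s) := hs ⟨hxt.1, h0, h.trans hxt.2.2⟩
          linarith)
    have h4 := h2.2 (fun y => φ (y, t)) (hφ.comp (by fun_prop)) x hxt.1 hloc
    have e1 := statOp_slice f m φ (w x) (x, t)
    have e2 := parOp_eq f m φ (w x) (x, t)
    simp only at e1 e2
    rw [e1] at h4
    rw [e2]
    refine ⟨fun hx => by linarith [h4.1 hx], fun hx => ?_⟩
    refine le_trans (h4.2 hx) (max_le_max_right _ ?_)
    linarith

lemma exists_ext {X : Type*} [TopologicalSpace X] [NormalSpace X] {K : Set X} (hK : IsClosed K)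
    {h : X → ℝ} (hh : ContinuousOn h K) : ∃ h' : X → ℝ, Continuous h' ∧ ∀ x ∈ K, h' x = h x := by
  obtain ⟨F, hF⟩ := ContinuousMap.exists_restrict_eq hK (f := ⟨K.domRestrict h, hh.domRestrict⟩)
  refine ⟨F, F.continuous, fun x hx => ?_⟩
  exact congrArg (fun G : C(K, ℝ) => G ⟨x, hx⟩) hF

lemma setting_of {Ω : Set (Euc N)}
    (hΩo : IsOpen Ω) (hΩb : Bornology.IsBounded Ω) (hΩc : IsConnected Ω)
    (hΩ2 : HasC2Boundary Ω) {m : ℝ} (hm : 2 < m) {f u₀ g : Euc N → ℝ}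
    (hf : ContinuousOn f (closure Ω))
    (hg : ContinuousOn g (frontier Ω))
    {u : Euc N → ℝ → ℝ} (hu : IsGlobalParSol Ω f g u₀ 0 m u)
    {w : Euc N → ℝ} (hLip : LocLipIn Ω w) (hErg : IsSCSolution Ω f 0 m w) :
    ∃ f' g' U w', Setting Ω m f' g' U w' ∧ (∀ x ∈ frontier Ω, g' x = g x) ∧
      (∀ x ∈ closure Ω, w' x = w x) ∧ (∀ x ∈ closure Ω, ∀ t, 0 ≤ t → U (x, t) = u x t) := by
  obtain ⟨f', hf', hff⟩ := exists_ext isClosed_closure hf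
  obtain ⟨g', hg', hgg⟩ := exists_ext isClosed_frontier hg
  obtain ⟨w', hw', hww⟩ := exists_ext isClosed_closure hErg.1
  obtain ⟨U, hU, hUu'⟩ := exists_ext (isClosed_closure.prod isClosed_Ici) hu.1
  have hUu : ∀ x ∈ closure Ω, ∀ t, 0 ≤ t → U (x, t) = u x t := fun x hx t ht =>
    hUu' (x, t) ⟨hx, ht⟩
  have hs1 : ∀ T > (0 : ℝ), IsParSub Ω f g u₀ 0 m T u := fun T hT => (hu.2 T hT).1
  have hs2 : ∀ T > (0 : ℝ), IsParSuper Ω f g u₀ 0 m T u := fun T hT => (hu.2 T hT).2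
  refine ⟨f', g', U, w', ⟨hΩo, hΩb, hΩc, hΩ2, hm, hf', hg', hU, hw',
    viscSub_of_par hΩo hs1 hUu hff, subBd_of_par hs1 hUu hff hgg,
    supAt_of_par hΩo hs2 hU hg' hUu hff hgg,
    viscSub_of_stat hΩo hErg.2.1 hww hff, fun p _ => supAt_of_stat hErg.2.2 hww hff p, ?_⟩,
    hgg, hww, hUu⟩
  intro x hx
  obtain ⟨ε, hε, K, hK, h1⟩ := hLip x hx
  obtain ⟨r, hr, hr'⟩ := Metric.isOpen_iff.1 hΩo x hx
  have hm1 : 0 < min ε r := lt_min hε hr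
  have hsub : ∀ y ∈ closedBall x (min ε r / 2), y ∈ ball x ε ∧ y ∈ Ω := by
    intro y hy
    rw [mem_closedBall] at hy
    have h3 : dist y x < min ε r := by linarith
    exact ⟨h3.trans_le (min_le_left _ _), hr' (h3.trans_le (min_le_right _ _))⟩
  refine ⟨min ε r / 2, by positivity, fun y hy => (hsub y hy).2, K, hK, fun y hy z hz => ?_⟩
  rw [hww y (subset_closure (hsub y hy).2), hww z (subset_closure (hsub z hz).2)]
  exact h1 y (hsub y hy) z (hsub z hz)

end Setup


/-! ### Part 8: a priori bounds and the limit constant -/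

section Bounds

variable {N : ℕ} {Ω : Set (Euc N)} {m : ℝ} {f g : Euc N → ℝ} {U : Euc N × ℝ → ℝ} {w : Euc N → ℝ}

lemma le_of_small {X B Y : ℝ} (h : ∀ ν : ℝ, 0 < ν → ν < 1 / 2 → X ≤ B + ν * Y) : X ≤ B := by
  refine le_of_forall_pos_le_add fun ε hε => ?_
  have hY : 0 < 2 * (|Y| + 1) := by positivity
  have h1 := h (min (1 / 4) (ε / (2 * (|Y| + 1)))) (by positivity)
    (lt_of_le_of_lt (min_le_left _ _) (by norm_num))
  have h2 : min (1 / 4) (ε / (2 * (|Y| + 1))) * Y ≤ ε := by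
    have h3 : min (1 / 4) (ε / (2 * (|Y| + 1))) * Y ≤ min (1 / 4) (ε / (2 * (|Y| + 1))) * (2 * (|Y| + 1)) := by
      refine mul_le_mul_of_nonneg_left ?_ (by positivity)
      linarith [le_abs_self Y, abs_nonneg Y]
    have h4 : min (1 / 4) (ε / (2 * (|Y| + 1))) * (2 * (|Y| + 1)) ≤ ε := by
      rw [← le_div_iff₀ hY]; exact min_le_right _ _
    linarith
  linarith

namespace Setting

lemma cpt (h : Setting Ω m f g U w) : IsCompact (closure Ω) := h.Ωb.isCompact_closure

lemma bdd (h : Setting Ω m f g U w) {F : Euc N → ℝ} (hF : Continuous F) :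
    ∃ A : ℝ, 0 ≤ A ∧ ∀ x ∈ closure Ω, |F x| ≤ A := by
  obtain ⟨A, hA⟩ := h.cpt.exists_bound_of_continuousOn hF.continuousOn
  exact ⟨|A|, abs_nonneg A, fun x hx => (hA x hx).trans (le_abs_self A)⟩

lemma strict_zero (h : Setting Ω m f g U w) {F ν : ℝ} (hν : 0 < ν)
    (hF : ∀ x ∈ closure Ω, |f x| ≤ F) {x : Euc N} (hx : x ∈ closure Ω) :
    -(2 * ν * (F + 1)) + ν * (- lapl (fun _ : Euc N => (0 : ℝ)) x +
      ‖gradient (fun _ : Euc N => (0 : ℝ)) x‖ ^ m - f x) < 0 := by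
  have hm := h.hm
  rw [lapl_const, gradient_cst, norm_zero, Real.zero_rpow (by linarith)]
  have h1 := abs_le.1 (hF x hx)
  have h2 : 0 ≤ F := (abs_nonneg _).trans (hF x hx)
  nlinarith

lemma mono_max (h : Setting Ω m f g U w) {t1 t2 B : ℝ} (ht1 : 0 < t1) (ht : t1 ≤ t2)
    (hB : ∀ x ∈ closure Ω, U (x, t1) - w x ≤ B) : ∀ x ∈ closure Ω, U (x, t2) - w x ≤ B := by
  intro x hx
  obtain ⟨F, hF0, hF⟩ := h.bdd h.hf
  obtain ⟨A, hA0, hA⟩ := h.bdd (h.hU.comp (by fun_prop : Continuous fun x : Euc N => (x, t1)))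
  refine le_of_small (Y := A + U (x, t2) + 2 * (F + 1) * t2) fun ν hν0 hν1 => ?_
  have := cmp_strip h.Ωo h.Ωb h.Ω2 h.hm h.hf h.hU (h.hw.comp continuous_fst) h.sub
    (μ := 1 - ν) (by linarith) (by linarith) (ψ := fun _ => 0) contDiff_const
    (a := -(2 * ν * (F + 1))) (S := univ) (t1 := t1) (t2 := t2) (B := B + ν * A)
    (fun x hx _ => by rw [sub_sub_cancel]; exact h.strict_zero hν0 hF hx) ht1 (by
      rintro y hy t - - (h1 | h1 | h1)
      · subst h1
        have h2 := hB y hy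
        have h3 := (abs_le.1 (hA y hy)).1
        simp only [Function.comp] at h3 ⊢
        have h4 : 0 ≤ (2 * ν * (F + 1)) * t := by positivity
        nlinarith
      · exact absurd (mem_univ y) h1
      · exact absurd (h.wsup (y, t) hy) h1) x hx t2 ht le_rfl
  simp only [Function.comp] at this
  linarith

lemma lower (h : Setting Ω m f g U w) {t1 : ℝ} (ht1 : 0 < t1) :
    ∃ C : ℝ, ∀ t, t1 ≤ t → ∀ x ∈ closure Ω, w x - C ≤ U (x, t) := by
  obtain ⟨F, hF0, hF⟩ := h.bdd h.hf
  obtain ⟨A1, hA10, hA1⟩ := h.bdd (h.hU.comp (by fun_prop : Continuous fun x : Euc N => (x, t1)))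
  obtain ⟨A2, hA20, hA2⟩ := h.bdd h.hg
  obtain ⟨A3, hA30, hA3⟩ := h.bdd h.hw
  obtain ⟨A, hA⟩ : ∃ A, A = A1 + A2 + A3 := ⟨_, rfl⟩
  refine ⟨3 * A, fun t ht x hx => ?_⟩
  suffices hs : w x - 3 * A - U (x, t) ≤ 0 by linarith
  refine le_of_small (Y := w x - 3 * A + 2 * (F + 1) * t) fun ν hν0 hν1 => ?_
  have := cmp_strip h.Ωo h.Ωb h.Ω2 h.hm h.hf
    ((h.hw.comp continuous_fst).add continuous_const) h.hU (h.wsub.add_const (-(3 * A)))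
    (μ := 1 - ν) (by linarith) (by linarith) (ψ := fun _ => 0) contDiff_const
    (a := -(2 * ν * (F + 1))) (S := univ) (t1 := t1) (t2 := t) (B := 0)
    (fun x hx _ => by rw [sub_sub_cancel]; exact h.strict_zero hν0 hF hx) ht1 (by
      intro y hy t' ht' _ hc
      have h0 : - A ≤ U (y, t') := by
        rcases hc with (h1 | h1 | h1)
        · subst h1
          have h3 := (abs_le.1 (hA1 y hy)).1
          simp only [Function.comp] at h3
          linarith
        · exact absurd (mem_univ y) h1
        · have h2 : ¬ (y ∈ Ω ∨ U (y, t') < g y) := fun hh =>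
            h1 (h.sup (y, t') hy (by linarith) hh)
          push Not at h2
          linarith [h2.2, (abs_le.1 (hA2 y hy)).1]
      have h3 := (abs_le.1 (hA3 y hy)).2
      have h4 : 0 ≤ (2 * ν * (F + 1)) * t' := by
        have : 0 ≤ t' := by linarith
        positivity
      have h5 : (1 - ν) * (w y + -(3 * A)) ≤ - A := by nlinarith
      change (1 - ν) * (w y + -(3 * A)) + ((1 - (1 - ν)) * 0 + -(2 * ν * (F + 1)) * t') - U (y, t') ≤ 0
      linarith) x hx t ht le_rfl
  change (1 - ν) * (w x + -(3 * A)) + ((1 - (1 - ν)) * 0 + -(2 * ν * (F + 1)) * t) - U (x, t) ≤ 0 at this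
  nlinarith

/-- the basic facts about the limit constant -/
lemma limit_const (h : Setting Ω m f g U w) : ∃ M C0 : ℝ, 0 ≤ C0 ∧
    (∀ t, 1 ≤ t → ∀ x ∈ closure Ω, |U (x, t)| ≤ C0) ∧
    (∀ ε > (0 : ℝ), ∃ T, 1 ≤ T ∧ ∀ t, T ≤ t → ∀ x ∈ closure Ω, U (x, t) ≤ w x + M + ε) ∧
    (∀ t, 1 ≤ t → ∃ x ∈ closure Ω, w x + M ≤ U (x, t)) := by
  obtain ⟨C, hC⟩ := h.lower one_pos
  obtain ⟨A1, hA10, hA1⟩ := h.bdd (h.hU.comp (by fun_prop : Continuous fun x : Euc N => (x, (1 : ℝ))))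
  obtain ⟨A3, hA30, hA3⟩ := h.bdd h.hw
  have hup : ∀ t, 1 ≤ t → ∀ x ∈ closure Ω, U (x, t) - w x ≤ A1 + A3 := fun t ht =>
    h.mono_max one_pos ht fun x hx => by
      have h1 := (abs_le.1 (hA1 x hx)).2
      have h2 := (abs_le.1 (hA3 x hx)).1
      simp only [Function.comp] at h1
      linarith
  have hne : (closure Ω).Nonempty := h.Ωc.nonempty.closure
  set S : Set ℝ := {B | ∃ t, 1 ≤ t ∧ ∀ x ∈ closure Ω, U (x, t) - w x ≤ B} with hS
  have hSne : S.Nonempty := ⟨A1 + A3, 1, le_rfl, hup 1 le_rfl⟩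
  have hSb : BddBelow S := by
    refine ⟨-C, ?_⟩
    rintro B ⟨t, ht, hB⟩
    obtain ⟨x, hx⟩ := hne
    linarith [hB x hx, hC t ht x hx]
  refine ⟨sInf S, A1 + 2 * A3 + |C|, by positivity, ?_, ?_, ?_⟩
  · intro t ht x hx
    have h2 := abs_le.1 (hA3 x hx)
    have h3 := hup t ht x hx
    have h4 := hC t ht x hx
    have h5 := le_abs_self C
    have h6 := abs_nonneg C
    rw [abs_le]
    constructor <;> linarith
  · intro ε hε
    obtain ⟨B, ⟨t, ht, hB⟩, hBlt⟩ := exists_lt_of_csInf_lt hSne (show sInf S < sInf S + ε by linarith)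
    refine ⟨t, ht, fun t' ht' x hx => ?_⟩
    have := h.mono_max (by linarith) ht' hB x hx
    linarith
  · intro t ht
    have hc : Continuous (fun x => U (x, t) - w x) := (h.hU.comp (by fun_prop)).sub h.hw
    obtain ⟨x, hx, hm⟩ := h.cpt.exists_isMaxOn hne hc.continuousOn
    refine ⟨x, hx, ?_⟩
    have : U (x, t) - w x ∈ S := ⟨t, ht, fun y hy => isMaxOn_iff.1 hm y hy⟩
    linarith [csInf_le hSb this]

end Setting

end Bounds


/-! ### Part 9: local barriers and propagation of smallness of subsolutions -/

section Prop9

variable {N : ℕ} {Ω : Set (Euc N)} {m : ℝ} {f g : Euc N → ℝ} {U : Euc N × ℝ → ℝ} {w : Euc N → ℝ}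

lemma Setting.loc_cmp (h : Setting Ω m f g U w) {y : Euc N} {R t1 t2 : ℝ} (ht1 : 0 < t1)
    {b : Euc N × ℝ → ℝ}
    (hb : ∀ x ∈ closure Ω, ‖x - y‖ ≤ R → ∀ θ, t1 ≤ θ → θ ≤ t2 → ∃ a v l,
      HasJet b (x, θ) a v l ∧ 0 < a - l + ‖v‖ ^ m - f x)
    (hfr : ∀ x ∈ frontier Ω, ‖x - y‖ < R → ∀ θ, t1 ≤ θ → θ ≤ t2 → g x ≤ b (x, θ))
    (hinit : ∀ x ∈ closure Ω, ‖x - y‖ ≤ R → U (x, t1) ≤ b (x, t1))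
    (hlat : ∀ x ∈ closure Ω, ‖x - y‖ = R → ∀ θ, t1 ≤ θ → θ ≤ t2 → U (x, θ) ≤ b (x, θ)) :
    ∀ x ∈ closure Ω, ‖x - y‖ ≤ R → ∀ θ, t1 ≤ θ → θ ≤ t2 → U (x, θ) ≤ b (x, θ) := by
  intro x hx hxR θ hθ1 hθ2
  by_contra hcon
  push Not at hcon
  have hK : IsCompact ((closure Ω ∩ closedBall y R) ×ˢ Icc t1 t2) :=
    (h.cpt.inter_right isClosed_closedBall).prod isCompact_Icc
  have hcont : ContinuousOn (fun q => U q - b q) ((closure Ω ∩ closedBall y R) ×ˢ Icc t1 t2) := by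
    rintro ⟨x', θ'⟩ ⟨⟨h1, h2⟩, h3, h4⟩
    obtain ⟨a, v, l, hj, -⟩ := hb x' h1 (by simpa [dist_eq_norm] using h2) θ' h3 h4
    exact (h.hU.continuousAt.sub hj.cd.continuousAt).continuousWithinAt
  obtain ⟨⟨x1, θ1⟩, ⟨⟨hx1, hxb⟩, hθ⟩, hmax⟩ := hK.exists_isMaxOn
    ⟨(x, θ), mk_mem_prod ⟨hx, by simpa [dist_eq_norm] using hxR⟩ ⟨hθ1, hθ2⟩⟩ hcont
  have hxb' : ‖x1 - y‖ ≤ R := by simpa [dist_eq_norm] using hxb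
  have hpos : 0 < U (x1, θ1) - b (x1, θ1) := by
    have := isMaxOn_iff.1 hmax (x, θ) (mk_mem_prod ⟨hx, by simpa [dist_eq_norm] using hxR⟩ ⟨hθ1, hθ2⟩)
    linarith
  have hθ' : t1 < θ1 := by
    rcases hθ.1.eq_or_lt with h1 | h1
    · simp only at h1
      subst h1
      linarith [hinit x1 hx1 hxb']
    · exact h1
  have hlt : ‖x1 - y‖ < R := by
    rcases hxb'.eq_or_lt with h1 | h1
    · linarith [hlat x1 hx1 h1 θ1 hθ.1 hθ.2]
    · exact h1
  obtain ⟨a, v, l, hj, hstr⟩ := hb x1 hx1 hxb' θ1 hθ.1 hθ.2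
  obtain ⟨φ, hφ, hφe⟩ := exists_global hj.cd
  have hjφ := hj.congr_fun hφe
  have e1 : ∀ᶠ q : Euc N × ℝ in 𝓝 (x1, θ1), ‖q.1 - y‖ < R :=
    (by fun_prop : Continuous fun q : Euc N × ℝ => ‖q.1 - y‖).continuousAt.eventually_lt
      continuousAt_const hlt
  have e2 : ∀ᶠ q : Euc N × ℝ in 𝓝 (x1, θ1), t1 < q.2 :=
    continuousAt_const.eventually_lt (by fun_prop : Continuous fun q : Euc N × ℝ => q.2).continuousAt
      hθ'
  have hloc : ∀ᶠ q in 𝓝 (x1, θ1), q.1 ∈ closure Ω → q.2 ≤ θ1 →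
      U q - φ q ≤ U (x1, θ1) - φ (x1, θ1) := by
    filter_upwards [e1, e2, hφe] with q h1 h2 h3 h4 h5
    rw [h3, hφe.self_of_nhds]
    exact isMaxOn_iff.1 hmax q ⟨⟨h4, by simpa [dist_eq_norm] using h1.le⟩, h2.le, h5.trans hθ.2⟩
  have hθpos : 0 < θ1 := ht1.trans hθ'
  by_cases hin : x1 ∈ Ω
  · have := h.sub φ (x1, θ1) (mk_mem_prod hin hθpos) hφ.contDiffAt (by
      have e3 : ∀ᶠ q : Euc N × ℝ in 𝓝 (x1, θ1), q.1 ∈ Ω :=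
        continuous_fst.continuousAt.eventually (h.Ωo.mem_nhds hin)
      filter_upwards [hloc, e3] with q h1 h2
      exact h1 (subset_closure h2))
    rw [hjφ.hdt, hjφ.hlp, hjφ.hgr] at this
    simp only at this
    linarith
  · have hfx : x1 ∈ frontier Ω := by rw [h.Ωo.frontier_eq]; exact ⟨hx1, hin⟩
    rcases h.subBd (x1, θ1) hfx hθpos φ hφ hloc with h1 | h1
    · rw [hjφ.hdt, hjφ.hlp, hjφ.hgr] at h1
      simp only at h1
      linarith
    · have := hfr x1 hfx hlt θ1 hθ.1 hθ.2
      simp only at h1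
      linarith

/-- Young type inequality for the barrier -/
lemma young_bar {m A : ℝ} (hm : 2 < m) (hA : 0 < A) : ∃ C1 : ℝ, 0 ≤ C1 ∧ ∀ Y S : ℝ, 0 ≤ Y → 0 < S →
    (m / (2 * (m - 1))) * A * (Y ^ 2 * S ^ (m / (2 * (m - 1)) - 1)) ≤
      (2 * A * Y) ^ m + C1 * S ^ (-(m / (2 * (m - 1)))) := by
  obtain ⟨q, hq⟩ : ∃ q, q = m / (2 * (m - 1)) := ⟨_, rfl⟩
  have hq0 : 0 < q := by rw [hq]; apply div_pos <;> linarith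
  rw [← hq]
  have hm2 : m - 2 ≠ 0 := by linarith
  have hk : (0 : ℝ) < (2 * A) ^ m := by positivity
  refine ⟨q * A * (q * A / (2 * A) ^ m) ^ (2 / (m - 2)), by positivity, fun Y S hY hS => ?_⟩
  rcases le_or_gt (q * A * S ^ (q - 1)) ((2 * A) ^ m * Y ^ (m - 2)) with h1 | h1
  · have h2 : (2 * A * Y) ^ m = ((2 * A) ^ m * Y ^ (m - 2)) * Y ^ 2 := by
      rw [Real.mul_rpow (by positivity) hY, mul_assoc]
      congr 1
      rcases hY.eq_or_lt with h | h
      · rw [← h, Real.zero_rpow (by linarith)]; simp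
      · rw [← Real.rpow_natCast Y 2, ← Real.rpow_add h]; congr 1; push_cast; ring
    rw [h2]
    have h3 := mul_le_mul_of_nonneg_right h1 (sq_nonneg Y)
    have h4 : 0 ≤ q * A * (q * A / (2 * A) ^ m) ^ (2 / (m - 2)) * S ^ (-q) := by positivity
    calc _ = q * A * S ^ (q - 1) * Y ^ 2 := by ring
      _ ≤ _ := by linarith
  · have h2 : Y ^ (m - 2) ≤ q * A / (2 * A) ^ m * S ^ (q - 1) := by
      rw [div_mul_eq_mul_div, le_div_iff₀ hk]; linarith
    have h3 : Y ^ 2 ≤ (q * A / (2 * A) ^ m) ^ (2 / (m - 2)) * S ^ ((q - 1) * (2 / (m - 2))) := by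
      have h4 := Real.rpow_le_rpow (by positivity) h2 (show 0 ≤ 2 / (m - 2) by
        apply div_nonneg <;> linarith)
      rw [← Real.rpow_mul hY, Real.mul_rpow (by positivity) (by positivity), ← Real.rpow_mul hS.le,
        mul_div_cancel₀ _ hm2] at h4
      simpa using h4
    have h5 : S ^ ((q - 1) * (2 / (m - 2))) * S ^ (q - 1) = S ^ (-q) := by
      rw [← Real.rpow_add hS]
      congr 1
      have hm1 : m - 1 ≠ 0 := by linarith
      rw [hq]; field_simp; ring
    calc q * A * (Y ^ 2 * S ^ (q - 1))
        ≤ q * A * (((q * A / (2 * A) ^ m) ^ (2 / (m - 2)) * S ^ ((q - 1) * (2 / (m - 2)))) * S ^ (q - 1)) := by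
          gcongr
      _ = q * A * (q * A / (2 * A) ^ m) ^ (2 / (m - 2)) * (S ^ ((q - 1) * (2 / (m - 2))) * S ^ (q - 1)) := by ring
      _ = q * A * (q * A / (2 * A) ^ m) ^ (2 / (m - 2)) * S ^ (-q) := by rw [h5]
      _ ≤ _ := by have : 0 ≤ (2 * A * Y) ^ m := by positivity
                  linarith

end Prop9


section Prop10

variable {N : ℕ} {Ω : Set (Euc N)} {m : ℝ} {f g : Euc N → ℝ} {U : Euc N × ℝ → ℝ} {w : Euc N → ℝ}

lemma HasJet.tpow (e β : ℝ) (p : Euc N × ℝ) (hp : 0 < p.2 + e) :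
    HasJet (fun q : Euc N × ℝ => (q.2 + e) ^ β) p (β * (p.2 + e) ^ (β - 1)) 0 0 := by
  refine HasJet.time (T := fun s : ℝ => (s + e) ^ β) ?_ ?_
  · exact ContDiffAt.rpow_const_of_ne (by fun_prop) hp.ne'
  · have := ((hasDerivAt_id p.2).add_const e).rpow_const (p := β) (Or.inl hp.ne')
    simpa using this

lemma bar_jet {e β q K A : ℝ} (c : ℝ) (y : Euc N) (p : Euc N × ℝ) (hp : 0 < p.2 + e) :
    HasJet (fun z : Euc N × ℝ => c + K * (z.2 + e) ^ β + A * (‖z.1 - y‖ ^ 2 * (z.2 + e) ^ (-q))) p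
      (K * (β * (p.2 + e) ^ (β - 1)) + A * (‖p.1 - y‖ ^ 2 * (-q * (p.2 + e) ^ (-q - 1))))
      ((2 * A * (p.2 + e) ^ (-q)) • (p.1 - y)) (2 * N * A * (p.2 + e) ^ (-q)) := by
  have h1 := ((HasJet.const c p).add ((HasJet.tpow e β p hp).const_mul K)).add
    (((HasJet.normsq y p).mul (HasJet.tpow e (-q) p hp)).const_mul A)
  refine h1.congr ?_ ?_ ?_
  · ring
  · simp only [smul_zero, zero_add, smul_smul]
    congr 1; ring
  · simp; ring

lemma bar_strict {m q A C1 K F e : ℝ} (hm : 2 < m) (hq : q = m / (2 * (m - 1))) (hA : 0 < A) (_hC1 : 0 ≤ C1)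
    (hF : 0 ≤ F)
    (hY : ∀ Y S : ℝ, 0 ≤ Y → 0 < S → q * A * (Y ^ 2 * S ^ (q - 1)) ≤ (2 * A * Y) ^ m + C1 * S ^ (-q))
    (hK : C1 + 2 * N * A + F + 1 ≤ K * (1 - q))
    (y : Euc N) (p : Euc N × ℝ) (hp : 0 < p.2 + e) (hp1 : p.2 + e ≤ 1) :
    F < (K * ((1 - q) * (p.2 + e) ^ ((1 - q) - 1)) + A * (‖p.1 - y‖ ^ 2 * (-q * (p.2 + e) ^ (-q - 1))))
      - (2 * N * A * (p.2 + e) ^ (-q)) + ‖(2 * A * (p.2 + e) ^ (-q)) • (p.1 - y)‖ ^ m := by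
  set S := p.2 + e with hS
  have hq0 : 0 < q := by rw [hq]; apply div_pos <;> linarith
  have h1 := hY (‖p.1 - y‖ * S ^ (-q)) S (by positivity) hp
  have h2 : ‖(2 * A * S ^ (-q)) • (p.1 - y)‖ = 2 * A * (‖p.1 - y‖ * S ^ (-q)) := by
    rw [norm_smul, Real.norm_eq_abs, abs_of_nonneg (by positivity)]; ring
  have h3 : S ^ ((1 - q) - 1) = S ^ (-q) := by congr 1; ring
  have h4 : (‖p.1 - y‖ * S ^ (-q)) ^ 2 * S ^ (q - 1) = ‖p.1 - y‖ ^ 2 * S ^ (-q - 1) := by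
    have : (S ^ (-q)) ^ 2 * S ^ (q - 1) = S ^ (-q - 1) := by
      rw [sq, ← Real.rpow_add hp, ← Real.rpow_add hp]; congr 1; ring
    rw [mul_pow, mul_assoc, this]
  rw [h4] at h1
  rw [h2, h3]
  have h5 : 1 ≤ S ^ (-q) := Real.one_le_rpow_of_pos_of_le_one_of_nonpos hp hp1 (by linarith)
  have h6 : (C1 + 2 * N * A + F + 1) * S ^ (-q) ≤ K * (1 - q) * S ^ (-q) := by gcongr
  nlinarith

lemma Setting.propagate (h : Setting Ω m f g U w) {C0 : ℝ} (hC00 : 0 ≤ C0)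
    (hC0 : ∀ t, 1 ≤ t → ∀ x ∈ closure Ω, |U (x, t)| ≤ C0) {R : ℝ} (hR : 0 < R) {η : ℝ}
    (hη : 0 < η) : ∃ τ r : ℝ, 0 < τ ∧ τ ≤ 1 / 2 ∧ 0 < r ∧ r ≤ R ∧ ∀ y, closedBall y R ⊆ Ω →
      ∀ t, 1 ≤ t → ∀ x, ‖x - y‖ ≤ r → U (x, t + τ) ≤ U (y, t) + η := by
  obtain ⟨F, hF0, hF⟩ := h.bdd h.hf
  have hm := h.hm
  obtain ⟨q, hq⟩ : ∃ q, q = m / (2 * (m - 1)) := ⟨_, rfl⟩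
  have hq0 : 0 < q := by rw [hq]; apply div_pos <;> linarith
  have hq1 : q < 1 := by rw [hq, div_lt_one (by linarith)]; linarith
  obtain ⟨A, hA⟩ : ∃ A, A = 2 * (C0 + 1) / R ^ 2 := ⟨_, rfl⟩
  have hA0 : 0 < A := by rw [hA]; positivity
  have hAR : A * R ^ 2 = 2 * (C0 + 1) := by rw [hA]; field_simp
  obtain ⟨C1, hC1, hY⟩ := young_bar hm hA0
  rw [← hq] at hY
  have hβ : 0 < 1 - q := by linarith
  obtain ⟨K, hK⟩ : ∃ K, K = (C1 + 2 * N * A + F + 1) / (1 - q) := ⟨_, rfl⟩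
  have hK0 : 0 < K := by rw [hK]; positivity
  have hK1 : C1 + 2 * N * A + F + 1 ≤ K * (1 - q) := by rw [hK]; field_simp; exact le_rfl
  -- choice of `τ`
  obtain ⟨τ, hτ, hτ0, hτ1⟩ : ∃ τ : ℝ, K * (2 * τ) ^ (1 - q) < η / 4 ∧ 0 < τ ∧ τ < 1 / 2 := by
    have hc : ContinuousAt (fun τ : ℝ => K * (2 * τ) ^ (1 - q)) 0 :=
      continuousAt_const.mul ((by fun_prop : ContinuousAt (fun τ : ℝ => 2 * τ) 0).rpow_const
        (Or.inr hβ.le))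
    have h1 : ∀ᶠ τ in 𝓝 (0 : ℝ), K * (2 * τ) ^ (1 - q) < η / 4 :=
      hc.eventually_lt continuousAt_const (by
        simp only [mul_zero]; rw [Real.zero_rpow hβ.ne', mul_zero]; positivity)
    have h2 : ∀ᶠ τ in 𝓝[>] (0 : ℝ), 0 < τ ∧ τ < 1 / 2 := by
      filter_upwards [Ioo_mem_nhdsGT (show (0 : ℝ) < 1 / 2 by norm_num)] with τ hτ
      exact hτ
    obtain ⟨τ, h3, h4⟩ := ((h1.filter_mono nhdsWithin_le_nhds).and h2).exists
    exact ⟨τ, h3, h4.1, h4.2⟩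
  obtain ⟨r, hr, hr0, hrR⟩ : ∃ r : ℝ, A * r ^ 2 * τ ^ (-q) < η / 4 ∧ 0 < r ∧ r < R := by
    have hc : ContinuousAt (fun r : ℝ => A * r ^ 2 * τ ^ (-q)) 0 := by fun_prop
    have h1 : ∀ᶠ r in 𝓝 (0 : ℝ), A * r ^ 2 * τ ^ (-q) < η / 4 :=
      hc.eventually_lt continuousAt_const (by simp; positivity)
    obtain ⟨r, h3, h4⟩ := ((h1.filter_mono nhdsWithin_le_nhds).and (Ioo_mem_nhdsGT hR)).exists
    exact ⟨r, h3, h4.1, h4.2⟩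
  refine ⟨τ, r, hτ0, hτ1.le, hr0, hrR.le, fun y hy t ht x hx => ?_⟩
  -- modulus of continuity at time `t`
  obtain ⟨d, hd0, hd⟩ : ∃ d > (0 : ℝ), ∀ z, ‖z - y‖ < d → U (z, t) < U (y, t) + η / 2 := by
    have hc : Continuous fun z : Euc N => U (z, t) := h.hU.comp (by fun_prop)
    obtain ⟨d, hd, h1⟩ := Metric.eventually_nhds_iff.1
      (hc.continuousAt.eventually_lt continuousAt_const
        (show U (y, t) < U (y, t) + η / 2 by linarith))
    exact ⟨d, hd, fun z hz => h1 (by rwa [dist_eq_norm])⟩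
  obtain ⟨ε, hε, hε0, hε1⟩ : ∃ ε : ℝ, 2 * C0 ≤ A * d ^ 2 * ε ^ (-q) ∧ 0 < ε ∧ ε < τ := by
    have h1 : Tendsto (fun ε : ℝ => ε ^ (-q)) (𝓝[>] 0) atTop :=
      tendsto_rpow_neg_nhdsGT_zero (by linarith)
    have h2 : ∀ᶠ ε in 𝓝[>] (0 : ℝ), 2 * C0 / (A * d ^ 2) ≤ ε ^ (-q) := h1.eventually_ge_atTop _
    obtain ⟨r, h3, h4⟩ := (h2.and (Ioo_mem_nhdsGT hτ0)).exists
    refine ⟨r, ?_, h4.1, h4.2⟩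
    rw [div_le_iff₀ (by positivity)] at h3
    linarith
  have hycl : y ∈ closure Ω := subset_closure (hy (mem_closedBall_self hR.le))
  have hbcl : ∀ z : Euc N, ‖z - y‖ ≤ R → z ∈ Ω := fun z hz => hy (by simpa [dist_eq_norm] using hz)
  have hkey := h.loc_cmp (y := y) (R := R) (t1 := t) (t2 := t + τ) (by linarith)
    (b := fun z => (U (y, t) + η / 2) + K * (z.2 + (ε - t)) ^ (1 - q) +
      A * (‖z.1 - y‖ ^ 2 * (z.2 + (ε - t)) ^ (-q))) (by
      intro z hz hzR θ h1 h2
      have hp : 0 < ((z, θ) : Euc N × ℝ).2 + (ε - t) := by simp only; linarith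
      refine ⟨_, _, _, bar_jet _ y (z, θ) hp, ?_⟩
      have h3 := bar_strict (N := N) hm hq hA0 hC1 hF0 hY hK1 y (z, θ) hp (by simp only; linarith)
      have h4 := (abs_le.1 (hF z hz)).2
      linarith) (by
      intro z hz hzR
      rw [h.Ωo.frontier_eq] at hz
      exact absurd (hbcl z hzR.le) hz.2) (by
      intro z hz hzR
      simp only
      have e : t + (ε - t) = ε := by ring
      rw [e]
      have h1 : 0 ≤ K * ε ^ (1 - q) := by positivity
      rcases lt_or_ge (‖z - y‖) d with h2 | h2
      · have h3 := hd z h2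
        have h4 : 0 ≤ A * (‖z - y‖ ^ 2 * ε ^ (-q)) := by positivity
        linarith
      · have h3 : A * d ^ 2 * ε ^ (-q) ≤ A * (‖z - y‖ ^ 2 * ε ^ (-q)) := by
          rw [mul_assoc]; gcongr
        have h4 := abs_le.1 (hC0 t ht z hz)
        have h5 := abs_le.1 (hC0 t ht y hycl)
        linarith) (by
      intro z hz hzR θ h1 h2
      simp only
      rw [hzR]
      have hp : 0 < θ + (ε - t) := by linarith
      have h6 : 0 ≤ K * (θ + (ε - t)) ^ (1 - q) := by positivity
      have h7 : 1 ≤ (θ + (ε - t)) ^ (-q) :=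
        Real.one_le_rpow_of_pos_of_le_one_of_nonpos hp (by linarith) (by linarith)
      have h8 : A * R ^ 2 * 1 ≤ A * R ^ 2 * (θ + (ε - t)) ^ (-q) := by gcongr
      have h4 := abs_le.1 (hC0 θ (by linarith) z hz)
      have h5 := abs_le.1 (hC0 t ht y hycl)
      rw [← mul_assoc]
      linarith) x (subset_closure (hbcl x (hx.trans hrR.le))) (hx.trans hrR.le) (t + τ)
      (by linarith) le_rfl
  simp only at hkey
  have e : t + τ + (ε - t) = τ + ε := by ring
  rw [e] at hkey
  have h1 : (τ + ε) ^ (1 - q) ≤ (2 * τ) ^ (1 - q) := by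
    apply Real.rpow_le_rpow <;> linarith
  have h2 : (τ + ε) ^ (-q) ≤ τ ^ (-q) :=
    Real.rpow_le_rpow_of_nonpos hτ0 (by linarith) (by linarith)
  have h3 : ‖x - y‖ ^ 2 ≤ r ^ 2 := by gcongr
  have h4 : A * (‖x - y‖ ^ 2 * (τ + ε) ^ (-q)) ≤ A * (r ^ 2 * τ ^ (-q)) := by
    gcongr
  have h5 : K * (τ + ε) ^ (1 - q) ≤ K * (2 * τ) ^ (1 - q) := by gcongr
  linarith

end Prop10


/-! ### Part 11: moving balls -/

section Prop11

variable {N : ℕ} {Ω : Set (Euc N)} {m : ℝ} {f g : Euc N → ℝ} {U : Euc N × ℝ → ℝ} {w : Euc N → ℝ}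

lemma tube_jet (κ lam t1 r : ℝ) (a v : Euc N) (p : Euc N × ℝ) :
    HasJet (fun q : Euc N × ℝ => (κ * Real.exp (-lam * (q.2 - t1))) *
      ((r ^ 2 - ‖q.1 - (a + q.2 • v)‖ ^ 2) * (r ^ 2 - ‖q.1 - (a + q.2 • v)‖ ^ 2))) p
      ((κ * Real.exp (-lam * (p.2 - t1))) * (4 * (r ^ 2 - ‖p.1 - (a + p.2 • v)‖ ^ 2) *
          inner ℝ (p.1 - (a + p.2 • v)) v - lam * (r ^ 2 - ‖p.1 - (a + p.2 • v)‖ ^ 2) ^ 2))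
      ((-(κ * Real.exp (-lam * (p.2 - t1))) * 4 * (r ^ 2 - ‖p.1 - (a + p.2 • v)‖ ^ 2)) •
        (p.1 - (a + p.2 • v)))
      ((κ * Real.exp (-lam * (p.2 - t1))) * (8 * ‖p.1 - (a + p.2 • v)‖ ^ 2 -
        4 * N * (r ^ 2 - ‖p.1 - (a + p.2 • v)‖ ^ 2))) := by
  have hT : HasJet (fun q : Euc N × ℝ => κ * Real.exp (-lam * (q.2 - t1))) p
      (-lam * (κ * Real.exp (-lam * (p.2 - t1)))) 0 0 := by
    refine HasJet.time (T := fun s : ℝ => κ * Real.exp (-lam * (s - t1))) ?_ ?_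
    · exact ContDiff.contDiffAt (by fun_prop)
    · have := ((((hasDerivAt_id p.2).sub_const t1).const_mul (-lam)).exp).const_mul κ
      refine this.congr_deriv ?_
      simp only [id, mul_one]
      ring
  have hG := (HasJet.const (r ^ 2) p).sub (HasJet.movsq a v p)
  have := hT.mul (hG.mul hG)
  refine this.congr ?_ ?_ ?_
  · ring
  · simp only [smul_zero, add_zero, zero_sub, smul_smul, ← add_smul, ← neg_smul]
    congr 1; ring
  · simp only [inner_zero_left, zero_sub, inner_neg_neg, inner_smul_left, inner_smul_right,
      real_inner_self_eq_norm_sq]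
    rw [show (starRingEnd ℝ) 2 = 2 from rfl]
    ring

lemma Setting.tube (h : Setting Ω m f g U w) {x0 : Euc N} {r0 Λ : ℝ} (hb : closedBall x0 r0 ⊆ Ω)
    (hΛ : 0 ≤ Λ) (hl : ∀ y ∈ closedBall x0 r0, ∀ z ∈ closedBall x0 r0, |w y - w z| ≤ Λ * ‖y - z‖)
    {r : ℝ} (hr : 0 < r) (ν : ℝ) :
    ∃ lam : ℝ, 0 < lam ∧ ∀ a v : Euc N, ‖v‖ ≤ ν → ∀ t1 t2 : ℝ, 0 < t1 →
      (∀ t, t1 ≤ t → t ≤ t2 → ‖a + t • v - x0‖ + r < r0) → ∀ c ε : ℝ, 0 < c → 0 ≤ ε →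
      (∀ x, ‖x - (a + t1 • v)‖ ≤ r → U (x, t1) - w x ≤ -c) →
      (∀ t, t1 ≤ t → t ≤ t2 → ∀ x ∈ closure Ω, U (x, t) ≤ w x + ε) →
      ∀ t, t1 ≤ t → t ≤ t2 → ∀ x, ‖x - (a + t • v)‖ ≤ r → U (x, t) - w x ≤
        ε - c / r ^ 4 * Real.exp (-lam * (t - t1)) * (r ^ 2 - ‖x - (a + t • v)‖ ^ 2) ^ 2 := by
  have hm := h.hm
  obtain ⟨C, hC⟩ : ∃ C, C = m * Λ ^ (m - 1) := ⟨_, rfl⟩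
  have hC0 : 0 ≤ C := by rw [hC]; have : 0 ≤ m := by linarith
                         positivity
  obtain ⟨E, hE⟩ : ∃ E, E = 4 * r * ν + 8 + 4 * N + 4 * C * r := ⟨_, rfl⟩
  obtain ⟨lam, hlam⟩ : ∃ lam, lam = (E ^ 2 + 1) / (32 * r ^ 2) := ⟨_, rfl⟩
  have hlam0 : 0 < lam := by rw [hlam]; positivity
  have hlE : E ^ 2 < 32 * lam * r ^ 2 := by
    have : 32 * lam * r ^ 2 = E ^ 2 + 1 := by rw [hlam]; field_simp
    linarith
  refine ⟨lam, hlam0, fun a v hv t1 t2 ht1 hin c ε hc hε hinit hup t hta htb x hx => ?_⟩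
  set χ : Euc N × ℝ → ℝ := fun q => (c / r ^ 4 * Real.exp (-lam * (q.2 - t1))) *
      ((r ^ 2 - ‖q.1 - (a + q.2 • v)‖ ^ 2) * (r ^ 2 - ‖q.1 - (a + q.2 • v)‖ ^ 2)) with hχ
  have hχc : ContDiff ℝ 2 χ := contDiff_iff_contDiffAt.2 fun p => (tube_jet _ _ _ _ a v p).cd
  set K : Set (Euc N × ℝ) := {q | t1 ≤ q.2 ∧ q.2 ≤ t2 ∧ ‖q.1 - (a + q.2 • v)‖ ≤ r} with hKdef
  have hsubK : ∀ q ∈ K, ‖q.1 - x0‖ < r0 := by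
    rintro q ⟨h1, h2, h3⟩
    have h4 := hin q.2 h1 h2
    have h5 : q.1 - x0 = (q.1 - (a + q.2 • v)) + (a + q.2 • v - x0) := by abel
    rw [h5]
    exact (norm_add_le _ _).trans_lt (by linarith)
  have hKc : IsCompact K := by
    refine IsCompact.of_isClosed_subset ((isCompact_closedBall x0 r0).prod (isCompact_Icc (a := t1) (b := t2))) ?_ ?_
    · exact (isClosed_le continuous_const continuous_snd).inter
        ((isClosed_le continuous_snd continuous_const).inter
          (isClosed_le (by fun_prop : Continuous fun q : Euc N × ℝ => ‖q.1 - (a + q.2 • v)‖)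
            continuous_const))
    · rintro q hq
      exact ⟨by simpa [dist_eq_norm] using (hsubK q hq).le, hq.1, hq.2.1⟩
  have hwc : Continuous fun q : Euc N × ℝ => w q.1 := h.hw.comp continuous_fst
  have hcont : Continuous (fun q => U q + χ q - w q.1) := (h.hU.add hχc.continuous).sub hwc
  have hmem : ((x, t) : Euc N × ℝ) ∈ K := ⟨hta, htb, hx⟩
  obtain ⟨p, hpK, hmax⟩ := hKc.exists_isMaxOn ⟨_, hmem⟩ hcont.continuousOn
  have hmax' : ∀ q ∈ K, U q + χ q - w q.1 ≤ U p + χ p - w p.1 := fun q hq => isMaxOn_iff.1 hmax q hq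
  suffices hs : U p + χ p - w p.1 ≤ ε by
    have h1 := hmax' _ hmem
    simp only [hχ] at h1 hs
    rw [sq (r ^ 2 - ‖x - (a + t • v)‖ ^ 2)]
    linarith
  by_contra hcon
  push Not at hcon
  obtain ⟨hp1, hp2, hp3⟩ := hpK
  have hpin : p.1 ∈ Ω := hb (by simpa [dist_eq_norm] using (hsubK p ⟨hp1, hp2, hp3⟩).le)
  -- lateral
  have hlt : ‖p.1 - (a + p.2 • v)‖ < r := by
    rcases hp3.eq_or_lt with h1 | h1
    · have h2 : χ p = 0 := by simp only [hχ, h1]; simp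
      have h3 := hup p.2 hp1 hp2 p.1 (subset_closure hpin)
      simp only [Prod.mk.eta] at h3
      linarith
    · exact h1
  obtain ⟨G, hG⟩ : ∃ G, G = r ^ 2 - ‖p.1 - (a + p.2 • v)‖ ^ 2 := ⟨_, rfl⟩
  obtain ⟨n, hn⟩ : ∃ n, n = ‖p.1 - (a + p.2 • v)‖ := ⟨_, rfl⟩
  have hn0 : 0 ≤ n := by rw [hn]; positivity
  rw [← hn] at hlt hG
  have hG0 : 0 < G := by rw [hG]; nlinarith
  have hGr : G ≤ r ^ 2 := by rw [hG]; nlinarith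
  -- initial
  have htlt : t1 < p.2 := by
    rcases hp1.eq_or_lt with h1 | h1
    · have h3 := hinit p.1 (by rw [h1]; exact hp3)
      have h2 : χ p ≤ c := by
        simp only [hχ]
        rw [← hn, ← hG, ← h1]
        simp only [sub_self, mul_zero, Real.exp_zero, mul_one]
        calc c / r ^ 4 * (G * G) ≤ c / r ^ 4 * (r ^ 2 * r ^ 2) := by gcongr
          _ = c := by field_simp
      rw [h1] at h3
      simp only [Prod.mk.eta] at h3
      linarith
    · exact h1
  have hsup : SupAt Ω f m (fun q => w q.1) (fun v => ‖v‖ ≤ Λ) p := by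
    have hd : 0 < r0 - ‖p.1 - x0‖ := by linarith [hsubK p ⟨hp1, hp2, hp3⟩]
    have hsb : ball p.1 (r0 - ‖p.1 - x0‖) ⊆ closedBall x0 r0 := by
      refine (ball_subset_ball' ?_).trans ball_subset_closedBall
      rw [dist_eq_norm]; linarith
    exact (h.wsup p (subset_closure hpin)).lip hΛ (hsb.trans hb) hd
      fun y hy z hz => hl y (hsb hy) z (hsb hz)
  have e1 : ∀ᶠ q : Euc N × ℝ in 𝓝 p, ‖q.1 - (a + q.2 • v)‖ < r :=
    (by fun_prop : Continuous fun q : Euc N × ℝ => ‖q.1 - (a + q.2 • v)‖).continuousAt.eventually_lt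
      continuousAt_const (by rw [← hn]; exact hlt)
  have e2 : ∀ᶠ q : Euc N × ℝ in 𝓝 p, t1 < q.2 :=
    continuousAt_const.eventually_lt continuous_snd.continuousAt htlt
  have hkey := cmp_lip h.Ωo h.Ω2 hm h.hf h.hU hwc h.sub hpin (ht1.trans htlt) hsup hχc (by
    filter_upwards [e1, e2] with q h1 h2 _ h3
    exact hmax' q ⟨h2.le, h3.trans hp2, h1.le⟩)
  have hj := tube_jet (c / r ^ 4) lam t1 r a v p
  rw [hj.hdt, hj.hlp, hj.hgr, norm_smul, ← hn, ← hG, ← hC] at hkey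
  obtain ⟨E0, hE0⟩ : ∃ E0, E0 = c / r ^ 4 * Real.exp (-lam * (p.2 - t1)) := ⟨_, rfl⟩
  have hE00 : 0 < E0 := by rw [hE0]; positivity
  rw [← hE0] at hkey
  have h5 : ‖-E0 * 4 * G‖ = E0 * 4 * G := by
    rw [Real.norm_eq_abs, neg_mul, neg_mul, abs_neg, abs_of_pos (by positivity)]
  rw [h5] at hkey
  have h6 : inner ℝ (p.1 - (a + p.2 • v)) v ≤ r * ν := by
    refine (real_inner_le_norm _ _).trans ?_
    rw [← hn]
    have : 0 ≤ ‖v‖ := norm_nonneg v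
    gcongr
  have h7 : 0 ≤ E0 * (4 * G * (r * ν) - lam * G ^ 2 - (8 * n ^ 2 - 4 * N * G) + C * (4 * G * r)) := by
    refine hkey.trans ?_
    have h8 : C * (E0 * 4 * G * n) ≤ C * (E0 * 4 * G * r) := by gcongr
    have h9 : E0 * (4 * G * inner ℝ (p.1 - (a + p.2 • v)) v) ≤ E0 * (4 * G * (r * ν)) := by gcongr
    linarith
  have h8 : 4 * G * (r * ν) - lam * G ^ 2 - (8 * n ^ 2 - 4 * N * G) + C * (4 * G * r)
      = E * G - lam * G ^ 2 - 8 * r ^ 2 := by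
    have : n ^ 2 = r ^ 2 - G := by rw [hG]; ring
    rw [this, hE]; ring
  rw [h8] at h7
  have h9 : E * G - lam * G ^ 2 - 8 * r ^ 2 < 0 := by
    have : 4 * lam * (E * G - lam * G ^ 2 - 8 * r ^ 2) < 0 := by
      nlinarith [sq_nonneg (E - 2 * lam * G)]
    by_contra hh
    push Not at hh
    have := mul_nonneg (by positivity : 0 ≤ 4 * lam) hh
    linarith
  have := mul_neg_of_pos_of_neg hE00 h9
  linarith

end Prop11


/-! ### Part 12: locally uniform convergence in the interior -/

section Prop12

variable {N : ℕ} {Ω : Set (Euc N)} {m : ℝ} {f g : Euc N → ℝ} {U : Euc N × ℝ → ℝ} {w : Euc N → ℝ}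

lemma Setting.strip (h : Setting Ω m f g U w) : ∃ (ψ : Euc N → ℝ) (K : Set (Euc N)),
    ContDiff ℝ 2 ψ ∧ IsCompact K ∧ K ⊆ Ω ∧ ∀ x ∈ closure Ω, x ∉ K →
      - lapl ψ x + ‖gradient ψ x‖ ^ m - f x ≤ -1 := by
  obtain ⟨ρ, hρ, hΩ, hfr, hgrad⟩ := h.Ω2
  have hm := h.hm
  obtain ⟨F, hF0, hF⟩ := h.bdd h.hf
  have hgc : Continuous (fun x => gradient ρ x) := by
    have h1 : ContDiff ℝ 2 (fun q : Euc N × ℝ => ρ q.1) := hρ.comp contDiff_fst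
    exact (continuous_gr h1).comp (by fun_prop : Continuous fun x : Euc N => (x, (0 : ℝ)))
  have hfc : IsCompact (frontier Ω) := h.cpt.of_isClosed_subset isClosed_frontier frontier_subset_closure
  obtain ⟨c, hc0, hc⟩ : ∃ c : ℝ, 0 < c ∧ ∀ x ∈ frontier Ω, c ≤ ‖gradient ρ x‖ ^ 2 := by
    rcases (frontier Ω).eq_empty_or_nonempty with h1 | h1
    · exact ⟨1, one_pos, by simp [h1]⟩
    · obtain ⟨x, hx, hmin⟩ := hfc.exists_isMinOn h1
        (by fun_prop : Continuous fun x => ‖gradient ρ x‖ ^ 2).continuousOn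
      exact ⟨_, by have := norm_pos_iff.2 (hgrad x hx); positivity, fun y hy => isMinOn_iff.1 hmin y hy⟩
  obtain ⟨k, hk⟩ : ∃ k, k = (F + 2) / c := ⟨_, rfl⟩
  have hk0 : 0 < k := by rw [hk]; positivity
  have hkc : k * c = F + 2 := by rw [hk]; field_simp
  have hψ : ContDiff ℝ 2 (fun x => k / 2 * (ρ x * ρ x)) := contDiff_const.mul (hρ.mul hρ)
  have hρρ : ContDiff ℝ 2 (fun x => ρ x * ρ x) := hρ.mul hρ
  set ψ := fun x => k / 2 * (ρ x * ρ x) with hψd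
  have hψ1 : ContDiff ℝ 2 (fun q : Euc N × ℝ => ψ q.1) := hψ.comp contDiff_fst
  have hlc : Continuous (fun x => lapl ψ x) :=
    (continuous_lpl hψ1).comp (by fun_prop : Continuous fun x : Euc N => (x, (0 : ℝ)))
  have hgc' : Continuous (fun x => gradient ψ x) :=
    (continuous_gr hψ1).comp (by fun_prop : Continuous fun x : Euc N => (x, (0 : ℝ)))
  have hn : Continuous (fun x => ‖gradient ψ x‖ ^ m) :=
    hgc'.norm.rpow_const (fun _ => Or.inr (by linarith))
  have hΘ : Continuous (fun x => - lapl ψ x + ‖gradient ψ x‖ ^ m - f x) :=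
    ((hlc.neg).add hn).sub h.hf
  refine ⟨ψ, closure Ω ∩ {x | -1 ≤ - lapl ψ x + ‖gradient ψ x‖ ^ m - f x}, hψ,
    h.cpt.inter_right (isClosed_le continuous_const hΘ), ?_, ?_⟩
  · rintro x ⟨hx1, hx2⟩
    by_contra hx
    have hxf : x ∈ frontier Ω := by rw [h.Ωo.frontier_eq]; exact ⟨hx1, hx⟩
    have hρ0 : ρ x = 0 := by rw [hfr] at hxf; exact hxf
    have e1 : lapl ψ x = k * ‖gradient ρ x‖ ^ 2 := by
      rw [hψd, lapl_const_mul _ hρρ.contDiffAt, lapl_mul hρ.contDiffAt hρ.contDiffAt, hρ0,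
        real_inner_self_eq_norm_sq]
      ring
    have hd : DifferentiableAt ℝ ρ x := hρ.differentiable (by norm_num) x
    have e2 : gradient ψ x = 0 := by
      rw [hψd, gradient_const_mul _ (hρρ.differentiable (by norm_num) x), gradient_mul hd hd, hρ0]
      simp
    have hx3 : -1 ≤ - lapl ψ x + ‖gradient ψ x‖ ^ m - f x := hx2
    rw [e1, e2, norm_zero, Real.zero_rpow (by linarith)] at hx3
    have h4 := (abs_le.1 (hF x hx1)).1
    have h5 : k * c ≤ k * ‖gradient ρ x‖ ^ 2 := mul_le_mul_of_nonneg_left (hc x hxf) hk0.le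
    linarith
  · intro x hx hxK
    by_contra hcon
    push Not at hcon
    exact hxK ⟨hx, hcon.le⟩

lemma tube_num {r d c e : ℝ} (hr : 0 < r) (hd0 : 0 ≤ d) (hd : d ≤ r / 2) (hc : 0 ≤ c) (he : 0 ≤ e) :
    c * e / 2 ≤ c / r ^ 4 * e * (r ^ 2 - d ^ 2) ^ 2 := by
  have h1 : d ^ 2 ≤ r ^ 2 / 4 := by nlinarith
  have h2 : r ^ 4 / 2 ≤ (r ^ 2 - d ^ 2) ^ 2 := by nlinarith [sq_nonneg r]
  calc c * e / 2 = c / r ^ 4 * e * (r ^ 4 / 2) := by field_simp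
    _ ≤ _ := by gcongr

/-- `s` is good along the sequence of times `tn` -/
def Good (U : Euc N × ℝ → ℝ) (w : Euc N → ℝ) (tn : ℕ → ℝ) (s : Set (Euc N)) : Prop :=
  ∃ σ : ℝ, 0 ≤ σ ∧ ∀ L : ℝ, ∃ c > (0 : ℝ), ∀ᶠ n in atTop, ∀ z ∈ s, ∀ t, tn n + σ ≤ t → t ≤ tn n + L →
    U (z, t) - w z ≤ -c

lemma Good.mono {tn : ℕ → ℝ} {s s' : Set (Euc N)} (h : Good U w tn s') (hs : s ⊆ s') :
    Good U w tn s := by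
  obtain ⟨σ, h0, h1⟩ := h
  refine ⟨σ, h0, fun L => ?_⟩
  obtain ⟨c, hc, h2⟩ := h1 L
  refine ⟨c, hc, ?_⟩
  filter_upwards [h2] with n hn z hz
  exact hn z (hs hz)

lemma Good.union {tn : ℕ → ℝ} {s s' : Set (Euc N)} (h : Good U w tn s) (h' : Good U w tn s') :
    Good U w tn (s ∪ s') := by
  obtain ⟨σ, h0, h1⟩ := h
  obtain ⟨σ', h0', h1'⟩ := h'
  refine ⟨max σ σ', le_max_of_le_left h0, fun L => ?_⟩
  obtain ⟨c, hc, h2⟩ := h1 L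
  obtain ⟨c', hc', h2'⟩ := h1' L
  refine ⟨min c c', lt_min hc hc', ?_⟩
  filter_upwards [h2, h2'] with n hn hn' z hz t h3 h4
  rcases hz with hz | hz
  · have := hn z hz t (by linarith [le_max_left σ σ']) h4
    linarith [min_le_left c c']
  · have := hn' z hz t (by linarith [le_max_right σ σ']) h4
    linarith [min_le_right c c']

lemma Good.compact {tn : ℕ → ℝ} {K : Set (Euc N)} (hK : IsCompact K)
    (h : ∀ x ∈ K, ∃ s ∈ 𝓝 x, Good U w tn s) : Good U w tn K := by
  refine hK.induction_on ?_ (fun s t hs ht => ht.mono hs) (fun s t hs ht => hs.union ht) ?_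
  · exact ⟨0, le_rfl, fun L => ⟨1, one_pos, Eventually.of_forall fun n z hz => absurd hz (by simp)⟩⟩
  · intro x hx
    obtain ⟨s, hs, hg⟩ := h x hx
    exact ⟨s, mem_nhdsWithin_of_mem_nhds hs, hg⟩

lemma Setting.good_spread (h : Setting Ω m f g U w)
    (F1 : ∀ ε > (0 : ℝ), ∃ T, 1 ≤ T ∧ ∀ t, T ≤ t → ∀ x ∈ closure Ω, U (x, t) ≤ w x + ε)
    {tn : ℕ → ℝ} (htn : Tendsto tn atTop atTop) {x : Euc N} (hx : x ∈ Ω) :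
    ∃ ρ > (0 : ℝ), ∀ x1 ∈ ball x ρ, ∀ x2 ∈ ball x ρ, (∃ s ∈ 𝓝 x1, Good U w tn s) →
      ∃ s ∈ 𝓝 x2, Good U w tn s := by
  obtain ⟨r0, hr0, hball, Λ, hΛ, hl⟩ := h.wlip x hx
  refine ⟨r0 / 4, by positivity, fun x1 hx1 x2 hx2 hs => ?_⟩
  obtain ⟨s, hs, σ, hσ, hgood⟩ := hs
  obtain ⟨r', hr', hrs⟩ := Metric.nhds_basis_closedBall.mem_iff.1 hs
  obtain ⟨r, hrd⟩ : ∃ r, r = min r' (r0 / 2) := ⟨_, rfl⟩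
  have hr : 0 < r := by rw [hrd]; positivity
  have hrr' : r ≤ r' := by rw [hrd]; exact min_le_left _ _
  have hrr0 : r ≤ r0 / 2 := by rw [hrd]; exact min_le_right _ _
  obtain ⟨lam, hlam, htube⟩ := h.tube hball hΛ hl hr r0
  rw [mem_ball, dist_eq_norm] at hx1 hx2
  refine ⟨closedBall x2 (r / 2), closedBall_mem_nhds _ (by positivity), σ + 1, by linarith, fun L => ?_⟩
  obtain ⟨c, hc, hcn⟩ := hgood L
  obtain ⟨e, he⟩ : ∃ e, e = Real.exp (-lam) := ⟨_, rfl⟩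
  have he0 : 0 < e := by rw [he]; positivity
  obtain ⟨T, hT1, hT⟩ := F1 (c * e / 4) (by positivity)
  refine ⟨c * e / 4, by positivity, ?_⟩
  filter_upwards [hcn, htn.eventually_ge_atTop T] with n hn hnT z hz t ht1 ht2
  rw [mem_closedBall, dist_eq_norm] at hz
  have hpt : ∀ θ : ℝ, x1 - (t - 1) • (x2 - x1) + θ • (x2 - x1) =
      x1 + (θ - (t - 1)) • (x2 - x1) := fun θ => by
    rw [sub_smul θ]; abel
  have e2 : x1 - (t - 1) • (x2 - x1) + t • (x2 - x1) = x2 := by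
    rw [hpt]; rw [show t - (t - 1) = 1 by ring, one_smul]; abel
  have e1 : x1 - (t - 1) • (x2 - x1) + (t - 1) • (x2 - x1) = x1 := by
    rw [hpt]; simp
  have := htube (x1 - (t - 1) • (x2 - x1)) (x2 - x1) (by
      rw [show x2 - x1 = (x2 - x) - (x1 - x) by abel]
      exact (norm_sub_le _ _).trans (by linarith)) (t - 1) t (by linarith) (by
      intro θ h1 h2
      rw [hpt, show x1 + (θ - (t - 1)) • (x2 - x1) - x =
        (1 - (θ - (t - 1))) • (x1 - x) + (θ - (t - 1)) • (x2 - x) by module]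
      have h3 : 0 ≤ θ - (t - 1) := by linarith
      have h4 : 0 ≤ 1 - (θ - (t - 1)) := by linarith
      have h5 := norm_add_le ((1 - (θ - (t - 1))) • (x1 - x)) ((θ - (t - 1)) • (x2 - x))
      rw [norm_smul, norm_smul, Real.norm_of_nonneg h3, Real.norm_of_nonneg h4] at h5
      nlinarith) c (c * e / 4) hc (by positivity) (by
      intro z' hz'
      rw [e1] at hz'
      exact hn z' (hrs (by rw [mem_closedBall, dist_eq_norm]; linarith)) (t - 1) (by linarith)
        (by linarith)) (fun θ h1 h2 => hT θ (by linarith)) t (by linarith) le_rfl z (by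
        rw [e2]; linarith)
  rw [e2, show -lam * (t - (t - 1)) = -lam by ring, ← he] at this
  have h6 := tube_num hr (norm_nonneg (z - x2)) hz hc.le he0.le
  linarith

lemma Setting.good_start (h : Setting Ω m f g U w) {C0 : ℝ} (hC00 : 0 ≤ C0)
    (hC0 : ∀ t, 1 ≤ t → ∀ x ∈ closure Ω, |U (x, t)| ≤ C0)
    (F1 : ∀ ε > (0 : ℝ), ∃ T, 1 ≤ T ∧ ∀ t, T ≤ t → ∀ x ∈ closure Ω, U (x, t) ≤ w x + ε)
    {tn : ℕ → ℝ} (htn : Tendsto tn atTop atTop) {x : Euc N} (hx : x ∈ Ω) {yn : ℕ → Euc N}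
    (hyn : Tendsto yn atTop (𝓝 x)) {δ : ℝ} (hδ : 0 < δ)
    (hle : ∀ n, U (yn n, tn n) ≤ w (yn n) - δ) : ∃ s ∈ 𝓝 x, Good U w tn s := by
  obtain ⟨r0, hr0, hball, Λ, hΛ, hl⟩ := h.wlip x hx
  obtain ⟨τ, r1, hτ0, hτ1, hr1, -, hprop⟩ := h.propagate hC00 hC0 (show 0 < r0 / 2 by positivity)
    (show 0 < δ / 4 by positivity)
  obtain ⟨d, hd0, hd⟩ : ∃ d > (0 : ℝ), ∀ z, ‖z - x‖ < d → |w z - w x| < δ / 8 := by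
    obtain ⟨d, hd, h1⟩ := Metric.continuous_iff.1 h.hw x (δ / 8) (by positivity)
    exact ⟨d, hd, fun z hz => by
      have := h1 z (by rwa [dist_eq_norm])
      rwa [Real.dist_eq] at this⟩
  obtain ⟨r, hrd⟩ : ∃ r, r = min (min (r1 / 2) (r0 / 2)) (d / 2) := ⟨_, rfl⟩
  have hr : 0 < r := by rw [hrd]; positivity
  have ha : r ≤ r1 / 2 := by rw [hrd]; exact (min_le_left _ _).trans (min_le_left _ _)
  have hb : r ≤ r0 / 2 := by rw [hrd]; exact (min_le_left _ _).trans (min_le_right _ _)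
  have hc : r ≤ d / 2 := by rw [hrd]; exact min_le_right _ _
  obtain ⟨lam, hlam, htube⟩ := h.tube hball hΛ hl hr 0
  refine ⟨closedBall x (r / 2), closedBall_mem_nhds _ (by positivity), τ, hτ0.le, fun L => ?_⟩
  obtain ⟨e, he⟩ : ∃ e, e = Real.exp (-lam * L) := ⟨_, rfl⟩
  have he0 : 0 < e := by rw [he]; positivity
  obtain ⟨T, hT1, hT⟩ := F1 (δ / 4 * e / 4) (by positivity)
  refine ⟨δ / 4 * e / 4, by positivity, ?_⟩
  have hyn' : ∀ᶠ n in atTop, ‖yn n - x‖ < r := by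
    filter_upwards [Metric.tendsto_nhds.1 hyn r hr] with n hn
    rwa [dist_eq_norm] at hn
  filter_upwards [hyn', htn.eventually_ge_atTop T] with n hn hnT z hz t ht1 ht2
  rw [mem_closedBall, dist_eq_norm] at hz
  have := htube x 0 (by simp) (tn n + τ) t (by linarith) (by
      intro θ _ _
      simp; linarith) (δ / 4) (δ / 4 * e / 4) (by positivity) (by positivity) (by
      intro z' hz'
      rw [smul_zero, add_zero] at hz'
      have h1 := hprop (yn n) (by
        refine (closedBall_subset_closedBall' ?_).trans hball
        rw [dist_eq_norm]; linarith) (tn n) (by linarith) z' (by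
          rw [show z' - yn n = (z' - x) - (yn n - x) by abel]
          exact (norm_sub_le _ _).trans (by linarith))
      have h2 := hle n
      have h3 := abs_lt.1 (hd z' (by linarith))
      have h4 := abs_lt.1 (hd (yn n) (by linarith))
      linarith) (fun θ h1 h2 => hT θ (by linarith)) t (by linarith) le_rfl z (by
      rw [smul_zero, add_zero]; linarith)
  rw [smul_zero, add_zero] at this
  have h6 := tube_num hr (norm_nonneg (z - x)) hz (show 0 ≤ δ / 4 by positivity)
    (Real.exp_pos (-lam * (t - (tn n + τ)))).le
  have h7 : e ≤ Real.exp (-lam * (t - (tn n + τ))) := by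
    rw [he]; apply Real.exp_le_exp.2; nlinarith
  have h8 : δ / 4 * e ≤ δ / 4 * Real.exp (-lam * (t - (tn n + τ))) := by gcongr
  linarith

/-- a good compact set containing the complement of the strip is impossible -/
lemma Setting.good_false (h : Setting Ω m f g U w) {C0 : ℝ}
    (hC0 : ∀ t, 1 ≤ t → ∀ x ∈ closure Ω, |U (x, t)| ≤ C0)
    (F1 : ∀ ε > (0 : ℝ), ∃ T, 1 ≤ T ∧ ∀ t, T ≤ t → ∀ x ∈ closure Ω, U (x, t) ≤ w x + ε)
    (F2 : ∀ t, 1 ≤ t → ∃ x ∈ closure Ω, w x ≤ U (x, t))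
    {tn : ℕ → ℝ} (htn : Tendsto tn atTop atTop) {ψ : Euc N → ℝ} {K : Set (Euc N)}
    (hψ : ContDiff ℝ 2 ψ)
    (hK : ∀ x ∈ closure Ω, x ∉ K → - lapl ψ x + ‖gradient ψ x‖ ^ m - f x ≤ -1)
    (hgood : Good U w tn K) : False := by
  obtain ⟨σ, hσ, hg⟩ := hgood
  obtain ⟨Cψ, hCψ0, hCψ⟩ := h.bdd hψ.continuous
  obtain ⟨C, hC⟩ : ∃ C, C = Cψ + |C0| := ⟨_, rfl⟩
  have hC0' : 0 ≤ C := by rw [hC]; positivity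
  have hCb : ∀ t, 1 ≤ t → ∀ x ∈ closure Ω, |ψ x - U (x, t)| ≤ C := fun t ht x hx => by
    rw [hC]
    exact (abs_sub _ _).trans (add_le_add (hCψ x hx) ((hC0 t ht x hx).trans (le_abs_self _)))
  obtain ⟨L, hL⟩ : ∃ L, L = 4 * C + 4 := ⟨_, rfl⟩
  obtain ⟨c, hc, hcn⟩ := hg (σ + L)
  obtain ⟨ν, hν⟩ : ∃ ν, ν = min (1 / 2) (c / (2 * C + 2)) := ⟨_, rfl⟩
  have hν0 : 0 < ν := by rw [hν]; positivity
  have hν1 : ν ≤ 1 / 2 := by rw [hν]; exact min_le_left _ _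
  have hνc : ν * (2 * C + 2) ≤ c := by
    rw [← le_div_iff₀ (by positivity), hν]; exact min_le_right _ _
  obtain ⟨T, hT1, hT⟩ := F1 ν hν0
  obtain ⟨n, hn, hnT⟩ := (hcn.and (htn.eventually_ge_atTop T)).exists
  obtain ⟨t1, ht1⟩ : ∃ t1, t1 = tn n + σ := ⟨_, rfl⟩
  have hstrip := cmp_strip h.Ωo h.Ωb h.Ω2 h.hm h.hf h.hU (h.hw.comp continuous_fst) h.sub
    (μ := 1 - ν) (by linarith) (by linarith) hψ (a := ν / 2) (S := Kᶜ) (t1 := t1) (t2 := t1 + L)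
    (B := ν + ν * C + ν / 2 * t1) (by
      intro x hx hxK
      have := hK x hx hxK
      rw [sub_sub_cancel]
      nlinarith) (by linarith) (by
      intro x hx t hta htb hcase
      have hCx := (abs_le.1 (hCb t (by linarith) x hx)).2
      have h1 : ν * (ψ x - U (x, t)) ≤ ν * C := by gcongr
      change (1 - ν) * U (x, t) + ((1 - (1 - ν)) * ψ x + ν / 2 * t) - w x ≤ _
      rcases hcase with h2 | h2 | h2
      · have h3 := hT t (by linarith) x hx
        rw [← h2]
        linarith
      · have h3 := hn x (not_notMem.1 h2) t (by linarith) (by linarith)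
        have h4 : ν / 2 * t ≤ ν / 2 * (t1 + L) := by gcongr
        rw [hL] at h4
        linarith
      · exact absurd (h.wsup (x, t) hx) h2)
  obtain ⟨x, hx, hxw⟩ := F2 (t1 + L) (by linarith)
  have h1 := hstrip x hx (t1 + L) (by linarith) le_rfl
  change (1 - ν) * U (x, t1 + L) + ((1 - (1 - ν)) * ψ x + ν / 2 * (t1 + L)) - w x ≤ _ at h1
  have hCx := (abs_le.1 (hCb (t1 + L) (by linarith) x hx)).1
  have h2 : ν * -C ≤ ν * (ψ x - U (x, t1 + L)) := by gcongr
  rw [hL] at h1 h2 hxw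
  linarith

/-- convergence from below, locally uniformly in `Ω` -/
lemma Setting.interior_lower (h : Setting Ω m f g U w) {C0 : ℝ} (hC00 : 0 ≤ C0)
    (hC0 : ∀ t, 1 ≤ t → ∀ x ∈ closure Ω, |U (x, t)| ≤ C0)
    (F1 : ∀ ε > (0 : ℝ), ∃ T, 1 ≤ T ∧ ∀ t, T ≤ t → ∀ x ∈ closure Ω, U (x, t) ≤ w x + ε)
    (F2 : ∀ t, 1 ≤ t → ∃ x ∈ closure Ω, w x ≤ U (x, t))
    {K : Set (Euc N)} (hK : IsCompact K) (hKΩ : K ⊆ Ω) {δ : ℝ} (hδ : 0 < δ) :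
    ∃ T, 1 ≤ T ∧ ∀ t, T ≤ t → ∀ x ∈ K, w x - δ ≤ U (x, t) := by
  by_contra hcon
  push Not at hcon
  have hseq : ∀ n : ℕ, ∃ p : Euc N × ℝ, (n : ℝ) + 1 ≤ p.2 ∧ p.1 ∈ K ∧ U p < w p.1 - δ := fun n => by
    obtain ⟨t, ht, x, hx, hlt⟩ := hcon (n + 1) (by linarith [n.cast_nonneg (α := ℝ)])
    exact ⟨(x, t), ht, hx, hlt⟩
  choose p hp1 hp2 hp3 using hseq
  obtain ⟨y, hyK, φ, hφ, hy⟩ := hK.tendsto_subseq hp2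
  obtain ⟨tn, htn⟩ : ∃ tn : ℕ → ℝ, tn = fun n => (p (φ n)).2 := ⟨_, rfl⟩
  have htn' : Tendsto tn atTop atTop := by
    refine tendsto_atTop_mono (f := fun n : ℕ => (n : ℝ)) (fun n => ?_) tendsto_natCast_atTop_atTop
    have h1 : (n : ℝ) ≤ φ n := by exact_mod_cast hφ.id_le n
    have h2 := hp1 (φ n)
    rw [htn]
    simp only
    linarith
  have hstart := h.good_start hC00 hC0 F1 htn' (hKΩ hyK) hy hδ (fun n => by
    have := (hp3 (φ n)).le
    rw [htn]
    exact this)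
  have hsub : Ω ⊆ {x | ∃ ρ > (0 : ℝ), ∀ z ∈ ball x ρ, ∃ s ∈ 𝓝 z, Good U w tn s} := by
    refine h.Ωc.isPreconnected.subset_of_closure_inter_subset ?_ ⟨y, hKΩ hyK, ?_⟩ ?_
    · rw [Metric.isOpen_iff]
      rintro x ⟨ρ, hρ, hx⟩
      refine ⟨ρ / 2, by positivity, fun z hz => ⟨ρ / 2, by positivity, fun z' hz' => hx z' ?_⟩⟩
      rw [mem_ball] at *
      linarith [dist_triangle z' z x]
    · obtain ⟨ρ, hρ, hs⟩ := h.good_spread F1 htn' (hKΩ hyK)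
      exact ⟨ρ, hρ, fun z hz => hs y (mem_ball_self hρ) z hz hstart⟩
    · rintro x ⟨hx1, hx2⟩
      obtain ⟨ρ, hρ, hs⟩ := h.good_spread F1 htn' hx2
      obtain ⟨x', ⟨ρ', hρ', hx'⟩, hd⟩ := Metric.mem_closure_iff.1 hx1 ρ hρ
      exact ⟨ρ, hρ, fun z hz => hs x' (by rwa [mem_ball, dist_comm]) z hz
        (hx' x' (mem_ball_self hρ'))⟩
  obtain ⟨ψ, K', hψ, hK', hK'Ω, hstrip⟩ := h.strip
  refine h.good_false hC0 F1 F2 htn' hψ hstrip (Good.compact hK' fun x hx => ?_)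
  obtain ⟨ρ, hρ, h1⟩ := hsub (hK'Ω hx)
  exact h1 x (mem_ball_self hρ)

end Prop12


/-! ### Part 13: the boundary inequality and uniform convergence -/

section Prop13

variable {N : ℕ} {Ω : Set (Euc N)} {m : ℝ} {f g : Euc N → ℝ} {U : Euc N × ℝ → ℝ} {w : Euc N → ℝ}

set_option maxHeartbeats 800000 in
lemma Setting.bd_barrier (h : Setting Ω m f g U w) {C0 : ℝ} (hC00 : 0 ≤ C0)
    (hC0 : ∀ t, 1 ≤ t → ∀ x ∈ closure Ω, |U (x, t)| ≤ C0) {x0 : Euc N} (hx0 : x0 ∈ frontier Ω)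
    {ε : ℝ} (hε : 0 < ε) : ∃ (r D : ℝ) (β : Euc N → ℝ), 0 < r ∧ Continuous β ∧ β x0 = 0 ∧
      ∀ x ∈ closure Ω, ‖x - x0‖ ≤ r → ∀ t, 1 ≤ t →
        U (x, t) ≤ g x0 + ε + β x + D * Real.exp (-(t - 1)) := by
  obtain ⟨ρ, hρ, hΩ, hfr, hgrad⟩ := h.Ω2
  have hm := h.hm
  obtain ⟨F, hF0, hF⟩ := h.bdd h.hf
  have hρ1 : ContDiff ℝ 2 (fun q : Euc N × ℝ => ρ q.1) := hρ.comp contDiff_fst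
  have hgc : Continuous (fun x => gradient ρ x) :=
    (continuous_gr hρ1).comp (by fun_prop : Continuous fun x : Euc N => (x, (0 : ℝ)))
  have hlc : Continuous (fun x => lapl ρ x) :=
    (continuous_lpl hρ1).comp (by fun_prop : Continuous fun x : Euc N => (x, (0 : ℝ)))
  obtain ⟨B, hB0, hB⟩ := h.bdd hlc
  have hn0 : 0 < ‖gradient ρ x0‖ := norm_pos_iff.2 (hgrad x0 hx0)
  obtain ⟨c1, hc1⟩ : ∃ c1, c1 = ‖gradient ρ x0‖ / 2 := ⟨_, rfl⟩
  have hc10 : 0 < c1 := by rw [hc1]; positivity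
  obtain ⟨r, hr, hr'⟩ : ∃ r > (0 : ℝ), ∀ x, ‖x - x0‖ ≤ r → c1 < ‖gradient ρ x‖ ∧ g x < g x0 + ε := by
    have h1 : ∀ᶠ x in 𝓝 x0, c1 < ‖gradient ρ x‖ :=
      continuousAt_const.eventually_lt hgc.norm.continuousAt (by rw [hc1]; linarith)
    have h2 : ∀ᶠ x in 𝓝 x0, g x < g x0 + ε :=
      h.hg.continuousAt.eventually_lt continuousAt_const (by linarith)
    obtain ⟨r, hr, hs⟩ := Metric.nhds_basis_closedBall.mem_iff.1 (h1.and h2)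
    exact ⟨r, hr, fun x hx => hs (by rwa [mem_closedBall, dist_eq_norm])⟩
  obtain ⟨D, hD⟩ : ∃ D, D = C0 + |g x0| := ⟨_, rfl⟩
  have hD0 : 0 ≤ D := by rw [hD]; positivity
  obtain ⟨A, hA⟩ : ∃ A, A = D / r ^ 2 := ⟨_, rfl⟩
  have hA0 : 0 ≤ A := by rw [hA]; positivity
  have hAr : A * r ^ 2 = D := by rw [hA]; field_simp
  obtain ⟨G, hG⟩ : ∃ G, G = B + D + 2 * N * A + F + 1 := ⟨_, rfl⟩
  have hG0 : 0 ≤ G := by rw [hG]; positivity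
  obtain ⟨k, hk⟩ : ∃ k, k = (4 * A * r + 4) / c1 + 4 * G / c1 ^ 2 + 1 := ⟨_, rfl⟩
  have hk1 : 1 ≤ k := by
    rw [hk]
    have : 0 ≤ (4 * A * r + 4) / c1 + 4 * G / c1 ^ 2 := by positivity
    linarith
  have hk2 : 4 * A * r + 4 ≤ k * c1 := by
    rw [← div_le_iff₀ hc10, hk]
    have : 0 ≤ 4 * G / c1 ^ 2 := by positivity
    linarith
  have hk3 : 4 * G ≤ k * c1 ^ 2 := by
    rw [← div_le_iff₀ (by positivity), hk]
    have : 0 ≤ (4 * A * r + 4) / c1 := by positivity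
    linarith
  have hρx0 : ρ x0 = 0 := by rw [hfr] at hx0; exact hx0
  refine ⟨r, D, fun x => A * ‖x - x0‖ ^ 2 - k * ρ x, hr, ?_, by simp [hρx0], ?_⟩
  · have := hρ.continuous
    fun_prop
  intro x hx hxr t ht
  have hcl : ∀ z ∈ closure Ω, ρ z ≤ 0 := fun z hz => closure_le hρ hΩ hz
  have hgx := le_abs_self (g x0)
  have hgx' := neg_abs_le (g x0)
  have hkey := h.loc_cmp (y := x0) (R := r) (t1 := 1) (t2 := t) one_pos
    (b := fun q => ((g x0 + ε) + (A * ‖q.1 - x0‖ ^ 2 - k * ρ q.1)) + D * Real.exp (-(q.2 - 1))) (by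
      intro z hz hzr θ h1 h2
      have hT : HasJet (fun q : Euc N × ℝ => D * Real.exp (-(q.2 - 1))) (z, θ)
          (-(D * Real.exp (-(θ - 1)))) 0 0 := by
        refine HasJet.time (T := fun s : ℝ => D * Real.exp (-(s - 1))) ?_ ?_
        · exact ContDiff.contDiffAt (by fun_prop)
        · have := ((((hasDerivAt_id θ).sub_const 1).neg).exp).const_mul D
          refine this.congr_deriv ?_
          simp
      have hj := ((HasJet.const (g x0 + ε) (z, θ)).add (((HasJet.normsq x0 (z, θ)).const_mul A).sub
        ((HasJet.space (T := ρ) (p := (z, θ)) hρ.contDiffAt).const_mul k))).add hT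
      refine ⟨_, _, _, hj, ?_⟩
      simp only [zero_add, add_zero, mul_zero, sub_zero]
      have h3 := (abs_le.1 (hF z hz)).2
      have h4 := (abs_le.1 (hB z hz)).1
      have h5 : D * Real.exp (-(θ - 1)) ≤ D * 1 := by
        gcongr
        exact Real.exp_le_one_iff.2 (by linarith)
      obtain ⟨n, hn⟩ : ∃ n, n = ‖A • (2 : ℝ) • (z - x0) - k • gradient ρ z‖ := ⟨_, rfl⟩
      have h6 : k * c1 - 2 * A * r ≤ n := by
        have e1 : ‖k • gradient ρ z‖ = k * ‖gradient ρ z‖ := by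
          rw [norm_smul, Real.norm_of_nonneg (by linarith)]
        have e2 : ‖A • (2 : ℝ) • (z - x0)‖ = A * (2 * ‖z - x0‖) := by
          rw [norm_smul, norm_smul, Real.norm_of_nonneg hA0]; simp
        have e3 := norm_sub_norm_le (k • gradient ρ z) (A • (2 : ℝ) • (z - x0))
        rw [norm_sub_rev, e1, e2, ← hn] at e3
        have e4 : k * c1 ≤ k * ‖gradient ρ z‖ :=
          mul_le_mul_of_nonneg_left (hr' z hzr).1.le (by linarith)
        have e5 : A * (2 * ‖z - x0‖) ≤ A * (2 * r) := by gcongr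
        linarith
      have h7 : k * c1 / 2 ≤ n := by linarith
      have hAr0 : 0 ≤ A * r := by positivity
      have h8 : 1 ≤ n := by linarith
      have h9 : n ^ 2 ≤ n ^ m := by
        rw [← Real.rpow_natCast]
        exact Real.rpow_le_rpow_of_exponent_le h8 (by push_cast; linarith)
      have h10 : (k * c1 / 2) ^ 2 ≤ n ^ 2 := by
        have : 0 ≤ k * c1 / 2 := by positivity
        gcongr
      have h11 : k * G ≤ (k * c1 / 2) ^ 2 := by
        have := mul_le_mul_of_nonneg_left hk3 (by linarith : 0 ≤ k)
        linarith
      have h12 : k * B + (D + 2 * N * A + F + 1) ≤ k * G := by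
        have : 0 ≤ D + 2 * N * A + F + 1 := by positivity
        have e1 := mul_le_mul_of_nonneg_right hk1 this
        rw [hG]; linarith
      have h13 : k * -B ≤ k * lapl ρ z := mul_le_mul_of_nonneg_left h4 (by linarith)
      rw [← hn]
      linarith) (by
      intro z hz hzr θ h1 h2
      have h3 := (hr' z hzr.le).2
      have h4 := hcl z (frontier_subset_closure hz)
      have h5 : 0 ≤ A * ‖z - x0‖ ^ 2 := by positivity
      have h6 : 0 ≤ D * Real.exp (-(θ - 1)) := by positivity
      have h7 : k * ρ z ≤ 0 := mul_nonpos_of_nonneg_of_nonpos (by linarith) h4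
      beta_reduce
      simp only
      linarith) (by
      intro z hz hzr
      have h4 := hcl z hz
      have h5 : 0 ≤ A * ‖z - x0‖ ^ 2 := by positivity
      have h7 : k * ρ z ≤ 0 := mul_nonpos_of_nonneg_of_nonpos (by linarith) h4
      have h8 := (abs_le.1 (hC0 1 le_rfl z hz)).2
      simp only [sub_self, neg_zero, Real.exp_zero]
      linarith) (by
      intro z hz hzr θ h1 h2
      have h4 := hcl z hz
      have h6 : 0 ≤ D * Real.exp (-(θ - 1)) := by positivity
      have h7 : k * ρ z ≤ 0 := mul_nonpos_of_nonneg_of_nonpos (by linarith) h4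
      have h8 := (abs_le.1 (hC0 θ h1 z hz)).2
      simp only [hzr]
      linarith) x hx hxr t ht le_rfl
  exact hkey

lemma Setting.le_bd (h : Setting Ω m f g U w) {C0 : ℝ} (hC00 : 0 ≤ C0)
    (hC0 : ∀ t, 1 ≤ t → ∀ x ∈ closure Ω, |U (x, t)| ≤ C0)
    (hlow : ∀ K : Set (Euc N), IsCompact K → K ⊆ Ω → ∀ δ > (0 : ℝ),
      ∃ T, 1 ≤ T ∧ ∀ t, T ≤ t → ∀ x ∈ K, w x - δ ≤ U (x, t))
    {x0 : Euc N} (hx0 : x0 ∈ frontier Ω) : w x0 ≤ g x0 := by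
  refine le_of_forall_pos_le_add fun ε hε => ?_
  obtain ⟨r, D, β, hr, hβ, hβ0, hle⟩ := h.bd_barrier hC00 hC0 hx0 hε
  have hin : ∀ x ∈ Ω, ‖x - x0‖ ≤ r → w x ≤ g x0 + ε + β x := by
    intro x hx hxr
    refine le_of_forall_pos_le_add fun δ hδ => ?_
    obtain ⟨T, hT1, hT⟩ := hlow {x} isCompact_singleton (by simpa using hx) (δ / 2) (by positivity)
    have hlim : Tendsto (fun t : ℝ => D * Real.exp (-(t - 1))) atTop (𝓝 0) := by
      have h1 : Tendsto (fun t : ℝ => t - 1) atTop atTop := tendsto_atTop_add_const_right _ _ tendsto_id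
      simpa using (Real.tendsto_exp_neg_atTop_nhds_zero.comp h1).const_mul D
    obtain ⟨t, ht1, ht2⟩ := ((hlim.eventually_lt_const (show 0 < δ / 2 by positivity)).and
      (eventually_ge_atTop T)).exists
    have h2 := hT t ht2 x rfl
    have h3 := hle x (subset_closure hx) hxr t (by linarith)
    linarith
  have hne : (𝓝[Ω] x0).NeBot := mem_closure_iff_nhdsWithin_neBot.1 (frontier_subset_closure hx0)
  have h1 : Tendsto w (𝓝[Ω] x0) (𝓝 (w x0)) := h.hw.continuousAt.mono_left nhdsWithin_le_nhds
  have h2 : Tendsto (fun x => g x0 + ε + β x) (𝓝[Ω] x0) (𝓝 (g x0 + ε + β x0)) :=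
    ((by fun_prop : Continuous fun x => g x0 + ε + β x).continuousAt).mono_left nhdsWithin_le_nhds
  have := le_of_tendsto_of_tendsto h1 h2 (by
    filter_upwards [self_mem_nhdsWithin,
      mem_nhdsWithin_of_mem_nhds (closedBall_mem_nhds x0 hr)] with x hx hxr
    exact hin x hx (by rwa [mem_closedBall, dist_eq_norm] at hxr))
  rwa [hβ0, add_zero] at this

lemma Setting.strip_lower (h : Setting Ω m f g U w) {C0 : ℝ}
    (hC0 : ∀ t, 1 ≤ t → ∀ x ∈ closure Ω, |U (x, t)| ≤ C0)
    (hlow : ∀ K : Set (Euc N), IsCompact K → K ⊆ Ω → ∀ δ > (0 : ℝ),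
      ∃ T, 1 ≤ T ∧ ∀ t, T ≤ t → ∀ x ∈ K, w x - δ ≤ U (x, t))
    (hbd : ∀ x ∈ frontier Ω, w x ≤ g x) {ε : ℝ} (hε : 0 < ε) :
    ∃ T, 1 ≤ T ∧ ∀ t, T ≤ t → ∀ x ∈ closure Ω, w x - ε ≤ U (x, t) := by
  obtain ⟨ψ, K, hψ, hK, hKΩ, hstrip⟩ := h.strip
  obtain ⟨C, hC, hCb⟩ := h.bdd (hψ.continuous.sub h.hw)
  obtain ⟨Cw, hCw, hCwb⟩ := h.bdd h.hw
  obtain ⟨D, hD⟩ : ∃ D, D = Cw + |C0| := ⟨_, rfl⟩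
  have hD0 : 0 ≤ D := by rw [hD]; positivity
  obtain ⟨ν, hν⟩ : ∃ ν, ν = min (1 / 2) (ε / 2 / (2 * C + 1)) := ⟨_, rfl⟩
  have hν0 : 0 < ν := by rw [hν]; positivity
  have hν1 : ν ≤ 1 / 2 := by rw [hν]; exact min_le_left _ _
  have hνC : ν * (2 * C + 1) ≤ ε / 2 := by
    rw [← le_div_iff₀ (by positivity), hν]; exact min_le_right _ _
  obtain ⟨L, hL⟩ : ∃ L, L = 2 * D / ν := ⟨_, rfl⟩
  have hL0 : 0 ≤ L := by rw [hL]; positivity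
  have hνL : ν / 2 * L = D := by rw [hL]; field_simp
  obtain ⟨T, hT1, hT⟩ := hlow K hK hKΩ (ε / 2) (by positivity)
  refine ⟨T + L, by linarith, fun t ht x hx => ?_⟩
  obtain ⟨t1, ht1⟩ : ∃ t1, t1 = t - L := ⟨_, rfl⟩
  have hst := cmp_strip h.Ωo h.Ωb h.Ω2 h.hm h.hf (h.hw.comp continuous_fst) h.hU h.wsub
    (μ := 1 - ν) (by linarith) (by linarith) hψ (a := ν / 2) (S := Kᶜ) (t1 := t1) (t2 := t)
    (B := ε / 2 + ν * C + ν / 2 * t1 + D) (by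
      intro x hx hxK
      have := hstrip x hx hxK
      rw [sub_sub_cancel]
      nlinarith) (by linarith) (by
      intro z hz θ hta htb hcase
      have hCx := (abs_le.1 (hCb z hz)).2
      have h1 : ν * (ψ z - w z) ≤ ν * C := by gcongr; exact hCx
      have h4 : ν / 2 * θ ≤ ν / 2 * (t1 + L) := by
        gcongr; linarith
      change (1 - ν) * w z + ((1 - (1 - ν)) * ψ z + ν / 2 * θ) - U (z, θ) ≤ _
      rcases hcase with h2 | h2 | h2
      · have h3 := (abs_le.1 (hCwb z hz)).2
        have h5 := (abs_le.1 ((hC0 θ (by linarith) z hz).trans (le_abs_self _))).1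
        rw [← h2]
        linarith
      · have h3 := hT θ (by linarith) z (not_notMem.1 h2)
        linarith
      · have h3 : ¬ (z ∈ Ω ∨ U (z, θ) < g z) := fun hh =>
          h2 (h.sup (z, θ) hz (by simp only; linarith) hh)
        push Not at h3
        have h5 := hbd z (by rw [h.Ωo.frontier_eq]; exact ⟨hz, h3.1⟩)
        linarith [h3.2]) x hx t (by linarith) le_rfl
  change (1 - ν) * w x + ((1 - (1 - ν)) * ψ x + ν / 2 * t) - U (x, t) ≤ _ at hst
  have hCx := (abs_le.1 (hCb x hx)).1
  have h2 : ν * -C ≤ ν * (ψ x - w x) := by gcongr; exact hCx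
  have h3 : t = t1 + L := by linarith
  rw [show ν / 2 * t = ν / 2 * t1 + ν / 2 * L by rw [h3]; ring] at hst
  linarith

theorem Setting.core (h : Setting Ω m f g U w) : ∃ M : ℝ, (∀ x ∈ frontier Ω, w x + M ≤ g x) ∧
    ∀ ε > (0 : ℝ), ∃ T, ∀ t, T ≤ t → ∀ x ∈ closure Ω, |U (x, t) - (w x + M)| ≤ ε := by
  obtain ⟨M, C0, hC00, hC0, F1, F2⟩ := h.limit_const
  have hs := h.shift M
  have hlow : ∀ K : Set (Euc N), IsCompact K → K ⊆ Ω → ∀ δ > (0 : ℝ),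
      ∃ T, 1 ≤ T ∧ ∀ t, T ≤ t → ∀ x ∈ K, (w x + M) - δ ≤ U (x, t) :=
    fun K hK hKΩ δ hδ => hs.interior_lower hC00 hC0 F1 F2 hK hKΩ hδ
  have hbd : ∀ x ∈ frontier Ω, w x + M ≤ g x := fun x hx => hs.le_bd hC00 hC0 hlow hx
  refine ⟨M, hbd, fun ε hε => ?_⟩
  obtain ⟨T1, -, hT1⟩ := F1 ε hε
  obtain ⟨T2, -, hT2⟩ := hs.strip_lower hC0 hlow hbd hε
  refine ⟨max T1 T2, fun t ht x hx => abs_le.2 ⟨?_, ?_⟩⟩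
  · have := hT2 t ((le_max_right _ _).trans ht) x hx
    linarith
  · have := hT1 t ((le_max_left _ _).trans ht) x hx
    linarith

end Prop13


/-- Long-time behavior when the ergodic constant vanishes,
Theorem 4.1 (B)(iii) of the paper. -/
theorem stmt19 {N : ℕ} (hN : 1 ≤ N) (Ω : Set (Euc N))
    (hΩo : IsOpen Ω) (hΩb : Bornology.IsBounded Ω) (hΩc : IsConnected Ω)
    (hΩ2 : HasC2Boundary Ω)
    (m : ℝ) (hm : 2 < m)
    (f u₀ g : Euc N → ℝ)
    (hf : ContinuousOn f (closure Ω)) (hu₀ : ContinuousOn u₀ (closure Ω))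
    (hg : ContinuousOn g (frontier Ω))
    (hcomp : ∀ x ∈ frontier Ω, u₀ x = g x)
    (u : Euc N → ℝ → ℝ) (hu : IsGlobalParSol Ω f g u₀ 0 m u)
    (c : ℝ) (uInf : Euc N → ℝ)
    (hHol : HolderOnCl ((m - 2) / (m - 1)) (closure Ω) uInf)
    (hLip : LocLipIn Ω uInf)
    (hErg : IsSCSolution Ω (fun x => f x + c) 0 m uInf)
    (hczero : c = 0) :
    (∀ w : Euc N → ℝ, ContinuousOn w (closure Ω) →
      IsStatSub Ω f g 0 m w → IsStatSuper Ω f g 0 m w →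
      ∃ Cc : ℝ, (∀ x ∈ closure Ω, w x = uInf x - Cc) ∧
        ∀ x ∈ frontier Ω, uInf x - Cc ≤ g x) ∧
    ∃ Ctil : ℝ, (∀ x ∈ frontier Ω, uInf x - Ctil ≤ g x) ∧
      TendstoUniformlyOn (fun t x => u x t)
        (fun x => uInf x - Ctil) atTop (closure Ω) := by
  subst hczero
  simp only [add_zero] at hErg
  refine ⟨fun w hw h1 h2 => ?_, ?_⟩
  · obtain ⟨f', g', U, w', hS, hg', hw', hU⟩ := setting_of hΩo hΩb hΩc hΩ2 hm hf hg
      (par_of_stat hw h1 h2) hLip hErg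
    obtain ⟨M, hM, hconv⟩ := hS.core
    refine ⟨-M, fun x hx => ?_, fun x hx => ?_⟩
    · have h3 : |w x - (uInf x + M)| ≤ 0 := by
        refine le_of_forall_pos_le_add fun ε hε => ?_
        obtain ⟨T, hT⟩ := hconv ε hε
        have h4 := hT (max T 0) (le_max_left _ _) x hx
        rw [hU x hx _ (le_max_right _ _), hw' x hx] at h4
        linarith
      have h4 := abs_eq_zero.1 (le_antisymm h3 (abs_nonneg _))
      linarith
    · have h3 := hM x hx
      rw [hw' x (frontier_subset_closure hx), hg' x hx] at h3
      linarith
  · obtain ⟨f', g', U, w', hS, hg', hw', hU⟩ := setting_of hΩo hΩb hΩc hΩ2 hm hf hg hu hLip hErg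
    obtain ⟨M, hM, hconv⟩ := hS.core
    refine ⟨-M, fun x hx => ?_, ?_⟩
    · have h3 := hM x hx
      rw [hw' x (frontier_subset_closure hx), hg' x hx] at h3
      linarith
    · rw [Metric.tendstoUniformlyOn_iff]
      intro ε hε
      obtain ⟨T, hT⟩ := hconv (ε / 2) (by positivity)
      filter_upwards [eventually_ge_atTop T, eventually_ge_atTop 0] with t ht ht0 x hx
      have h4 := hT t ht x hx
      rw [hU x hx t ht0, hw' x hx] at h4
      rw [dist_comm, Real.dist_eq, sub_neg_eq_add]
      linarith
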